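/- arXiv:1308.3046 — 3 statements merged into one kernel-verified Lean document; each statement's English description precedes it below -/
import Mathlib

section
/- For every integer k ≥ 6, the complete k-partite graph K_{4,3*2,2*(k-6),1*3} (one part of size 4, two parts of size 3, k−6 parts of size 2, and three parts of size 1) has choice number exactly k. -/
/-- `G` has a proper coloring in which every vertex gets a color from its own list. -/
def ListColorable {V : Type*} (G : SimpleGraph V) (L : V → Finset ℕ) : Prop :=
  ∃ c : V → ℕ, (∀ v, c v ∈ L v) ∧ ∀ ⦃u w⦄, G.Adj u w → c u ≠ c w

/-- `G` is `k`-choosable: `L`-colorable for every list assignment with all lists of size ≥ `k`. -/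
def Choosable {V : Type*} (G : SimpleGraph V) (k : ℕ) : Prop :=
  ∀ L : V → Finset ℕ, (∀ v, k ≤ (L v).card) → ListColorable G L

namespace Ohba

/-- List coloring of the complete multipartite graph on `S` with part function `π`. -/
def LC {V ι : Type} (π : V → ι) (S : Finset V) (L : V → Finset ℕ) : Prop :=
  ∃ c : V → ℕ, (∀ v ∈ S, c v ∈ L v) ∧ ∀ u ∈ S, ∀ w ∈ S, π u ≠ π w → c u ≠ c w

theorem LC.mono {V ι : Type} {π : V → ι} {S S' : Finset V} {L L' : V → Finset ℕ}
    (h : LC π S' L') (hS : S ⊆ S') (hL : ∀ v ∈ S, L' v ⊆ L v) : LC π S L := by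
  obtain ⟨c, hc, hp⟩ := h
  exact ⟨c, fun v hv => hL v hv (hc v (hS hv)), fun u hu w hw => hp u (hS hu) w (hS hw)⟩

theorem LC.step {V ι : Type} [DecidableEq V] [DecidableEq ι] {π : V → ι} {S : Finset V}
    {L : V → Finset ℕ} (T : Finset V) (i : ι) (c : ℕ) (hT : ∀ v ∈ T, π v = i ∧ c ∈ L v)
    (h : LC π (S \ T) (fun v => if π v = i then L v else L v \ {c})) : LC π S L := by
  obtain ⟨f, hf, hp⟩ := h
  have key : ∀ w ∈ S, w ∉ T → π w ≠ i → f w ≠ c := by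
    intro w hw hwT hwi
    have := hf w (by simp [hw, hwT])
    simp only [hwi, if_false, Finset.mem_sdiff, Finset.mem_singleton] at this
    exact this.2
  refine ⟨fun v => if v ∈ T then c else f v, ?_, ?_⟩
  · intro v hv
    by_cases hvT : v ∈ T
    · simpa [hvT] using (hT v hvT).2
    · simp only [hvT, if_false]
      have := hf v (by simp [hv, hvT])
      dsimp only at this
      split_ifs at this
      · exact this
      · exact (Finset.mem_sdiff.1 this).1
  · intro u hu w hw huw
    by_cases huT : u ∈ T <;> by_cases hwT : w ∈ T
    · exact absurd ((hT u huT).1.trans (hT w hwT).1.symm) huw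
    · simp only [huT, hwT, if_true, if_false]
      exact (key w hw hwT (fun h => huw ((hT u huT).1.trans h.symm))).symm
    · simp only [huT, hwT, if_true, if_false]
      exact (key u hu huT (fun h => huw (h.trans (hT w hwT).1.symm)))
    · simp only [huT, hwT, if_false]
      exact hp u (by simp [hu, huT]) w (by simp [hw, hwT]) huw

theorem LC.step' {V ι : Type} [DecidableEq V] [DecidableEq ι] {π : V → ι} {S : Finset V}
    {L : V → Finset ℕ} (T : Finset V) (i : ι) (c : ℕ) (hT : ∀ v ∈ T, π v = i ∧ c ∈ L v)
    (h : LC π (S \ T) (fun v => L v \ {c})) : LC π S L := by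
  refine LC.step T i c hT (h.mono (Finset.Subset.refl _) ?_)
  intro v _
  split_ifs
  · exact Finset.sdiff_subset
  · exact Finset.Subset.refl _

theorem LC.of_hall {V ι : Type} [DecidableEq V] {π : V → ι} {S : Finset V}
    {L : V → Finset ℕ} (h : ∀ X ⊆ S, X.card ≤ (X.biUnion L).card) : LC π S L := by
  have := (Finset.all_card_le_biUnion_card_iff_exists_injective (fun v : S => L v)).1 (by
    intro s
    have h1 := h (s.map (Function.Embedding.subtype _)) (by
      intro x hx
      simp only [Finset.mem_map, Function.Embedding.coe_subtype] at hx
      obtain ⟨a, _, rfl⟩ := hx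
      exact a.2)
    rw [Finset.card_map] at h1
    refine h1.trans (le_of_eq ?_)
    congr 1
    ext x
    simp)
  obtain ⟨f, hf, hm⟩ := this
  refine ⟨fun v => if h : v ∈ S then f ⟨v, h⟩ else 0, ?_, ?_⟩
  · intro v hv
    simpa [hv] using hm ⟨v, hv⟩
  · intro u hu w hw huw heq
    simp only [hu, hw, dif_pos] at heq
    have := hf heq
    simp only [Subtype.mk.injEq] at this
    exact huw (by rw [this])

theorem small_pot {V ι : Type} [DecidableEq V] (π : V → ι) (S : Finset V) (f : V → ℕ) (N : ℕ)
    (hS : S.card ≤ N + 1) (hf : ∀ v ∈ S, f v ≤ N)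
    (h : ∀ L : V → Finset ℕ, (∀ v ∈ S, (L v).card = f v) → (S.biUnion L).card ≤ N → LC π S L)
    (L : V → Finset ℕ) (hL : ∀ v ∈ S, f v ≤ (L v).card) : LC π S L := by
  have h0 : ∀ v, ∃ t ⊆ L v, v ∈ S → t.card = f v := by
    intro v
    by_cases hv : v ∈ S
    · obtain ⟨t, ht, htc⟩ := Finset.exists_subset_card_eq (hL v hv)
      exact ⟨t, ht, fun _ => htc⟩
    · exact ⟨L v, Finset.Subset.refl _, fun h => absurd h hv⟩
  choose L0 hL0 hL0c using h0
  suffices LC π S L0 from this.mono (Finset.Subset.refl _) (fun v _ => hL0 v)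
  by_cases hH : ∀ X ⊆ S, X.card ≤ (X.biUnion L0).card
  · exact LC.of_hall hH
  push Not at hH
  obtain ⟨X0, hX0, hX0v⟩ := hH
  obtain ⟨X, hX, hmax⟩ := Finset.exists_max_image
    (S.powerset.filter (fun X => (X.biUnion L0).card < X.card)) Finset.card
    ⟨X0, by simp [hX0, hX0v]⟩
  simp only [Finset.mem_filter, Finset.mem_powerset] at hX hmax
  obtain ⟨hXS, hXv⟩ := hX
  have hXN : (X.biUnion L0).card ≤ N := by
    have := Finset.card_le_card hXS
    omega
  obtain ⟨D, hD, hDc⟩ := Infinite.exists_superset_card_eq (X.biUnion L0) N hXN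
  have h1 : ∀ v, ∃ t ⊆ D, v ∈ S → t.card = f v := by
    intro v
    by_cases hv : v ∈ S
    · obtain ⟨t, ht, htc⟩ := Finset.exists_subset_card_eq (s := D) (n := f v) (by
        rw [hDc]; exact hf v hv)
      exact ⟨t, ht, fun _ => htc⟩
    · exact ⟨D, Finset.Subset.refl _, fun h => absurd h hv⟩
  choose L1 hL1 hL1c using h1
  obtain ⟨c1, hc1, hp1⟩ := h (fun v => if v ∈ X then L0 v else L1 v) (by
      intro v hv
      split_ifs
      · exact hL0c v hv
      · exact hL1c v hv) (by
      rw [← hDc]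
      apply Finset.card_le_card
      intro x hx
      simp only [Finset.mem_biUnion] at hx
      obtain ⟨v, hv, hxv⟩ := hx
      split_ifs at hxv with hvX
      · exact hD (Finset.mem_biUnion.2 ⟨v, hvX, hxv⟩)
      · exact hL1 v hxv)
  have h2 : LC π (S \ X) (fun v => L0 v \ X.biUnion L0) := by
    apply LC.of_hall
    intro Y hY
    rcases Y.eq_empty_or_nonempty with rfl | hne
    · simp
    have hdis : Disjoint X Y := by
      rw [Finset.disjoint_left]
      intro a ha ha'
      exact (Finset.mem_sdiff.1 (hY ha')).2 ha
    have hc : (X ∪ Y).card = X.card + Y.card := Finset.card_union_of_disjoint hdis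
    have hnv : ¬ ((X ∪ Y).biUnion L0).card < (X ∪ Y).card := by
      intro hlt
      have := hmax (X ∪ Y) ⟨Finset.union_subset hXS (hY.trans Finset.sdiff_subset), hlt⟩
      have := hne.card_pos
      omega
    have hsub : (X ∪ Y).biUnion L0 ⊆
        X.biUnion L0 ∪ Y.biUnion (fun v => L0 v \ X.biUnion L0) := by
      intro x hx
      simp only [Finset.mem_biUnion, Finset.mem_union, Finset.mem_sdiff] at hx ⊢
      obtain ⟨v, hv, hxv⟩ := hx
      by_cases hxX : ∃ a ∈ X, x ∈ L0 a
      · exact Or.inl hxX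
      · rcases hv with hv | hv
        · exact Or.inl ⟨v, hv, hxv⟩
        · exact Or.inr ⟨v, hv, hxv, hxX⟩
    have := (Finset.card_le_card hsub).trans (Finset.card_union_le _ _)
    omega
  obtain ⟨c2, hc2, hp2⟩ := h2
  have k1 : ∀ v ∈ X, c1 v ∈ L0 v := by
    intro v hv
    have := hc1 v (hXS hv)
    simpa [hv] using this
  have k2 : ∀ v ∈ S, v ∉ X → c2 v ∈ L0 v ∧ c2 v ∉ X.biUnion L0 := by
    intro v hv hvX
    have := hc2 v (by simp [hv, hvX])
    exact Finset.mem_sdiff.1 this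
  have k3 : ∀ u ∈ X, ∀ w ∈ S, w ∉ X → c1 u ≠ c2 w := by
    intro u hu w hw hwX heq
    exact (k2 w hw hwX).2 (heq ▸ Finset.mem_biUnion.2 ⟨u, hu, k1 u hu⟩)
  refine ⟨fun v => if v ∈ X then c1 v else c2 v, ?_, ?_⟩
  · intro v hv
    by_cases hvX : v ∈ X
    · simpa [hvX] using k1 v hvX
    · simpa [hvX] using (k2 v hv hvX).1
  · intro u hu w hw huw
    by_cases huX : u ∈ X <;> by_cases hwX : w ∈ X <;> simp only [huX, hwX, if_true, if_false]
    · exact hp1 u hu w hw huw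
    · exact k3 u huX w hw hwX
    · exact (k3 w hwX u hu huX).symm
    · exact hp2 u (by simp [hu, huX]) w (by simp [hw, hwX]) huw

theorem sum_cnt {V : Type} (Q : Finset V) (L : V → Finset ℕ) (C : Finset ℕ)
    (hC : ∀ v ∈ Q, L v ⊆ C) :
    ∑ v ∈ Q, (L v).card = ∑ c ∈ C, (Q.filter (fun v => c ∈ L v)).card := by
  have h := Finset.sum_card_bipartiteAbove_eq_sum_card_bipartiteBelow (s := Q) (t := C)
    (fun v c => c ∈ L v)
  refine Eq.trans ?_ h
  apply Finset.sum_congr rfl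
  intro v hv
  congr 1
  ext c
  simp only [Finset.mem_bipartiteAbove]
  exact ⟨fun h => ⟨hC v hv h, h⟩, fun h => h.2⟩

/-- Among the lists of `Q`, `w` is the only vertex whose list misses `d`. -/
def Pr {V : Type} (L : V → Finset ℕ) (Q : Finset V) (d : ℕ) (w : V) : Prop :=
  w ∈ Q ∧ d ∉ L w ∧ ∀ u ∈ Q, u ≠ w → d ∈ L u

open Classical in
/-- The colors that are missed by exactly one list of `Q`. -/
noncomputable def BB {V : Type} (L : V → Finset ℕ) (Q : Finset V) (C : Finset ℕ) : Finset ℕ :=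
  C.filter (fun d => ∃ w, Pr L Q d w)

theorem mem_BB {V : Type} {L : V → Finset ℕ} {Q : Finset V} {C : Finset ℕ} {d : ℕ} :
    d ∈ BB L Q C ↔ d ∈ C ∧ ∃ w, Pr L Q d w := by
  simp [BB]

theorem Pr.uniq {V : Type} {L : V → Finset ℕ} {Q : Finset V} {d : ℕ} {w w' : V}
    (h : Pr L Q d w) (h' : Pr L Q d w') : w = w' := by
  by_contra hne
  exact h.2.1 (h'.2.2 w h.1 hne)

theorem card_BB {V : Type} [DecidableEq V] (Q : Finset V) (L : V → Finset ℕ) (C : Finset ℕ)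
    (k : ℕ) (hQ : Q.card = 3) (hC : ∀ v ∈ Q, L v ⊆ C) (hk : ∀ v ∈ Q, (L v).card = k)
    (hn : ∀ c, ∃ v ∈ Q, c ∉ L v) : 3 * k ≤ C.card + (BB L Q C).card := by
  have h1 : ∑ v ∈ Q, (L v).card = 3 * k := by
    rw [Finset.sum_congr rfl hk]; simp [hQ]
  have h2 : ∀ c ∈ C, (Q.filter (fun v => c ∈ L v)).card ≤ 1 + if c ∈ BB L Q C then 1 else 0 := by
    intro c hc
    obtain ⟨w, hw, hcw⟩ := hn c
    have hsub : Q.filter (fun v => c ∈ L v) ⊆ Q.erase w := by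
      intro v hv
      simp only [Finset.mem_filter, Finset.mem_erase] at hv ⊢
      refine ⟨?_, hv.1⟩
      rintro rfl
      exact hcw hv.2
    have he : (Q.erase w).card = 2 := by rw [Finset.card_erase_of_mem hw, hQ]
    have hle := Finset.card_le_card hsub
    split_ifs with hB
    · omega
    · by_contra hgt
      have heq := Finset.eq_of_subset_of_card_le hsub (by omega)
      apply hB
      rw [mem_BB]
      refine ⟨hc, w, hw, hcw, ?_⟩
      intro u hu huw
      have : u ∈ Q.filter (fun v => c ∈ L v) := by rw [heq]; simp [hu, huw]
      exact (Finset.mem_filter.1 this).2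
  have h3 := Finset.sum_le_sum h2
  rw [← sum_cnt Q L C hC, h1, Finset.sum_add_distrib, ← Finset.sum_filter] at h3
  simp only [Finset.sum_const, smul_eq_mul, mul_one] at h3
  have h4 : C.filter (fun c => c ∈ BB L Q C) ⊆ BB L Q C := fun x hx => (Finset.mem_filter.1 hx).2
  have := Finset.card_le_card h4
  omega

theorem card_inter_le (W D : Finset ℕ) (T : Finset ℕ) (m : ℕ) (hT : T ⊆ D)
    (hW : ∀ x ∈ T, x ∉ W) (hm : D.card ≤ m + T.card) : (W ∩ D).card ≤ m := by
  have h1 : W ∩ D ⊆ D \ T := by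
    intro x hx
    simp only [Finset.mem_inter, Finset.mem_sdiff] at hx ⊢
    exact ⟨hx.2, fun h => hW x h hx.1⟩
  have h2 := Finset.card_le_card h1
  rw [Finset.card_sdiff_of_subset hT] at h2
  omega

/-- The conditions on the chosen colors which guarantee that Hall's condition holds. -/
def NF (k : ℕ) (Y W1 W2 D : Finset ℕ) : Prop :=
  ¬ ((Y ∪ W1 ∪ W2 ∪ D).card ≤ k + 2 ∧ 2 ≤ (W1 ∩ D).card ∧ 2 ≤ (W2 ∩ D).card) ∧
  ¬ (3 ≤ (W1 ∩ D).card ∧ 3 ≤ (W2 ∩ D).card) ∧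
  ¬ ((Y ∪ W1 ∪ D).card ≤ k + 1 ∧ 3 ≤ (W1 ∩ D).card) ∧
  ¬ ((Y ∪ W2 ∪ D).card ≤ k + 1 ∧ 3 ≤ (W2 ∩ D).card) ∧
  ¬ D ⊆ Y

theorem NF.symm {k : ℕ} {Y W1 W2 D : Finset ℕ} (h : NF k Y W1 W2 D) : NF k Y W2 W1 D := by
  obtain ⟨h1, h2, h3, h4, h5⟩ := h
  refine ⟨?_, fun h => h2 ⟨h.2, h.1⟩, h4, h3, h5⟩
  rw [Finset.union_right_comm Y W2 W1]
  exact fun h => h1 ⟨h.1, h.2.2, h.2.1⟩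

theorem pick (A C : Finset ℕ) (φ : ℕ → ℕ) (hφ : Set.InjOn φ (C : Set ℕ)) (hA : A ⊆ C)
    (d1 d2 : ℕ) (h3 : 3 ≤ A.card) : ∃ c ∈ A, φ c ≠ d1 ∧ φ c ≠ d2 := by
  by_contra hcon
  push Not at hcon
  have h1 : A.card ≤ ({d1, d2} : Finset ℕ).card := by
    apply Finset.card_le_card_of_injOn φ
    · intro c hc
      have := hcon c hc
      simp only [Finset.coe_insert, Finset.coe_singleton, Set.mem_insert_iff,
        Set.mem_singleton_iff]
      by_cases h : φ c = d1
      · exact Or.inl h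
      · exact Or.inr (this h)
    · exact hφ.mono (by exact_mod_cast hA)
  have := Finset.card_le_two (a := d1) (b := d2)
  omega

/-- What the choice of colors has to deliver. -/
def Good (k : ℕ) (C Y W1 W2 : Finset ℕ) (φ : ℕ → ℕ) (d1 d2 : ℕ) : Prop :=
  ∃ c ∈ C, c ≠ d1 ∧ c ≠ d2 ∧ φ c ≠ d1 ∧ φ c ≠ d2 ∧ NF k Y W1 W2 {c, φ c, d1, d2}

theorem Good.symm {k : ℕ} {C Y W1 W2 : Finset ℕ} {φ : ℕ → ℕ} {d1 d2 : ℕ}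
    (h : Good k C Y W1 W2 φ d1 d2) : Good k C Y W2 W1 φ d2 d1 := by
  obtain ⟨c, hc, h1, h2, h3, h4, h5⟩ := h
  refine ⟨c, hc, h2, h1, h4, h3, ?_⟩
  rw [Finset.pair_comm d2 d1]
  exact h5.symm

theorem card_sdiff_ge (C B : Finset ℕ) (a b : ℕ) (hC : a + b ≤ C.card) (hB : B.card ≤ b) :
    a ≤ (C \ B).card := by
  have := Finset.le_card_sdiff B C
  omega

theorem core1 (k : ℕ) (hk : 6 ≤ k) (C Y W1 W2 : Finset ℕ) (φ : ℕ → ℕ)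
    (hφ : Set.InjOn φ (C : Set ℕ)) (hC : C.card = 2 * k) (hY : Y.card = k)
    (d1 d2 : ℕ) (hd : d1 ≠ d2) (h1 : d1 ∉ W1) (h2 : d2 ∉ W2) (h12 : d1 ∉ W2) :
    Good k C Y W1 W2 φ d1 d2 := by
  have cD : ∀ c, ({c, φ c, d1, d2} : Finset ℕ).card ≤ 4 := fun c => Finset.card_le_four
  have e2 : ∀ c, (W2 ∩ {c, φ c, d1, d2}).card ≤ 2 := by
    intro c
    refine card_inter_le _ _ {d1, d2} 2 ?_ ?_ ?_
    · intro x hx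
      simp only [Finset.mem_insert, Finset.mem_singleton] at hx ⊢
      tauto
    · intro x hx
      simp only [Finset.mem_insert, Finset.mem_singleton] at hx
      rcases hx with rfl | rfl <;> assumption
    · rw [Finset.card_pair hd]
      exact cD c
  have e1 : ∀ c, c ≠ d1 → c ∉ W1 → (W1 ∩ {c, φ c, d1, d2}).card ≤ 2 := by
    intro c hcd hc
    refine card_inter_le _ _ {c, d1} 2 ?_ ?_ ?_
    · intro x hx
      simp only [Finset.mem_insert, Finset.mem_singleton] at hx ⊢
      tauto
    · intro x hx
      simp only [Finset.mem_insert, Finset.mem_singleton] at hx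
      rcases hx with rfl | rfl <;> assumption
    · rw [Finset.card_pair hcd]
      exact cD c
  by_cases hF1 : ∃ c, (Y ∪ W1 ∪ W2 ∪ {c, φ c, d1, d2}).card ≤ k + 2
  · obtain ⟨c0, hc0⟩ := hF1
    obtain ⟨c, hc, hc1, hc2⟩ := pick (C \ (Y ∪ W1 ∪ W2 ∪ {c0, φ c0, d1, d2})) C φ hφ
      Finset.sdiff_subset d1 d2 (card_sdiff_ge _ _ _ (k + 2) (by omega) hc0)
    simp only [Finset.mem_sdiff, Finset.mem_union, Finset.mem_insert, Finset.mem_singleton,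
      not_or] at hc
    obtain ⟨hcC, ⟨⟨hcY, hcW1⟩, hcW2⟩, -, -, hcd1, hcd2⟩ := hc
    have e3 : (W2 ∩ {c, φ c, d1, d2}).card ≤ 1 := by
      refine card_inter_le _ _ {c, d1, d2} 1 ?_ ?_ ?_
      · intro x hx
        simp only [Finset.mem_insert, Finset.mem_singleton] at hx ⊢
        tauto
      · intro x hx
        simp only [Finset.mem_insert, Finset.mem_singleton] at hx
        rcases hx with rfl | rfl | rfl <;> assumption
      · have h3 : ({c, d1, d2} : Finset ℕ).card = 3 := Finset.card_eq_three.2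
          ⟨c, d1, d2, hcd1, hcd2, hd, rfl⟩
        rw [h3]
        exact cD c
    have e1 := e1 c hcd1 hcW1
    refine ⟨c, hcC, hcd1, hcd2, hc1, hc2, ?_, ?_, ?_, ?_, ?_⟩
    · omega
    · omega
    · omega
    · omega
    · intro h
      exact hcY (h (by simp))
  by_cases hF2 : ∃ c, (Y ∪ W1 ∪ {c, φ c, d1, d2}).card ≤ k + 1
  · obtain ⟨c0, hc0⟩ := hF2
    obtain ⟨c, hc, hc1, hc2⟩ := pick (C \ (Y ∪ W1 ∪ {c0, φ c0, d1, d2})) C φ hφ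
      Finset.sdiff_subset d1 d2 (card_sdiff_ge _ _ _ (k + 1) (by omega) hc0)
    simp only [Finset.mem_sdiff, Finset.mem_union, Finset.mem_insert, Finset.mem_singleton,
      not_or] at hc
    obtain ⟨hcC, ⟨hcY, hcW1⟩, -, -, hcd1, hcd2⟩ := hc
    have e1 := e1 c hcd1 hcW1
    have e2 := e2 c
    refine ⟨c, hcC, hcd1, hcd2, hc1, hc2, ?_, ?_, ?_, ?_, ?_⟩
    · exact fun h => hF1 ⟨c, h.1⟩
    · omega
    · omega
    · omega
    · intro h
      exact hcY (h (by simp))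
  · have hY2 : (Y ∪ {d1, d2}).card ≤ k + 2 := by
      have := Finset.card_union_le Y {d1, d2}
      rw [Finset.card_pair hd] at this
      omega
    obtain ⟨c, hc, hc1, hc2⟩ := pick (C \ (Y ∪ {d1, d2})) C φ hφ
      Finset.sdiff_subset d1 d2 (card_sdiff_ge _ _ _ (k + 2) (by omega) hY2)
    simp only [Finset.mem_sdiff, Finset.mem_union, Finset.mem_insert, Finset.mem_singleton,
      not_or] at hc
    obtain ⟨hcC, hcY, hcd1, hcd2⟩ := hc
    have e2 := e2 c
    refine ⟨c, hcC, hcd1, hcd2, hc1, hc2, ?_, ?_, ?_, ?_, ?_⟩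
    · exact fun h => hF1 ⟨c, h.1⟩
    · omega
    · exact fun h => hF2 ⟨c, h.1⟩
    · omega
    · intro h
      exact hcY (h (by simp))

theorem core2_aux (k : ℕ) (hk : 6 ≤ k) (C Y W1 W2 : Finset ℕ) (φ : ℕ → ℕ)
    (hφ : Set.InjOn φ (C : Set ℕ)) (hC : C.card = 2 * k) (hY : Y.card = k)
    (hW1 : W1.card = k) (hW2 : W2.card = k) (hdis : Disjoint W1 W2)
    (d1 d2 : ℕ) (h1 : d1 ∉ W1)
    (hF2 : ∃ c, (Y ∪ W1 ∪ {c, φ c, d1, d2}).card ≤ k + 1) :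
    Good k C Y W1 W2 φ d1 d2 := by
  have cD : ∀ c, ({c, φ c, d1, d2} : Finset ℕ).card ≤ 4 := fun c => Finset.card_le_four
  have e1 : ∀ c, c ≠ d1 → c ∉ W1 → (W1 ∩ {c, φ c, d1, d2}).card ≤ 2 := by
    intro c hcd hc
    refine card_inter_le _ _ {c, d1} 2 ?_ ?_ ?_
    · intro x hx
      simp only [Finset.mem_insert, Finset.mem_singleton] at hx ⊢
      tauto
    · intro x hx
      simp only [Finset.mem_insert, Finset.mem_singleton] at hx
      rcases hx with rfl | rfl <;> assumption
    · rw [Finset.card_pair hcd]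
      exact cD c
  obtain ⟨c0, hc0⟩ := hF2
  obtain ⟨c, hc, hc1, hc2⟩ := pick (C \ (Y ∪ W1 ∪ {c0, φ c0, d1, d2})) C φ hφ
    Finset.sdiff_subset d1 d2 (card_sdiff_ge _ _ _ (k + 1) (by omega) hc0)
  simp only [Finset.mem_sdiff, Finset.mem_union, Finset.mem_insert, Finset.mem_singleton,
    not_or] at hc
  obtain ⟨hcC, ⟨hcY, hcW1⟩, -, -, hcd1, hcd2⟩ := hc
  have e1 := e1 c hcd1 hcW1
  refine ⟨c, hcC, hcd1, hcd2, hc1, hc2, ?_, ?_, ?_, ?_, ?_⟩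
  · intro h
    have h' : (W1 ∪ W2).card ≤ k + 2 := by
      refine le_trans (Finset.card_le_card ?_) h.1
      intro x hx
      simp only [Finset.mem_union] at hx ⊢
      tauto
    rw [Finset.card_union_of_disjoint hdis] at h'
    omega
  · omega
  · omega
  · intro h
    have a1 : (Y ∪ W1).card ≤ k + 1 := (Finset.card_le_card Finset.subset_union_left).trans hc0
    have a2 : (Y ∪ W2).card ≤ k + 1 := (Finset.card_le_card Finset.subset_union_left).trans h.1
    have b1 := Finset.card_union_add_card_inter Y W1
    have b2 := Finset.card_union_add_card_inter Y W2
    have b3 : ((Y ∩ W1) ∪ (Y ∩ W2)).card ≤ Y.card := by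
      apply Finset.card_le_card
      intro x hx
      simp only [Finset.mem_union, Finset.mem_inter] at hx
      tauto
    rw [Finset.card_union_of_disjoint (hdis.mono Finset.inter_subset_right
      Finset.inter_subset_right)] at b3
    omega
  · intro h
    exact hcY (h (by simp))

theorem core2 (k : ℕ) (hk : 6 ≤ k) (C Y W1 W2 : Finset ℕ) (φ : ℕ → ℕ)
    (hφ : Set.InjOn φ (C : Set ℕ)) (hC : C.card = 2 * k) (hY : Y.card = k)
    (hW1 : W1.card = k) (hW2 : W2.card = k) (hdis : Disjoint W1 W2)
    (d1 d2 : ℕ) (hd : d1 ≠ d2) (h1 : d1 ∉ W1) (h2 : d2 ∉ W2) :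
    Good k C Y W1 W2 φ d1 d2 := by
  by_cases hF1 : ∃ c, (Y ∪ W1 ∪ {c, φ c, d1, d2}).card ≤ k + 1
  · exact core2_aux k hk C Y W1 W2 φ hφ hC hY hW1 hW2 hdis d1 d2 h1 hF1
  by_cases hF2 : ∃ c, (Y ∪ W2 ∪ {c, φ c, d2, d1}).card ≤ k + 1
  · exact (core2_aux k hk C Y W2 W1 φ hφ hC hY hW2 hW1 hdis.symm d2 d1 h2 hF2).symm
  have hY2 : (Y ∪ {d1, d2}).card ≤ k + 2 := by
    have := Finset.card_union_le Y {d1, d2}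
    rw [Finset.card_pair hd] at this
    omega
  obtain ⟨c, hc, hc1, hc2⟩ := pick (C \ (Y ∪ {d1, d2})) C φ hφ
    Finset.sdiff_subset d1 d2 (card_sdiff_ge _ _ _ (k + 2) (by omega) hY2)
  simp only [Finset.mem_sdiff, Finset.mem_union, Finset.mem_insert, Finset.mem_singleton,
    not_or] at hc
  obtain ⟨hcC, hcY, hcd1, hcd2⟩ := hc
  refine ⟨c, hcC, hcd1, hcd2, hc1, hc2, ?_, ?_, ?_, ?_, ?_⟩
  · intro h
    have h' : (W1 ∪ W2).card ≤ k + 2 := by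
      refine le_trans (Finset.card_le_card ?_) h.1
      intro x hx
      simp only [Finset.mem_union] at hx ⊢
      tauto
    rw [Finset.card_union_of_disjoint hdis] at h'
    omega
  · intro h
    have b3 : ((W1 ∩ {c, φ c, d1, d2}) ∪ (W2 ∩ {c, φ c, d1, d2})).card ≤ 4 := by
      refine le_trans (Finset.card_le_card ?_)
        (Finset.card_le_four (a := c) (b := φ c) (c := d1) (d := d2))
      exact Finset.union_subset Finset.inter_subset_right Finset.inter_subset_right
    rw [Finset.card_union_of_disjoint (hdis.mono Finset.inter_subset_left
      Finset.inter_subset_left)] at b3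
    omega
  · exact fun h => hF1 ⟨c, h.1⟩
  · intro h
    rw [Finset.pair_comm d1 d2] at h
    exact hF2 ⟨c, h.1⟩
  · intro h
    exact hcY (h (by simp))

theorem Pr_uniq_class {V : Type} [DecidableEq V] (Q : Finset V) (L : V → Finset ℕ) (E : Finset ℕ)
    (hQ : Q.card = 3) (hn : ∀ c, ∃ v ∈ Q, c ∉ L v) (hE : 4 ≤ E.card)
    (H : ∀ d ∈ E, ∀ d' w', Pr L Q d' w' → d ≠ d' → d ∈ L w')
    (d d' : ℕ) (w w' : V) (h : Pr L Q d w) (h' : Pr L Q d' w') : w = w' := by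
  by_contra hne
  have hc : 1 < (E \ {d, d'}).card := by
    have := Finset.le_card_sdiff {d, d'} E
    have := Finset.card_le_two (a := d) (b := d')
    omega
  obtain ⟨e, he, e', he', hee⟩ := Finset.one_lt_card.1 hc
  simp only [Finset.mem_sdiff, Finset.mem_insert, Finset.mem_singleton, not_or] at he he'
  have h3 : ∀ v ∈ Q, ∀ v' ∈ Q, v ≠ w → v ≠ w' → v' ≠ w → v' ≠ w' → v = v' := by
    intro v hv v' hv' a1 a2 a3 a4
    have : ((Q.erase w).erase w').card ≤ 1 := by
      rw [Finset.card_erase_of_mem (by simp [h'.1, Ne.symm hne]), Finset.card_erase_of_mem h.1, hQ]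
    exact Finset.card_le_one.1 this v (by simp [*]) v' (by simp [*])
  have key : ∀ x ∈ E, x ≠ d → x ≠ d' → ∃ v, Pr L Q x v ∧ v ≠ w ∧ v ≠ w' := by
    intro x hx hxd hxd'
    obtain ⟨v, hv, hxv⟩ := hn x
    have i1 := H x hx d w h hxd
    have i2 := H x hx d' w' h' hxd'
    have n1 : v ≠ w := by rintro rfl; exact hxv i1
    have n2 : v ≠ w' := by rintro rfl; exact hxv i2
    refine ⟨v, ⟨hv, hxv, ?_⟩, n1, n2⟩
    intro u hu huv
    by_cases hu1 : u = w
    · rw [hu1]; exact i1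
    by_cases hu2 : u = w'
    · rw [hu2]; exact i2
    exact absurd (h3 u hu v hv hu1 hu2 n1 n2) huv
  obtain ⟨v, hv, hv1, hv2⟩ := key e he.1 he.2.1 he.2.2
  obtain ⟨v', hv', hv1', hv2'⟩ := key e' he'.1 he'.2.1 he'.2.2
  have hvv : v' = v := h3 v' hv'.1 v hv.1 hv1' hv2' hv1 hv2
  subst hvv
  exact hv'.2.1 (H e' he'.1 e v' hv (Ne.symm hee))

theorem choice_main {V : Type} [DecidableEq V] (k : ℕ) (hk : 6 ≤ k) (C Y : Finset ℕ)
    (φ : ℕ → ℕ) (hφ : Set.InjOn φ (C : Set ℕ)) (hC : C.card = 2 * k) (hY : Y.card = k)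
    (L : V → Finset ℕ) (Q1 Q2 : Finset V) (hQ1 : Q1.card = 3) (hQ2 : Q2.card = 3)
    (hL1 : ∀ v ∈ Q1, (L v).card = k ∧ L v ⊆ C) (hL2 : ∀ v ∈ Q2, (L v).card = k ∧ L v ⊆ C)
    (hn1 : ∀ c, ∃ v ∈ Q1, c ∉ L v) (hn2 : ∀ c, ∃ v ∈ Q2, c ∉ L v) :
    ∃ d1 w1 d2 w2, d1 ∈ C ∧ d2 ∈ C ∧ d1 ≠ d2 ∧ Pr L Q1 d1 w1 ∧ Pr L Q2 d2 w2 ∧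
      Good k C Y (L w1) (L w2) φ d1 d2 := by
  have hB1 := card_BB Q1 L C k hQ1 (fun v hv => (hL1 v hv).2) (fun v hv => (hL1 v hv).1) hn1
  have hB2 := card_BB Q2 L C k hQ2 (fun v hv => (hL2 v hv).2) (fun v hv => (hL2 v hv).1) hn2
  by_cases h1 : ∃ d1 ∈ C, ∃ w1, ∃ d2 ∈ C, ∃ w2, Pr L Q1 d1 w1 ∧ Pr L Q2 d2 w2 ∧ d1 ≠ d2 ∧
      d1 ∉ L w2
  · obtain ⟨d1, hd1, w1, d2, hd2, w2, p1, p2, hd, h12⟩ := h1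
    exact ⟨d1, w1, d2, w2, hd1, hd2, hd, p1, p2,
      core1 k hk C Y _ _ φ hφ hC hY d1 d2 hd p1.2.1 p2.2.1 h12⟩
  by_cases h2 : ∃ d1 ∈ C, ∃ w1, ∃ d2 ∈ C, ∃ w2, Pr L Q1 d1 w1 ∧ Pr L Q2 d2 w2 ∧ d1 ≠ d2 ∧
      d2 ∉ L w1
  · obtain ⟨d1, hd1, w1, d2, hd2, w2, p1, p2, hd, h12⟩ := h2
    exact ⟨d1, w1, d2, w2, hd1, hd2, hd, p1, p2,
      (core1 k hk C Y _ _ φ hφ hC hY d2 d1 hd.symm p2.2.1 p1.2.1 h12).symm⟩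
  push Not at h1 h2
  have inC1 : ∀ d w, Pr L Q1 d w → d ∈ C := by
    intro d w h
    have : (Q1.erase w).Nonempty := by
      rw [← Finset.card_pos, Finset.card_erase_of_mem h.1]; omega
    obtain ⟨u, hu⟩ := this
    rw [Finset.mem_erase] at hu
    exact (hL1 u hu.2).2 (h.2.2 u hu.2 hu.1)
  have inC2 : ∀ d w, Pr L Q2 d w → d ∈ C := by
    intro d w h
    have : (Q2.erase w).Nonempty := by
      rw [← Finset.card_pos, Finset.card_erase_of_mem h.1]; omega
    obtain ⟨u, hu⟩ := this
    rw [Finset.mem_erase] at hu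
    exact (hL2 u hu.2).2 (h.2.2 u hu.2 hu.1)
  have u2 := Pr_uniq_class Q2 L (BB L Q1 C) hQ2 hn2 (by omega) (by
    intro d hd d' w' hp hne
    obtain ⟨hdC, w, hw⟩ := mem_BB.1 hd
    exact h1 d hdC w d' (inC2 _ _ hp) w' hw hp hne)
  have u1 := Pr_uniq_class Q1 L (BB L Q2 C) hQ1 hn1 (by omega) (by
    intro d hd d' w' hp hne
    obtain ⟨hdC, w, hw⟩ := mem_BB.1 hd
    exact h2 d' (inC1 _ _ hp) w' d hdC w hp hw (Ne.symm hne))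
  obtain ⟨d1, hd1⟩ : (BB L Q1 C).Nonempty := by rw [← Finset.card_pos]; omega
  obtain ⟨hd1C, w1, p1⟩ := mem_BB.1 hd1
  obtain ⟨d2, hd2, hd21⟩ := Finset.exists_mem_ne (s := BB L Q2 C) (by omega) d1
  obtain ⟨hd2C, w2, p2⟩ := mem_BB.1 hd2
  refine ⟨d1, w1, d2, w2, hd1C, hd2C, hd21.symm, p1, p2, ?_⟩
  have s1 : BB L Q1 C ⊆ L w2 := by
    intro x hx
    obtain ⟨hxC, w, p⟩ := mem_BB.1 hx
    obtain ⟨d', hd', hdx⟩ := Finset.exists_mem_ne (s := BB L Q2 C) (by omega) x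
    obtain ⟨hdC', w', p'⟩ := mem_BB.1 hd'
    rw [u2 d2 d' w2 w' p2 p']
    exact h1 x hxC w d' hdC' w' p p' hdx.symm
  have s2 : BB L Q1 C = L w2 := by
    apply Finset.eq_of_subset_of_card_le s1
    rw [(hL2 w2 p2.1).1]
    omega
  refine core2 k hk C Y _ _ φ hφ hC hY (hL1 w1 p1.1).1 (hL2 w2 p2.1).1 ?_ d1 d2 hd21.symm
    p1.2.1 p2.2.1
  rw [← s2, Finset.disjoint_left]
  intro x hx hx'
  obtain ⟨hxC, w, p⟩ := mem_BB.1 hx'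
  rw [u1 d1 x w1 w p1 p] at hx
  exact p.2.1 hx

theorem third {V : Type} [DecidableEq V] {Q : Finset V} (hQ : Q.card = 3) {u u' v v' : V}
    (hu : u ∈ Q) (hu' : u' ∈ Q) (hne : u ≠ u') (hv : v ∈ Q) (hv' : v' ∈ Q)
    (a1 : v ≠ u) (a2 : v ≠ u') (a3 : v' ≠ u) (a4 : v' ≠ u') : v = v' := by
  have : ((Q.erase u).erase u').card ≤ 1 := by
    rw [Finset.card_erase_of_mem (by simp [hu', Ne.symm hne]), Finset.card_erase_of_mem hu, hQ]
  exact Finset.card_le_one.1 this v (by simp [*]) v' (by simp [*])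

theorem Pr_of_two {V : Type} [DecidableEq V] {L : V → Finset ℕ} {Q : Finset V}
    (hQ : Q.card = 3) (hn : ∀ c, ∃ v ∈ Q, c ∉ L v) {u u' : V} (hu : u ∈ Q) (hu' : u' ∈ Q)
    (hne : u ≠ u') {c : ℕ} (hc : c ∈ L u) (hc' : c ∈ L u') :
    ∃ w, Pr L Q c w ∧ w ≠ u ∧ w ≠ u' := by
  obtain ⟨w, hw, hcw⟩ := hn c
  have n1 : w ≠ u := by rintro rfl; exact hcw hc
  have n2 : w ≠ u' := by rintro rfl; exact hcw hc'
  refine ⟨w, ⟨hw, hcw, ?_⟩, n1, n2⟩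
  intro x hx hxw
  by_cases h1 : x = u
  · rw [h1]; exact hc
  by_cases h2 : x = u'
  · rw [h2]; exact hc'
  exact absurd (third hQ hu hu' hne hx hw h1 h2 n1 n2) hxw

/-- The conditions guaranteeing Hall's condition in the base case. -/
def NG (X W1 W2 : Finset ℕ) (d1 d2 : ℕ) : Prop :=
  ¬ (d2 ∈ W1 ∧ d1 ∈ W2 ∧ W1 \ {d2} = W2 \ {d1}) ∧
  ¬ (d1 ∈ X ∧ d2 ∈ X ∧ (W1 ⊆ X ∨ W2 ⊆ X)) ∧
  ¬ (W1 ∪ W2 ∪ X ∪ {d1, d2}).card ≤ 7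

theorem NG.symm {X W1 W2 : Finset ℕ} {d1 d2 : ℕ} (h : NG X W1 W2 d1 d2) : NG X W2 W1 d2 d1 := by
  obtain ⟨h1, h2, h3⟩ := h
  refine ⟨fun h => h1 ⟨h.2.1, h.1, h.2.2.symm⟩, fun h => h2 ⟨h.2.1, h.1, h.2.2.symm⟩, ?_⟩
  rw [Finset.union_comm W2 W1, Finset.pair_comm d2 d1]
  exact h3

theorem eq7 {X W1 W2 : Finset ℕ} {d1 d2 : ℕ} (hX : X.card = 6) (hd : d1 ∉ X)
    (h : (W1 ∪ W2 ∪ X ∪ {d1, d2}).card ≤ 7) : W1 ∪ W2 ∪ X ∪ {d1, d2} = insert d1 X := by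
  symm
  apply Finset.eq_of_subset_of_card_le
  · intro x hx
    simp only [Finset.mem_insert, Finset.mem_union, Finset.mem_singleton] at hx ⊢
    tauto
  · rw [Finset.card_insert_of_notMem hd, hX]
    exact h

theorem choiceA_i {V : Type} [DecidableEq V] (C X : Finset ℕ) (hC : C.card ≤ 9)
    (hX : X.card = 6) (L : V → Finset ℕ) (Q1 Q2 : Finset V) (hQ2 : Q2.card = 3)
    (hL1 : ∀ v ∈ Q1, (L v).card = 5 ∧ L v ⊆ C) (hL2 : ∀ v ∈ Q2, (L v).card = 5 ∧ L v ⊆ C)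
    (hn2 : ∀ c, ∃ v ∈ Q2, c ∉ L v) (d1 : ℕ) (a : V) (p1 : Pr L Q1 d1 a)
    (hd1 : d1 ∉ X) :
    ∃ d2 ∈ C, ∃ w2, d1 ≠ d2 ∧ Pr L Q2 d2 w2 ∧ NG X (L a) (L w2) d1 d2 := by
  have hB2 := card_BB Q2 L C 5 hQ2 (fun v hv => (hL2 v hv).2) (fun v hv => (hL2 v hv).1) hn2
  by_contra hcon
  push Not at hcon
  by_cases haX : L a ⊆ X
  · -- every list that can be used is inside `insert d1 X`
    have key : ∀ d2 ∈ C, ∀ b, Pr L Q2 d2 b → d2 ≠ d1 → L b ⊆ insert d1 X := by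
      intro d2 hd2 b p2 hne
      have h := hcon d2 hd2 b hne.symm p2
      by_contra hb
      apply h
      refine ⟨?_, fun h => hd1 h.1, ?_⟩
      · rintro ⟨h1, h2, h3⟩
        apply hb
        intro x hx
        by_cases hxd : x = d1
        · simp [hxd]
        · have : x ∈ L a \ {d2} := by rw [h3]; simp [hx, hxd]
          exact Finset.mem_insert_of_mem (haX (Finset.mem_sdiff.1 this).1)
      · intro h7
        apply hb
        rw [← eq7 hX hd1 h7]
        intro x hx
        simp [hx]
    have hX' : (insert d1 X).card = 7 := by rw [Finset.card_insert_of_notMem hd1, hX]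
    have c1 : ∃ v ∈ Q2, ¬ L v ⊆ insert d1 X := by
      by_contra hall
      push Not at hall
      have h1 := card_BB Q2 L (insert d1 X) 5 hQ2 hall (fun v hv => (hL2 v hv).1) hn2
      have h2 : BB L Q2 (insert d1 X) ⊆ insert d1 X := fun x hx => (mem_BB.1 hx).1
      have := Finset.card_le_card h2
      omega
    obtain ⟨v, hv, hvX⟩ := c1
    have c2 : ∃ u ∈ Q2, u ≠ v ∧ ¬ L u ⊆ insert d1 X := by
      by_contra hall
      push Not at hall
      have he : (Q2.erase v).card = 2 := by rw [Finset.card_erase_of_mem hv, hQ2]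
      obtain ⟨u, u', huu, heq⟩ := Finset.card_eq_two.1 he
      have hu : u ∈ Q2.erase v := by rw [heq]; simp
      have hu' : u' ∈ Q2.erase v := by rw [heq]; simp
      rw [Finset.mem_erase] at hu hu'
      have i1 : L u ∩ L u' ⊆ {d1} := by
        intro x hx
        rw [Finset.mem_inter] at hx
        obtain ⟨w, pw, n1, n2⟩ := Pr_of_two hQ2 hn2 hu.2 hu'.2 huu hx.1 hx.2
        have hwv : w = v := third hQ2 hu.2 hu'.2 huu pw.1 hv n1 n2 hu.1.symm hu'.1.symm
        by_contra hxd
        rw [Finset.mem_singleton] at hxd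
        exact hvX (hwv ▸ key x ((hL2 u hu.2).2 hx.1) w pw hxd)
      have i2 := Finset.card_le_card i1
      have i3 := Finset.card_union_add_card_inter (L u) (L u')
      have i4 := Finset.card_le_card (Finset.union_subset (hall u hu.2 hu.1) (hall u' hu'.2 hu'.1))
      rw [(hL2 u hu.2).1, (hL2 u' hu'.2).1] at i3
      rw [Finset.card_singleton] at i2
      omega
    obtain ⟨u, hu, huv, huX⟩ := c2
    have ht : ∃ t ∈ Q2, t ≠ v ∧ t ≠ u := by
      have : ((Q2.erase v).erase u).Nonempty := by
        rw [← Finset.card_pos, Finset.card_erase_of_mem (by simp [hu, huv]),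
          Finset.card_erase_of_mem hv, hQ2]
        norm_num
      obtain ⟨t, ht⟩ := this
      simp only [Finset.mem_erase] at ht
      exact ⟨t, ht.2.2, ht.2.1, ht.1⟩
    obtain ⟨t, ht, htv, htu⟩ := ht
    have hdis : Disjoint ((BB L Q2 C).erase d1) (L t) := by
      rw [Finset.disjoint_left]
      intro x hx hxt
      rw [Finset.mem_erase, mem_BB] at hx
      obtain ⟨hxd, hxC, w, pw⟩ := hx
      have hk := key x hxC w pw hxd
      have n1 : w ≠ v := by rintro rfl; exact hvX hk
      have n2 : w ≠ u := by rintro rfl; exact huX hk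
      have : w = t := third hQ2 hv hu huv.symm pw.1 ht n1 n2 htv htu
      exact pw.2.1 (this ▸ hxt)
    have h1 : ((BB L Q2 C).erase d1 ∪ L t).card ≤ C.card := by
      apply Finset.card_le_card
      apply Finset.union_subset _ (hL2 t ht).2
      exact (Finset.erase_subset _ _).trans (fun x hx => (mem_BB.1 hx).1)
    rw [Finset.card_union_of_disjoint hdis, (hL2 t ht).1] at h1
    have := Finset.pred_card_le_card_erase (s := BB L Q2 C) (a := d1)
    omega
  · have key : ∀ d2 ∈ C, ∀ b, Pr L Q2 d2 b → d2 ≠ d1 →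
        d2 ∈ L a ∧ L a \ {d2} = L b \ {d1} := by
      intro d2 hd2 b p2 hne
      have h := hcon d2 hd2 b hne.symm p2
      by_contra hb
      apply h
      refine ⟨fun h => hb ⟨h.1, h.2.2⟩, fun h => hd1 h.1, ?_⟩
      intro h7
      apply haX
      intro x hx
      have : x ∈ insert d1 X := by
        rw [← eq7 hX hd1 h7]
        simp [hx]
      rcases Finset.mem_insert.1 this with rfl | h
      · exact absurd hx p1.2.1
      · exact h
    have hsub : BB L Q2 C ⊆ insert d1 (L a) := by
      intro x hx
      obtain ⟨hxC, b, pb⟩ := mem_BB.1 hx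
      by_cases hxd : x = d1
      · simp [hxd]
      · exact Finset.mem_insert_of_mem (key x hxC b pb hxd).1
    have heq : BB L Q2 C = insert d1 (L a) := by
      apply Finset.eq_of_subset_of_card_le hsub
      rw [Finset.card_insert_of_notMem p1.2.1, (hL1 a p1.1).1]
      omega
    have hex : ∀ x, ∃ b, x ∈ L a → Pr L Q2 x b := by
      intro x
      by_cases hx : x ∈ L a
      · have : x ∈ BB L Q2 C := by rw [heq]; simp [hx]
        obtain ⟨-, b, pb⟩ := mem_BB.1 this
        exact ⟨b, fun _ => pb⟩
      · exact ⟨a, fun h => absurd h hx⟩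
    choose g hg using hex
    obtain ⟨x, hx, x', hx', hne, hgx⟩ := Finset.exists_ne_map_eq_of_card_lt_of_maps_to
      (s := L a) (t := Q2) (by rw [hQ2, (hL1 a p1.1).1]; norm_num) (f := g)
      (fun x hx => (hg x hx).1)
    have hxd : x ≠ d1 := by rintro rfl; exact p1.2.1 hx
    have h1 := (key x ((hL1 a p1.1).2 hx) (g x) (hg x hx) hxd).2
    have h2 : x' ∈ L a \ {x} := by simp [hx', hne.symm]
    rw [h1, hgx] at h2
    exact (hg x' hx').2.1 (Finset.mem_sdiff.1 h2).1

/-- Facts about a part all of whose doubly covered colors form the set `X`. -/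
theorem caseii_facts {V : Type} [DecidableEq V] (C X : Finset ℕ) (hC : C.card ≤ 9)
    (hX : X.card = 6) (L : V → Finset ℕ) (Q : Finset V) (hQ : Q.card = 3)
    (hL : ∀ v ∈ Q, (L v).card = 5 ∧ L v ⊆ C) (hn : ∀ c, ∃ v ∈ Q, c ∉ L v)
    (hB : ∀ d w, Pr L Q d w → d ∈ X) :
    (∀ w ∈ Q, ∀ d ∈ X, d ∉ L w → Pr L Q d w) ∧
    (∀ w ∈ Q, (X \ L w).card = 1 + (L w \ X).card) ∧
    (∃ w ∈ Q, (L w \ X).Nonempty) ∧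
    (∀ w ∈ Q, (L w \ X).Nonempty → (∀ v ∈ Q, v ≠ w → ¬ (L v \ X).Nonempty) →
      4 ≤ (X \ L w).card) ∧
    (∀ w ∈ Q, ∀ v ∈ Q, v ≠ w → Disjoint (L v \ X) (L w \ X)) := by
  have hB2 := card_BB Q L C 5 hQ (fun v hv => (hL v hv).2) (fun v hv => (hL v hv).1) hn
  have hsub : BB L Q C ⊆ X := by
    intro x hx
    obtain ⟨-, w, pw⟩ := mem_BB.1 hx
    exact hB x w pw
  have heq : BB L Q C = X := Finset.eq_of_subset_of_card_le hsub (by omega)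
  have f1 : ∀ w ∈ Q, ∀ d ∈ X, d ∉ L w → Pr L Q d w := by
    intro w hw d hd hdw
    rw [← heq] at hd
    obtain ⟨-, v, pv⟩ := mem_BB.1 hd
    have : v = w := by
      by_contra hne
      exact hdw (pv.2.2 w hw (Ne.symm hne))
    exact this ▸ pv
  refine ⟨f1, ?_, ?_, ?_, ?_⟩
  · intro w hw
    have h1 := Finset.card_sdiff_add_card_inter X (L w)
    have h2 := Finset.card_sdiff_add_card_inter (L w) X
    rw [Finset.inter_comm] at h2
    have := (hL w hw).1
    omega
  · by_contra hall
    push Not at hall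
    have hall' : ∀ v ∈ Q, L v ⊆ X := by
      intro v hv
      exact Finset.sdiff_eq_empty_iff_subset.1 (hall v hv)
    have h1 := card_BB Q L X 5 hQ hall' (fun v hv => (hL v hv).1) hn
    have h2 : BB L Q X ⊆ X := fun x hx => (mem_BB.1 hx).1
    have := Finset.card_le_card h2
    omega
  · intro w hw _ hv
    have he : (Q.erase w).card = 2 := by rw [Finset.card_erase_of_mem hw, hQ]
    obtain ⟨u, u', huu, heq'⟩ := Finset.card_eq_two.1 he
    have hu : u ∈ Q.erase w := by rw [heq']; simp
    have hu' : u' ∈ Q.erase w := by rw [heq']; simp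
    rw [Finset.mem_erase] at hu hu'
    have s1 : L u ⊆ X := Finset.sdiff_eq_empty_iff_subset.1
      (Finset.not_nonempty_iff_eq_empty.1 (hv u hu.2 hu.1))
    have s2 : L u' ⊆ X := Finset.sdiff_eq_empty_iff_subset.1
      (Finset.not_nonempty_iff_eq_empty.1 (hv u' hu'.2 hu'.1))
    have i1 : L u ∩ L u' ⊆ X \ L w := by
      intro x hx
      rw [Finset.mem_inter] at hx
      obtain ⟨t, pt, n1, n2⟩ := Pr_of_two hQ hn hu.2 hu'.2 huu hx.1 hx.2
      have htw : t = w := third hQ hu.2 hu'.2 huu pt.1 hw n1 n2 hu.1.symm hu'.1.symm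
      exact Finset.mem_sdiff.2 ⟨s1 hx.1, htw ▸ pt.2.1⟩
    have i2 := Finset.card_le_card i1
    have i3 := Finset.card_union_add_card_inter (L u) (L u')
    have i4 := Finset.card_le_card (Finset.union_subset s1 s2)
    rw [(hL u hu.2).1, (hL u' hu'.2).1] at i3
    omega
  · intro w hw v hv hne
    rw [Finset.disjoint_left]
    intro x hx hx'
    rw [Finset.mem_sdiff] at hx hx'
    obtain ⟨t, pt, -, -⟩ := Pr_of_two hQ hn hv hw hne hx.1 hx'.1
    exact hx.2 (hB x t pt)

theorem choiceA {V : Type} [DecidableEq V] (C X : Finset ℕ) (hC : C.card ≤ 9)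
    (hX : X.card = 6) (L : V → Finset ℕ) (Q1 Q2 : Finset V)
    (hQ1 : Q1.card = 3) (hQ2 : Q2.card = 3)
    (hL1 : ∀ v ∈ Q1, (L v).card = 5 ∧ L v ⊆ C) (hL2 : ∀ v ∈ Q2, (L v).card = 5 ∧ L v ⊆ C)
    (hn1 : ∀ c, ∃ v ∈ Q1, c ∉ L v) (hn2 : ∀ c, ∃ v ∈ Q2, c ∉ L v) :
    ∃ d1 w1 d2 w2, d1 ≠ d2 ∧ Pr L Q1 d1 w1 ∧ Pr L Q2 d2 w2 ∧ NG X (L w1) (L w2) d1 d2 := by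
  by_cases h1 : ∃ d1 a, Pr L Q1 d1 a ∧ d1 ∉ X
  · obtain ⟨d1, a, p1, hd1⟩ := h1
    obtain ⟨d2, -, w2, hne, p2, hg⟩ :=
      choiceA_i C X hC hX L Q1 Q2 hQ2 hL1 hL2 hn2 d1 a p1 hd1
    exact ⟨d1, a, d2, w2, hne, p1, p2, hg⟩
  by_cases h2 : ∃ d2 a, Pr L Q2 d2 a ∧ d2 ∉ X
  · obtain ⟨d2, a, p2, hd2⟩ := h2
    obtain ⟨d1, -, w1, hne, p1, hg⟩ :=
      choiceA_i C X hC hX L Q2 Q1 hQ1 hL2 hL1 hn1 d2 a p2 hd2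
    exact ⟨d1, w1, d2, a, hne.symm, p1, p2, hg.symm⟩
  push Not at h1 h2
  obtain ⟨a1, a2, a3, a4, a5⟩ := caseii_facts C X hC hX L Q1 hQ1 hL1 hn1 h1
  obtain ⟨b1, b2, b3, b4, b5⟩ := caseii_facts C X hC hX L Q2 hQ2 hL2 hn2 h2
  by_cases hD : ∃ w1 ∈ Q1, ∃ w2 ∈ Q2, (L w1 \ X).Nonempty ∧ (L w2 \ X).Nonempty ∧
      L w1 \ X ≠ L w2 \ X
  · obtain ⟨w1, hw1, w2, hw2, n1, n2, hne⟩ := hD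
    have c1 := a2 w1 hw1
    have c2 := b2 w2 hw2
    have := n1.card_pos
    have := n2.card_pos
    obtain ⟨d1, hd1⟩ : (X \ L w1).Nonempty := by rw [← Finset.card_pos]; omega
    obtain ⟨d2, hd2, hd⟩ := Finset.exists_mem_ne (s := X \ L w2) (by omega) d1
    rw [Finset.mem_sdiff] at hd1 hd2
    refine ⟨d1, w1, d2, w2, hd.symm, a1 w1 hw1 d1 hd1.1 hd1.2, b1 w2 hw2 d2 hd2.1 hd2.2,
      ?_, ?_, ?_⟩
    · rintro ⟨-, -, h⟩
      apply hne
      ext x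
      have hx := Finset.ext_iff.1 h x
      simp only [Finset.mem_sdiff, Finset.mem_singleton] at hx ⊢
      constructor
      · rintro ⟨h1, h2⟩
        exact ⟨(hx.1 ⟨h1, by rintro rfl; exact h2 hd2.1⟩).1, h2⟩
      · rintro ⟨h1, h2⟩
        exact ⟨(hx.2 ⟨h1, by rintro rfl; exact h2 hd1.1⟩).1, h2⟩
    · rintro ⟨-, -, h | h⟩
      · rw [Finset.sdiff_eq_empty_iff_subset.2 h] at n1
        exact Finset.not_nonempty_empty n1
      · rw [Finset.sdiff_eq_empty_iff_subset.2 h] at n2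
        exact Finset.not_nonempty_empty n2
    · intro h7
      have hdis : Disjoint X ((L w1 \ X) ∪ (L w2 \ X)) := by
        rw [Finset.disjoint_left]
        intro x hx hx'
        simp only [Finset.mem_union, Finset.mem_sdiff] at hx'
        tauto
      have h8 : (X ∪ ((L w1 \ X) ∪ (L w2 \ X))).card ≤ 7 := by
        refine le_trans (Finset.card_le_card ?_) h7
        intro x hx
        simp only [Finset.mem_union, Finset.mem_sdiff] at hx ⊢
        tauto
      rw [Finset.card_union_of_disjoint hdis, hX] at h8
      apply hne
      have e1 := Finset.eq_of_subset_of_card_le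
        (Finset.subset_union_left (s₁ := L w1 \ X) (s₂ := L w2 \ X)) (by omega)
      have e2 := Finset.eq_of_subset_of_card_le
        (Finset.subset_union_right (s₁ := L w1 \ X) (s₂ := L w2 \ X)) (by omega)
      rw [e1, ← e2]
  · push Not at hD
    obtain ⟨w1, hw1, n1⟩ := a3
    obtain ⟨w2, hw2, n2⟩ := b3
    have heq := hD w1 hw1 w2 hw2 n1 n2
    have c1 := a4 w1 hw1 n1 (by
      intro v hv hne hnv
      have h := a5 w1 hw1 v hv hne
      rw [hD v hv w2 hw2 hnv n2, heq, disjoint_self] at h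
      rw [h] at n2
      exact Finset.not_nonempty_empty n2)
    have c2 := b4 w2 hw2 n2 (by
      intro v hv hne hnv
      have h := b5 w2 hw2 v hv hne
      rw [← hD w1 hw1 v hv n1 hnv, ← heq, disjoint_self] at h
      rw [h] at n1
      exact Finset.not_nonempty_empty n1)
    have i1 := Finset.card_union_add_card_inter (X \ L w1) (X \ L w2)
    have i2 : ((X \ L w1) ∪ (X \ L w2)).card ≤ X.card := Finset.card_le_card
      (Finset.union_subset Finset.sdiff_subset Finset.sdiff_subset)
    have i3 : 1 < ((X \ L w1) ∩ (X \ L w2)).card := by omega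
    obtain ⟨d1, hd1, d2, hd2, hd⟩ := Finset.one_lt_card.1 i3
    simp only [Finset.mem_inter, Finset.mem_sdiff] at hd1 hd2
    refine ⟨d1, w1, d2, w2, hd, a1 w1 hw1 d1 hd1.1.1 hd1.1.2, b1 w2 hw2 d2 hd2.2.1 hd2.2.2,
      ?_, ?_, ?_⟩
    · exact fun h => hd2.1.2 h.1
    · rintro ⟨-, -, h | h⟩
      · rw [Finset.sdiff_eq_empty_iff_subset.2 h] at n1
        exact Finset.not_nonempty_empty n1
      · rw [Finset.sdiff_eq_empty_iff_subset.2 h] at n2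
        exact Finset.not_nonempty_empty n2
    · intro h7
      have h8 : (X ∪ (L w1 \ X)).card ≤ 7 := by
        refine le_trans (Finset.card_le_card ?_) h7
        intro x hx
        simp only [Finset.mem_union, Finset.mem_sdiff] at hx ⊢
        tauto
      rw [Finset.card_union_of_disjoint Finset.disjoint_sdiff, hX] at h8
      have := a2 w1 hw1
      omega

theorem sdiff_one_self {A : Finset ℕ} {c : ℕ} (h : c ∉ A) : A \ {c} = A := by
  rw [Finset.sdiff_singleton_eq_erase, Finset.erase_eq_of_notMem h]

theorem card_sdiff_one (A : Finset ℕ) (c n : ℕ) (h : n + 1 ≤ A.card) : n ≤ (A \ {c}).card := by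
  have := Finset.le_card_sdiff {c} A
  simp only [Finset.card_singleton] at this
  omega

theorem le_biUnion {V : Type} [DecidableEq V] (L : V → Finset ℕ) {X : Finset V} {v : V}
    (hv : v ∈ X) : (L v).card ≤ (X.biUnion L).card :=
  Finset.card_le_card (Finset.subset_biUnion_of_mem L hv)

theorem greedy5 {V ι : Type} [DecidableEq V] (π : V → ι) (Y : Finset V) (w z : V)
    (L : V → Finset ℕ) (hY : Y.card ≤ 3) (hLY : ∀ v ∈ Y, 3 ≤ (L v).card)
    (hw : 4 ≤ (L w).card) (hz : 5 ≤ (L z).card) : LC π (insert z (insert w Y)) L := by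
  apply LC.of_hall
  intro X hX
  have h1 := Finset.card_insert_le w Y
  have h2 := Finset.card_insert_le z (insert w Y)
  by_cases hzX : z ∈ X
  · have := le_biUnion L hzX
    have := Finset.card_le_card hX
    omega
  have hX1 : X ⊆ insert w Y := (Finset.subset_insert_iff_of_notMem hzX).1 hX
  by_cases hwX : w ∈ X
  · have := le_biUnion L hwX
    have := Finset.card_le_card hX1
    omega
  have hX2 : X ⊆ Y := (Finset.subset_insert_iff_of_notMem hwX).1 hX1
  rcases X.eq_empty_or_nonempty with rfl | ⟨v, hv⟩
  · simp
  have := le_biUnion L hv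
  have := Finset.card_le_card hX2
  have := hLY v (hX2 hv)
  omega

theorem greedy4 {V ι : Type} [DecidableEq V] (π : V → ι) (Y : Finset V) (z : V)
    (L : V → Finset ℕ) (hY : Y.card ≤ 3) (hLY : ∀ v ∈ Y, 3 ≤ (L v).card)
    (hz : 4 ≤ (L z).card) : LC π (insert z Y) L := by
  apply LC.of_hall
  intro X hX
  have h2 := Finset.card_insert_le z Y
  by_cases hzX : z ∈ X
  · have := le_biUnion L hzX
    have := Finset.card_le_card hX
    omega
  have hX2 : X ⊆ Y := (Finset.subset_insert_iff_of_notMem hzX).1 hX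
  rcases X.eq_empty_or_nonempty with rfl | ⟨v, hv⟩
  · simp
  have := le_biUnion L hv
  have := Finset.card_le_card hX2
  have := hLY v (hX2 hv)
  omega

theorem B0 {V ι : Type} [DecidableEq V] [DecidableEq ι] (π : V → ι) (Q Y : Finset V) (z : V)
    (i : ι) (hQ : Q.card = 3) (hQπ : ∀ v ∈ Q, π v = i) (hY : Y.card ≤ 3) (hz : z ∉ Q)
    (L : V → Finset ℕ) (hLQ : ∀ v ∈ Q, 4 ≤ (L v).card) (hLY : ∀ v ∈ Y, 4 ≤ (L v).card)
    (hLz : 5 ≤ (L z).card) : LC π (Q ∪ Y ∪ {z}) L := by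
  refine small_pot π _ (fun v => if v = z then 5 else 4) 6 ?_ ?_ ?_ L ?_
  · have h1 := Finset.card_union_le (Q ∪ Y) {z}
    have h2 := Finset.card_union_le Q Y
    simp only [Finset.card_singleton] at h1
    omega
  · intro v _; split_ifs <;> omega
  swap
  · intro v hv
    simp only [Finset.mem_union, Finset.mem_singleton] at hv
    by_cases hvz : v = z
    · simp only [hvz, if_true]; exact hLz
    · simp only [hvz, if_false]
      rcases hv with (hv | hv) | hv
      · exact hLQ v hv
      · exact hLY v hv
      · exact absurd hv hvz
  clear hLQ hLY hLz L
  intro L hL hC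
  set C := (Q ∪ Y ∪ {z}).biUnion L with hCdef
  have hsub : ∀ v ∈ Q ∪ Y ∪ {z}, L v ⊆ C := fun v hv => Finset.subset_biUnion_of_mem L hv
  have hLz : (L z).card = 5 := by have := hL z (by simp); simpa using this
  have hLQ : ∀ v ∈ Q, (L v).card = 4 := by
    intro v hv
    have := hL v (by simp [hv])
    have hne : v ≠ z := by rintro rfl; exact hz hv
    simpa [hne] using this
  have hLY : ∀ v ∈ Y, 4 ≤ (L v).card := by
    intro v hv
    have := hL v (by simp [hv])
    rw [this]; split_ifs <;> omega
  by_cases hcom : ∃ c, ∀ v ∈ Q, c ∈ L v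
  · obtain ⟨c, hc⟩ := hcom
    refine LC.step' Q i c (fun v hv => ⟨hQπ v hv, hc v hv⟩) ?_
    refine (greedy4 π Y z _ hY (fun v hv => card_sdiff_one _ _ _ (hLY v hv))
      (card_sdiff_one _ _ _ hLz.ge)).mono ?_ (fun _ _ => Finset.Subset.refl _)
    intro v hv
    simp only [Finset.mem_sdiff, Finset.mem_union, Finset.mem_singleton, Finset.mem_insert] at hv ⊢
    tauto
  push Not at hcom
  have hB := card_BB Q L C 4 hQ (fun v hv => hsub v (by simp [hv])) hLQ hcom
  have hBC : BB L Q C ⊆ C := fun x hx => (mem_BB.1 hx).1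
  have hex : ∃ c ∈ BB L Q C, c ∉ L z := by
    by_contra hno
    push Not at hno
    have := Finset.card_le_card (s := BB L Q C) (t := L z) hno
    omega
  obtain ⟨c, hcB, hcz⟩ := hex
  obtain ⟨-, w, hw, hcw, hwo⟩ := mem_BB.1 hcB
  refine LC.step' (Q.erase w) i c (fun v hv => ?_) ?_
  · rw [Finset.mem_erase] at hv
    exact ⟨hQπ v hv.2, hwo v hv.2 hv.1⟩
  refine (greedy5 π Y w z _ hY (fun v hv => card_sdiff_one _ _ _ (hLY v hv)) ?_ ?_).mono ?_
    (fun _ _ => Finset.Subset.refl _)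
  · rw [sdiff_one_self hcw, hLQ w hw]
  · rw [sdiff_one_self hcz, hLz]
  · intro v hv
    simp only [Finset.mem_sdiff, Finset.mem_union, Finset.mem_singleton, Finset.mem_insert,
      Finset.mem_erase] at hv ⊢
    tauto

theorem A0 {V ι : Type} [DecidableEq V] [DecidableEq ι] (π : V → ι) (Q1 Q2 Y : Finset V) (z : V)
    (i1 i2 : ι) (hQ1 : Q1.card = 3) (hQ2 : Q2.card = 3) (hπ1 : ∀ v ∈ Q1, π v = i1)
    (hπ2 : ∀ v ∈ Q2, π v = i2) (hi : i1 ≠ i2) (hY : Y.card ≤ 3) (hz1 : z ∉ Q1) (hz2 : z ∉ Q2)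
    (L : V → Finset ℕ) (hL1 : ∀ v ∈ Q1, (L v).card = 5) (hL2 : ∀ v ∈ Q2, (L v).card = 5)
    (hLY : ∀ v ∈ Y, 5 ≤ (L v).card) (hLz : (L z).card = 6)
    (hC : ((Q1 ∪ Q2 ∪ Y ∪ {z}).biUnion L).card ≤ 9) : LC π (Q1 ∪ Q2 ∪ Y ∪ {z}) L := by
  set C := (Q1 ∪ Q2 ∪ Y ∪ {z}).biUnion L with hCdef
  have hsub : ∀ v ∈ Q1 ∪ Q2 ∪ Y ∪ {z}, L v ⊆ C := fun v hv => Finset.subset_biUnion_of_mem L hv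
  by_cases hcom1 : ∃ c, ∀ v ∈ Q1, c ∈ L v
  · obtain ⟨c, hc⟩ := hcom1
    refine LC.step' Q1 i1 c (fun v hv => ⟨hπ1 v hv, hc v hv⟩) ?_
    refine (B0 π Q2 Y z i2 hQ2 hπ2 hY hz2 _ (fun v hv => card_sdiff_one _ _ _ (hL2 v hv).ge)
      (fun v hv => card_sdiff_one _ _ _ (hLY v hv))
      (card_sdiff_one _ _ _ hLz.ge)).mono ?_ (fun _ _ => Finset.Subset.refl _)
    intro v hv
    simp only [Finset.mem_sdiff, Finset.mem_union] at hv ⊢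
    tauto
  by_cases hcom2 : ∃ c, ∀ v ∈ Q2, c ∈ L v
  · obtain ⟨c, hc⟩ := hcom2
    refine LC.step' Q2 i2 c (fun v hv => ⟨hπ2 v hv, hc v hv⟩) ?_
    refine (B0 π Q1 Y z i1 hQ1 hπ1 hY hz1 _ (fun v hv => card_sdiff_one _ _ _ (hL1 v hv).ge)
      (fun v hv => card_sdiff_one _ _ _ (hLY v hv))
      (card_sdiff_one _ _ _ hLz.ge)).mono ?_ (fun _ _ => Finset.Subset.refl _)
    intro v hv
    simp only [Finset.mem_sdiff, Finset.mem_union] at hv ⊢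
    tauto
  push Not at hcom1 hcom2
  obtain ⟨d1, w1, d2, w2, hd, p1, p2, g1, g2, g3⟩ := choiceA C (L z) hC hLz L Q1 Q2 hQ1 hQ2
    (fun v hv => ⟨hL1 v hv, hsub v (by simp [hv])⟩)
    (fun v hv => ⟨hL2 v hv, hsub v (by simp [hv])⟩) hcom1 hcom2
  obtain ⟨hw1, hdw1, ho1⟩ := p1
  obtain ⟨hw2, hdw2, ho2⟩ := p2
  refine LC.step' (Q1.erase w1) i1 d1 (fun v hv => ?_) ?_
  · rw [Finset.mem_erase] at hv
    exact ⟨hπ1 v hv.2, ho1 v hv.2 hv.1⟩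
  refine LC.step' (Q2.erase w2) i2 d2 (fun v hv => ?_) ?_
  · rw [Finset.mem_erase] at hv
    refine ⟨hπ2 v hv.2, ?_⟩
    simp only [Finset.mem_sdiff, Finset.mem_singleton]
    exact ⟨ho2 v hv.2 hv.1, hd.symm⟩
  suffices h : LC π (insert w1 (insert w2 (insert z Y))) (fun v => L v \ {d1, d2}) by
    refine h.mono ?_ ?_
    · intro v hv
      simp only [Finset.mem_sdiff, Finset.mem_union, Finset.mem_singleton, Finset.mem_insert,
        Finset.mem_erase] at hv ⊢
      clear * - hv
      grind
    · intro v _ x hx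
      simp only [Finset.mem_sdiff, Finset.mem_singleton, Finset.mem_insert] at hx ⊢
      clear * - hx
      grind
  apply LC.of_hall
  intro X hX
  by_contra hlt
  push Not at hlt
  set R := X.biUnion (fun v => L v \ {d1, d2}) with hR
  have hRv : ∀ v ∈ X, L v \ {d1, d2} ⊆ R := fun v hv =>
    Finset.subset_biUnion_of_mem (fun v => L v \ {d1, d2}) hv
  have c2 : ({d1, d2} : Finset ℕ).card = 2 := Finset.card_pair hd
  have cY : ∀ v ∈ X, (L v).card ≤ R.card + ((L v) ∩ {d1, d2}).card := by
    intro v hv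
    have h1 := Finset.card_le_card (hRv v hv)
    have h2 := Finset.card_sdiff_add_card_inter (L v) {d1, d2}
    omega
  have int2 : ∀ A : Finset ℕ, (A ∩ {d1, d2}).card ≤ 2 := fun A =>
    (Finset.card_le_card Finset.inter_subset_right).trans c2.le
  have int1 : ((L w1) ∩ {d1, d2}).card ≤ 1 := by
    have : (L w1) ∩ {d1, d2} ⊆ {d2} := by
      intro x hx
      simp only [Finset.mem_inter, Finset.mem_insert, Finset.mem_singleton] at hx ⊢
      rcases hx with ⟨a, rfl | rfl⟩
      · exact absurd a hdw1
      · rfl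
    simpa using Finset.card_le_card this
  have int1' : ((L w2) ∩ {d1, d2}).card ≤ 1 := by
    have : (L w2) ∩ {d1, d2} ⊆ {d1} := by
      intro x hx
      simp only [Finset.mem_inter, Finset.mem_insert, Finset.mem_singleton] at hx ⊢
      rcases hx with ⟨a, rfl | rfl⟩
      · rfl
      · exact absurd a hdw2
    simpa using Finset.card_le_card this
  have hw12 : w1 ≠ w2 := by
    rintro rfl; exact hi ((hπ1 _ hw1).symm.trans (hπ2 _ hw2))
  have hzw1 : z ≠ w1 := by rintro rfl; exact hz1 hw1
  have hzw2 : z ≠ w2 := by rintro rfl; exact hz2 hw2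
  have lw1 := hL1 w1 hw1
  have lw2 := hL2 w2 hw2
  -- cardinality of a subset missing some vertices
  have e1 := Finset.card_insert_le w1 (insert w2 (insert z Y))
  have e2 := Finset.card_insert_le w2 (insert z Y)
  have e3 := Finset.card_insert_le z Y
  have hXc : X.card ≤ 6 := (Finset.card_le_card hX).trans (by omega)
  have hne : X.Nonempty := Finset.card_pos.1 (by omega)
  -- the list of every vertex has at least 5 elements
  have h4 : 4 ≤ X.card := by
    obtain ⟨v, hv⟩ := hne
    have h1 := cY v hv
    have h2 := int2 (L v)
    have h5 : 5 ≤ (L v).card := by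
      have := hX hv
      simp only [Finset.mem_insert] at this
      rcases this with rfl | rfl | rfl | h
      · omega
      · omega
      · omega
      · exact hLY v h
    omega
  have hS : ¬ X ⊆ Y := fun h => by have := Finset.card_le_card h; omega
  have h5 : 5 ≤ X.card := by
    obtain ⟨v, hv, hvY⟩ := Finset.not_subset.1 hS
    have h1 := cY v hv
    have h2 := int2 (L v)
    have := hX hv
    simp only [Finset.mem_insert] at this
    rcases this with rfl | rfl | rfl | h
    · omega
    · omega
    · omega
    · exact absurd h hvY
  -- two missing vertices are impossible
  have miss : ∀ a b : V, a ∈ insert w1 (insert w2 (insert z Y)) →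
      b ∈ insert w1 (insert w2 (insert z Y)) → a ≠ b → a ∉ X → b ∈ X := by
    intro a b ha hb hab haX
    by_contra hbX
    have hs : X ⊆ ((insert w1 (insert w2 (insert z Y))).erase a).erase b := by
      intro v hv
      simp only [Finset.mem_erase]
      exact ⟨fun h => hbX (h ▸ hv), fun h => haX (h ▸ hv), hX hv⟩
    have := Finset.card_le_card hs
    rw [Finset.card_erase_of_mem (Finset.mem_erase.2 ⟨hab.symm, hb⟩),
      Finset.card_erase_of_mem ha] at this
    omega
  by_cases h6 : X.card = 6
  · have hXe : X = insert w1 (insert w2 (insert z Y)) :=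
      Finset.eq_of_subset_of_card_le hX (by omega)
    apply g3
    have hs : L w1 ∪ L w2 ∪ L z ∪ {d1, d2} ⊆ R ∪ {d1, d2} := by
      have q1 := hRv w1 (by rw [hXe]; simp)
      have q2 := hRv w2 (by rw [hXe]; simp)
      have q3 := hRv z (by rw [hXe]; simp)
      intro x hx
      by_cases hxd : x ∈ ({d1, d2} : Finset ℕ)
      · exact Finset.mem_union_right _ hxd
      · refine Finset.mem_union_left _ ?_
        simp only [Finset.mem_union, hxd, or_false] at hx
        rcases hx with (hx | hx) | hx
        · exact q1 (Finset.mem_sdiff.2 ⟨hx, hxd⟩)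
        · exact q2 (Finset.mem_sdiff.2 ⟨hx, hxd⟩)
        · exact q3 (Finset.mem_sdiff.2 ⟨hx, hxd⟩)
    have := (Finset.card_le_card hs).trans (Finset.card_union_le _ _)
    omega
  have hR4 : R.card ≤ 4 := by omega
  have eqR1 : w1 ∈ X → L w1 \ {d1, d2} = R := by
    intro h
    apply Finset.eq_of_subset_of_card_le (hRv w1 h)
    have h2 := Finset.card_sdiff_add_card_inter (L w1) {d1, d2}
    omega
  have eqR2 : w2 ∈ X → L w2 \ {d1, d2} = R := by
    intro h
    apply Finset.eq_of_subset_of_card_le (hRv w2 h)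
    have h2 := Finset.card_sdiff_add_card_inter (L w2) {d1, d2}
    omega
  have eqRz : z ∈ X → L z \ {d1, d2} = R ∧ {d1, d2} ⊆ L z := by
    intro h
    have h2 := Finset.card_sdiff_add_card_inter (L z) {d1, d2}
    have h3 := int2 (L z)
    have h4 := cY z h
    refine ⟨Finset.eq_of_subset_of_card_le (hRv z h) (by omega), ?_⟩
    have := Finset.eq_of_subset_of_card_le
      (Finset.inter_subset_right : L z ∩ {d1, d2} ⊆ {d1, d2}) (by omega)
    exact Finset.inter_eq_right.1 this
  have m1 : w1 ∈ X → d2 ∈ L w1 := by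
    intro h
    by_contra hd2
    have := cY w1 h
    have h0 : L w1 ∩ {d1, d2} = ∅ := by
      ext x
      simp only [Finset.mem_inter, Finset.mem_insert, Finset.mem_singleton, Finset.notMem_empty,
        iff_false]
      rintro ⟨a, rfl | rfl⟩
      · exact hdw1 a
      · exact hd2 a
    rw [h0, Finset.card_empty] at this
    omega
  have m2 : w2 ∈ X → d1 ∈ L w2 := by
    intro h
    by_contra hd2
    have := cY w2 h
    have h0 : L w2 ∩ {d1, d2} = ∅ := by
      ext x
      simp only [Finset.mem_inter, Finset.mem_insert, Finset.mem_singleton, Finset.notMem_empty,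
        iff_false]
      rintro ⟨a, rfl | rfl⟩
      · exact hd2 a
      · exact hdw2 a
    rw [h0, Finset.card_empty] at this
    omega
  have r1 : L w1 \ {d2} = L w1 \ {d1, d2} := by
    ext x
    simp only [Finset.mem_sdiff, Finset.mem_insert, Finset.mem_singleton, not_or]
    refine ⟨fun h => ⟨h.1, fun e => hdw1 (e ▸ h.1), h.2⟩, fun h => ⟨h.1, h.2.2⟩⟩
  have r2 : L w2 \ {d1} = L w2 \ {d1, d2} := by
    ext x
    simp only [Finset.mem_sdiff, Finset.mem_insert, Finset.mem_singleton, not_or]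
    refine ⟨fun h => ⟨h.1, h.2, fun e => hdw2 (e ▸ h.1)⟩, fun h => ⟨h.1, h.2.1⟩⟩
  have zc : ∀ w, z ∈ X → L w \ {d1, d2} = R → L w ⊆ L z := by
    intro w hzX hw x hx
    obtain ⟨q1, q2⟩ := eqRz hzX
    by_cases hxd : x ∈ ({d1, d2} : Finset ℕ)
    · exact q2 hxd
    · have : x ∈ L z \ {d1, d2} := by
        rw [q1, ← hw]; exact Finset.mem_sdiff.2 ⟨hx, hxd⟩
      exact (Finset.mem_sdiff.1 this).1
  by_cases hx1 : w1 ∈ X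
  · by_cases hx2 : w2 ∈ X
    · exact g1 ⟨m1 hx1, m2 hx2, by rw [r1, r2, eqR1 hx1, eqR2 hx2]⟩
    · have hzX := miss w2 z (by simp) (by simp) hzw2.symm hx2
      obtain ⟨q1, q2⟩ := eqRz hzX
      exact g2 ⟨q2 (by simp), q2 (by simp), Or.inl (zc w1 hzX (eqR1 hx1))⟩
  · have hx2 := miss w1 w2 (by simp) (by simp) hw12 hx1
    have hzX := miss w1 z (by simp) (by simp) hzw1.symm hx1
    obtain ⟨q1, q2⟩ := eqRz hzX
    exact g2 ⟨q2 (by simp), q2 (by simp), Or.inr (zc w2 hzX (eqR2 hx2))⟩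

theorem pair_common {V : Type} [DecidableEq V] (T : Finset V) (hT : T.card = 2)
    (L : V → Finset ℕ) (C : Finset ℕ) (m : ℕ) (hsub : ∀ v ∈ T, L v ⊆ C)
    (hm : ∀ v ∈ T, m ≤ (L v).card) (hC : C.card < 2 * m) : ∃ c, ∀ v ∈ T, c ∈ L v := by
  obtain ⟨u, v, huv, rfl⟩ := Finset.card_eq_two.1 hT
  have h1 := Finset.card_union_add_card_inter (L u) (L v)
  have h2 := Finset.card_le_card (Finset.union_subset (hsub u (by simp)) (hsub v (by simp)))
  have h3 := hm u (by simp)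
  have h4 := hm v (by simp)
  obtain ⟨c, hc⟩ := Finset.card_pos.1 (show 0 < (L u ∩ L v).card by omega)
  rw [Finset.mem_inter] at hc
  refine ⟨c, fun x hx => ?_⟩
  simp only [Finset.mem_insert, Finset.mem_singleton] at hx
  rcases hx with rfl | rfl
  · exact hc.1
  · exact hc.2

theorem three_of_four {V : Type} [DecidableEq V] (P : Finset V) (hP : P.card = 4)
    (L : V → Finset ℕ) (c : ℕ) (h : 3 ≤ (P.filter (fun v => c ∈ L v)).card) :
    ∃ w ∈ P, ∀ v ∈ P, v ≠ w → c ∈ L v := by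
  have h1 := Finset.card_filter_add_card_filter_not (s := P) (fun v => c ∈ L v)
  have h2 : (P.filter (fun v => ¬ c ∈ L v)).card ≤ 1 := by omega
  rcases (P.filter (fun v => ¬ c ∈ L v)).eq_empty_or_nonempty with he | ⟨w, hw⟩
  · obtain ⟨w, hw⟩ := Finset.card_pos.1 (show 0 < P.card by omega)
    refine ⟨w, hw, fun v hv _ => ?_⟩
    by_contra hc
    have : v ∈ P.filter (fun v => ¬ c ∈ L v) := Finset.mem_filter.2 ⟨hv, hc⟩
    rw [he] at this
    simp at this
  · refine ⟨w, (Finset.mem_filter.1 hw).1, fun v hv hvw => ?_⟩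
    by_contra hc
    exact hvw (Finset.card_le_one.1 h2 v (Finset.mem_filter.2 ⟨hv, hc⟩) w hw)

theorem thmA {V ι : Type} [DecidableEq V] [DecidableEq ι] (π : V → ι) (Q1 Q2 Y : Finset V)
    (z : V) (i1 i2 : ι) (hQ1 : Q1.card = 3) (hQ2 : Q2.card = 3) (hπ1 : ∀ v ∈ Q1, π v = i1)
    (hπ2 : ∀ v ∈ Q2, π v = i2) (hi : i1 ≠ i2) (hY : Y.card ≤ 3) (hz1 : z ∉ Q1) (hz2 : z ∉ Q2)
    (pr : ι → Finset V) (n : ℕ) : ∀ (J : Finset ι), J.card = n →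
    (∀ j ∈ J, (pr j).card = 2 ∧ ∀ v ∈ pr j, π v = j) → ∀ L : V → Finset ℕ,
    (∀ v ∈ Q1 ∪ Q2 ∪ Y ∪ {z} ∪ J.biUnion pr, n + 5 ≤ (L v).card) → n + 6 ≤ (L z).card →
    LC π (Q1 ∪ Q2 ∪ Y ∪ {z} ∪ J.biUnion pr) L := by
  induction n with
  | zero =>
    intro J hJ _ L hL hLz
    obtain rfl := Finset.card_eq_zero.1 hJ
    rw [Finset.biUnion_empty, Finset.union_empty] at hL ⊢
    refine small_pot π _ (fun v => if v = z then 6 else 5) 9 ?_ ?_ ?_ L ?_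
    · have h1 := Finset.card_union_le (Q1 ∪ Q2 ∪ Y) {z}
      have h2 := Finset.card_union_le (Q1 ∪ Q2) Y
      have h3 := Finset.card_union_le Q1 Q2
      simp only [Finset.card_singleton] at h1
      omega
    · intro v _; split_ifs <;> omega
    swap
    · intro v hv
      split_ifs with hvz
      · rw [hvz]; exact hLz
      · exact hL v hv
    clear hL hLz L
    intro L hL hC
    refine A0 π Q1 Q2 Y z i1 i2 hQ1 hQ2 hπ1 hπ2 hi hY hz1 hz2 L ?_ ?_ ?_ ?_ hC
    · intro v hv
      have hne : v ≠ z := by rintro rfl; exact hz1 hv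
      simpa [hne] using hL v (by simp [hv])
    · intro v hv
      have hne : v ≠ z := by rintro rfl; exact hz2 hv
      simpa [hne] using hL v (by simp [hv])
    · intro v hv
      rw [hL v (by simp [hv])]
      split_ifs <;> omega
    · simpa using hL z (by simp)
  | succ n ih =>
    intro J hJ hpr L hL hLz
    refine small_pot π _ (fun v => if v = z then n + 7 else n + 6) (2 * n + 11) ?_ ?_ ?_ L ?_
    · have h1 := Finset.card_union_le (Q1 ∪ Q2 ∪ Y) {z}
      have h2 := Finset.card_union_le (Q1 ∪ Q2) Y
      have h3 := Finset.card_union_le Q1 Q2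
      have h4 := Finset.card_union_le (Q1 ∪ Q2 ∪ Y ∪ {z}) (J.biUnion pr)
      have h5 := Finset.card_biUnion_le_card_mul J pr 2 (fun j hj => (hpr j hj).1.le)
      simp only [Finset.card_singleton] at h1
      omega
    · intro v _; split_ifs <;> omega
    swap
    · intro v hv
      split_ifs with hvz
      · rw [hvz]; omega
      · have := hL v hv; omega
    clear hL hLz L
    intro L hL hC
    obtain ⟨j, hj⟩ := Finset.card_pos.1 (show 0 < J.card by omega)
    have hge : ∀ v ∈ Q1 ∪ Q2 ∪ Y ∪ {z} ∪ J.biUnion pr, n + 6 ≤ (L v).card := by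
      intro v hv
      rw [hL v hv]; split_ifs <;> omega
    have hjS : pr j ⊆ Q1 ∪ Q2 ∪ Y ∪ {z} ∪ J.biUnion pr :=
      (Finset.subset_biUnion_of_mem pr hj).trans Finset.subset_union_right
    obtain ⟨c, hc⟩ := pair_common (pr j) (hpr j hj).1 L _ (n + 6)
      (fun v hv => Finset.subset_biUnion_of_mem L (hjS hv)) (fun v hv => hge v (hjS hv)) (by omega)
    refine LC.step' (pr j) j c (fun v hv => ⟨(hpr j hj).2 v hv, hc v hv⟩) ?_
    refine (ih (J.erase j) (by rw [Finset.card_erase_of_mem hj]; omega)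
      (fun i hi => hpr i (Finset.mem_of_mem_erase hi)) (fun v => L v \ {c}) ?_ ?_).mono ?_
      (fun _ _ => Finset.Subset.refl _)
    · intro v hv
      apply card_sdiff_one
      apply hge v
      exact Finset.union_subset_union (Finset.Subset.refl _)
        (Finset.biUnion_subset_biUnion_of_subset_left pr (Finset.erase_subset _ _)) hv
    · apply card_sdiff_one
      have := hL z (by simp)
      simp only [if_true] at this
      omega
    · intro v hv
      rw [Finset.mem_sdiff, Finset.mem_union] at hv
      rw [Finset.mem_union]
      obtain ⟨h | h, h'⟩ := hv
      · exact Or.inl h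
      · right
        obtain ⟨i, hi, hvi⟩ := Finset.mem_biUnion.1 h
        refine Finset.mem_biUnion.2 ⟨i, Finset.mem_erase.2 ⟨?_, hi⟩, hvi⟩
        rintro rfl
        exact h' hvi

theorem thmB {V ι : Type} [DecidableEq V] [DecidableEq ι] (π : V → ι) (P Q Y : Finset V)
    (i1 i2 : ι) (hP : P.card = 4) (hQ : Q.card = 3) (hπ1 : ∀ v ∈ P, π v = i1)
    (hπ2 : ∀ v ∈ Q, π v = i2) (hi : i1 ≠ i2) (hY : Y.card ≤ 3)
    (pr : ι → Finset V) (n : ℕ) : ∀ (J : Finset ι), J.card = n →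
    (∀ j ∈ J, (pr j).card = 2 ∧ ∀ v ∈ pr j, π v = j) → ∀ L : V → Finset ℕ,
    (∀ v ∈ P ∪ Q ∪ Y ∪ J.biUnion pr, n + 5 ≤ (L v).card) →
    LC π (P ∪ Q ∪ Y ∪ J.biUnion pr) L := by
  induction n with
  | zero =>
    intro J hJ _ L hL
    obtain rfl := Finset.card_eq_zero.1 hJ
    rw [Finset.biUnion_empty, Finset.union_empty] at hL ⊢
    refine small_pot π _ (fun _ => 5) 9 ?_ ?_ ?_ L hL
    · have h2 := Finset.card_union_le (P ∪ Q) Y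
      have h3 := Finset.card_union_le P Q
      omega
    · intro v _; omega
    clear hL L
    intro L hL hC
    have hsub : ∀ v ∈ P, L v ⊆ (P ∪ Q ∪ Y).biUnion L := fun v hv =>
      Finset.subset_biUnion_of_mem L (by simp [hv])
    have hsum := sum_cnt P L _ hsub
    have h1 : ∑ v ∈ P, (L v).card = 20 := by
      rw [Finset.sum_congr rfl (fun v hv => hL v (by simp [hv]))]
      simp [hP]
    have h2 : ∃ c, 3 ≤ (P.filter (fun v => c ∈ L v)).card := by
      by_contra hno
      push Not at hno
      have := Finset.sum_le_card_nsmul ((P ∪ Q ∪ Y).biUnion L)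
        (fun c => (P.filter (fun v => c ∈ L v)).card) 2 (fun c _ => by have := hno c; omega)
      rw [smul_eq_mul] at this
      omega
    obtain ⟨c, hc⟩ := h2
    obtain ⟨w, hw, hwo⟩ := three_of_four P hP L c hc
    have hwQ : w ∉ Q := fun h => hi ((hπ1 w hw).symm.trans (hπ2 w h))
    refine LC.step (P.erase w) i1 c (fun v hv => ?_) ?_
    · rw [Finset.mem_erase] at hv
      exact ⟨hπ1 v hv.2, hwo v hv.2 hv.1⟩
    have hge : ∀ v ∈ P ∪ Q ∪ Y, 4 ≤ (if π v = i1 then L v else L v \ {c}).card := by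
      intro v hv
      have := hL v hv
      split_ifs
      · omega
      · exact card_sdiff_one _ _ _ this.ge
    refine (B0 π Q Y w i2 hQ hπ2 hY hwQ _ (fun v hv => hge v (by simp [hv]))
      (fun v hv => hge v (by simp [hv])) ?_).mono ?_ (fun _ _ => Finset.Subset.refl _)
    · simp only [hπ1 w hw, if_true]
      exact (hL w (by simp [hw])).ge
    · intro v hv
      simp only [Finset.mem_sdiff, Finset.mem_union, Finset.mem_singleton,
        Finset.mem_erase] at hv ⊢
      clear * - hv
      grind
  | succ n ih =>
    intro J hJ hpr L hL
    refine small_pot π _ (fun _ => n + 6) (2 * n + 11) ?_ ?_ ?_ L ?_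
    · have h2 := Finset.card_union_le (P ∪ Q) Y
      have h3 := Finset.card_union_le P Q
      have h4 := Finset.card_union_le (P ∪ Q ∪ Y) (J.biUnion pr)
      have h5 := Finset.card_biUnion_le_card_mul J pr 2 (fun j hj => (hpr j hj).1.le)
      omega
    · intro v _; omega
    swap
    · intro v hv
      have := hL v hv; omega
    clear hL L
    intro L hL hC
    obtain ⟨j, hj⟩ := Finset.card_pos.1 (show 0 < J.card by omega)
    have hjS : pr j ⊆ P ∪ Q ∪ Y ∪ J.biUnion pr :=
      (Finset.subset_biUnion_of_mem pr hj).trans Finset.subset_union_right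
    obtain ⟨c, hc⟩ := pair_common (pr j) (hpr j hj).1 L _ (n + 6)
      (fun v hv => Finset.subset_biUnion_of_mem L (hjS hv)) (fun v hv => (hL v (hjS hv)).ge)
      (by omega)
    refine LC.step' (pr j) j c (fun v hv => ⟨(hpr j hj).2 v hv, hc v hv⟩) ?_
    refine (ih (J.erase j) (by rw [Finset.card_erase_of_mem hj]; omega)
      (fun i hi => hpr i (Finset.mem_of_mem_erase hi)) (fun v => L v \ {c}) ?_).mono ?_
      (fun _ _ => Finset.Subset.refl _)
    · intro v hv
      apply card_sdiff_one
      apply (hL v _).ge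
      exact Finset.union_subset_union (Finset.Subset.refl _)
        (Finset.biUnion_subset_biUnion_of_subset_left pr (Finset.erase_subset _ _)) hv
    · intro v hv
      rw [Finset.mem_sdiff, Finset.mem_union] at hv
      rw [Finset.mem_union]
      obtain ⟨h | h, h'⟩ := hv
      · exact Or.inl h
      · right
        obtain ⟨i, hi, hvi⟩ := Finset.mem_biUnion.1 h
        refine Finset.mem_biUnion.2 ⟨i, Finset.mem_erase.2 ⟨?_, hi⟩, hvi⟩
        rintro rfl
        exact h' hvi

theorem exists_inj (A B : Finset ℕ) (h : A.card = B.card) :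
    ∃ f : ℕ → ℕ, (∀ c ∈ A, f c ∈ B) ∧ ∀ c ∈ A, ∀ c' ∈ A, f c = f c' → c = c' := by
  let e := Finset.equivOfCardEq h
  refine ⟨fun c => if hc : c ∈ A then (e ⟨c, hc⟩ : ℕ) else 0, ?_, ?_⟩
  · intro c hc
    simp [hc]
  · intro c hc c' hc' heq
    simp only [hc, hc', dif_pos] at heq
    have := e.injective (Subtype.ext heq)
    simpa using this

theorem exists_phi {V : Type} [DecidableEq V] (P : Finset V) (hP : P.card = 4)
    (L : V → Finset ℕ) (C : Finset ℕ) (k : ℕ) (hsub : ∀ v ∈ P, L v ⊆ C) (hC : C.card = 2 * k)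
    (hL : ∀ v ∈ P, (L v).card = k) (h2 : ∀ c ∈ C, (P.filter (fun v => c ∈ L v)).card = 2) :
    ∃ φ : ℕ → ℕ, Set.InjOn φ (C : Set ℕ) ∧ ∀ c ∈ C, ∀ x ∈ P, c ∉ L x → φ c ∈ L x := by
  have hcard : ∀ T, ∃ f : ℕ → ℕ, T ∈ P.powersetCard 2 →
      (∀ c ∈ C.filter (fun c => P.filter (fun v => c ∈ L v) = T),
        f c ∈ C.filter (fun c => P.filter (fun v => c ∈ L v) = P \ T)) ∧
      ∀ c ∈ C.filter (fun c => P.filter (fun v => c ∈ L v) = T),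
      ∀ c' ∈ C.filter (fun c => P.filter (fun v => c ∈ L v) = T), f c = f c' → c = c' := by
    intro T
    by_cases hT : T ∈ P.powersetCard 2
    swap
    · exact ⟨id, fun h => absurd h hT⟩
    rw [Finset.mem_powersetCard] at hT
    obtain ⟨hTP, hT2⟩ := hT
    have hT2' := hT2
    obtain ⟨x, y, hxy, hTe⟩ := Finset.card_eq_two.1 hT2
    have hx : x ∈ P := hTP (by simp [hTe])
    have hy : y ∈ P := hTP (by simp [hTe])
    have hPT : (P \ T).card = 2 := by rw [Finset.card_sdiff_of_subset hTP]; omega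
    have e1 : C.filter (fun c => P.filter (fun v => c ∈ L v) = T) = L x ∩ L y := by
      ext c
      rw [Finset.mem_filter, Finset.mem_inter]
      constructor
      · rintro ⟨hc, he⟩
        have a1 : x ∈ P.filter (fun v => c ∈ L v) := by rw [he, hTe]; simp
        have a2 : y ∈ P.filter (fun v => c ∈ L v) := by rw [he, hTe]; simp
        exact ⟨(Finset.mem_filter.1 a1).2, (Finset.mem_filter.1 a2).2⟩
      · rintro ⟨hcx, hcy⟩
        have hc := hsub x hx hcx
        refine ⟨hc, (Finset.eq_of_subset_of_card_le ?_ ?_).symm⟩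
        · rw [hTe]
          intro v hv
          simp only [Finset.mem_insert, Finset.mem_singleton] at hv
          rcases hv with rfl | rfl
          · exact Finset.mem_filter.2 ⟨hx, hcx⟩
          · exact Finset.mem_filter.2 ⟨hy, hcy⟩
        · rw [h2 c hc, hT2]
    have e2 : C.filter (fun c => P.filter (fun v => c ∈ L v) = P \ T) = C \ (L x ∪ L y) := by
      ext c
      rw [Finset.mem_filter, Finset.mem_sdiff, Finset.mem_union, not_or]
      constructor
      · rintro ⟨hc, he⟩
        refine ⟨hc, fun h => ?_, fun h => ?_⟩
        · have a1 : x ∈ P.filter (fun v => c ∈ L v) := Finset.mem_filter.2 ⟨hx, h⟩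
          rw [he, hTe] at a1
          simp at a1
        · have a1 : y ∈ P.filter (fun v => c ∈ L v) := Finset.mem_filter.2 ⟨hy, h⟩
          rw [he, hTe] at a1
          simp at a1
      · rintro ⟨hc, hcx, hcy⟩
        refine ⟨hc, Finset.eq_of_subset_of_card_le ?_ ?_⟩
        · intro v hv
          rw [Finset.mem_filter] at hv
          rw [Finset.mem_sdiff]
          refine ⟨hv.1, fun h => ?_⟩
          rw [hTe] at h
          simp only [Finset.mem_insert, Finset.mem_singleton] at h
          rcases h with rfl | rfl
          · exact hcx hv.2
          · exact hcy hv.2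
        · rw [h2 c hc, hPT]
    have hce : (L x ∩ L y).card = (C \ (L x ∪ L y)).card := by
      rw [Finset.card_sdiff_of_subset (Finset.union_subset (hsub x hx) (hsub y hy))]
      have := Finset.card_union_add_card_inter (L x) (L y)
      rw [hL x hx, hL y hy] at this
      omega
    obtain ⟨f, hf1, hf2⟩ := exists_inj _ _ hce
    refine ⟨f, fun _ => ?_⟩
    rw [e1, e2]
    exact ⟨hf1, hf2⟩
  choose f hf using hcard
  have ht : ∀ c ∈ C, P.filter (fun v => c ∈ L v) ∈ P.powersetCard 2 := fun c hc =>
    Finset.mem_powersetCard.2 ⟨Finset.filter_subset _ _, h2 c hc⟩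
  have hφ : ∀ c ∈ C, P.filter (fun v => f (P.filter (fun v => c ∈ L v)) c ∈ L v) =
      P \ P.filter (fun v => c ∈ L v) := by
    intro c hc
    have := (hf _ (ht c hc)).1 c (Finset.mem_filter.2 ⟨hc, rfl⟩)
    exact (Finset.mem_filter.1 this).2
  refine ⟨fun c => f (P.filter (fun v => c ∈ L v)) c, ?_, ?_⟩
  · intro c hc c' hc' heq
    dsimp only at heq
    have hc1 : c ∈ C := hc
    have hc1' : c' ∈ C := hc'
    have q1 := hφ c hc1
    have q2 := hφ c' hc1'
    rw [heq, q2] at q1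
    have q3 : P.filter (fun v => c' ∈ L v) = P.filter (fun v => c ∈ L v) := by
      rw [← Finset.sdiff_sdiff_eq_self (Finset.filter_subset (fun v => c' ∈ L v) P), q1,
        Finset.sdiff_sdiff_eq_self (Finset.filter_subset _ _)]
    rw [q3] at heq
    exact (hf _ (ht c hc1)).2 c (Finset.mem_filter.2 ⟨hc1, rfl⟩) c'
      (Finset.mem_filter.2 ⟨hc1', q3⟩) heq
  · intro c hc x hx hcx
    have : x ∈ P \ P.filter (fun v => c ∈ L v) := by
      simp [hx, hcx]
    rw [← hφ c hc] at this
    exact (Finset.mem_filter.1 this).2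

theorem hall_final {V ι : Type} [DecidableEq V] (π : V → ι) (n : ℕ)
    (Y : Finset V) (w1 w2 y : V) (hY : Y.card = 3) (hy : y ∈ Y) (pr : ι → Finset V) (J : Finset ι)
    (hJ : J.card = n) (hpr : ∀ j ∈ J, (pr j).card = 2) (L : V → Finset ℕ) (D : Finset ℕ)
    (hD : D.card ≤ 4) (d1 d2 : ℕ) (hd1 : d1 ∈ D) (hd2 : d2 ∈ D) (hw1 : d1 ∉ L w1)
    (hw2 : d2 ∉ L w2)
    (hL : ∀ v ∈ insert w1 (insert w2 Y) ∪ J.biUnion pr, (L v).card = n + 6)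
    (hnp : ∀ j ∈ J, ∀ c, ∃ v ∈ pr j, c ∉ L v)
    (hNF : NF (n + 6) (L y) (L w1) (L w2) D) :
    LC π (insert w1 (insert w2 Y) ∪ J.biUnion pr) (fun v => L v \ D) := by
  apply LC.of_hall
  intro X hX
  by_contra hlt
  push Not at hlt
  set F := insert w1 (insert w2 Y) with hF
  set R := X.biUnion (fun v => L v \ D) with hR
  have hRv : ∀ v ∈ X, L v \ D ⊆ R := fun v hv =>
    Finset.subset_biUnion_of_mem (fun v => L v \ D) hv
  have e1 := Finset.card_insert_le w1 (insert w2 Y)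
  have e2 := Finset.card_insert_le w2 Y
  have e3 := Finset.card_insert_le w1 Y
  have hFc : F.card ≤ 5 := by rw [hF]; omega
  by_cases hpair : ∃ j ∈ J, pr j ⊆ X
  · obtain ⟨j, hj, hjX⟩ := hpair
    obtain ⟨u, v, huv, he⟩ := Finset.card_eq_two.1 (hpr j hj)
    have hu : u ∈ X := hjX (by simp [he])
    have hv : v ∈ X := hjX (by simp [he])
    have hdis : Disjoint (L u) (L v) := by
      rw [Finset.disjoint_left]
      intro c hc hc'
      obtain ⟨x, hx, hcx⟩ := hnp j hj c
      simp only [he, Finset.mem_insert, Finset.mem_singleton] at hx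
      rcases hx with rfl | rfl
      · exact hcx hc
      · exact hcx hc'
    have h1 := Finset.card_union_of_disjoint hdis
    rw [hL u (hX hu), hL v (hX hv)] at h1
    have h2 := Finset.le_card_sdiff D (L u ∪ L v)
    have h3 : (L u ∪ L v) \ D ⊆ R := by
      rw [Finset.union_sdiff_distrib]
      exact Finset.union_subset (hRv u hu) (hRv v hv)
    have h4 := Finset.card_le_card h3
    have h5 := (Finset.card_le_card hX).trans (Finset.card_union_le _ _)
    have h6 := Finset.card_biUnion_le_card_mul J pr 2 (fun j hj => (hpr j hj).le)
    omega
  push Not at hpair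
  have hXn : X.card ≤ (X ∩ F).card + n := by
    have hs : X ⊆ (X ∩ F) ∪ J.biUnion (fun j => X ∩ pr j) := by
      intro v hv
      have := hX hv
      simp only [Finset.mem_union, Finset.mem_inter, Finset.mem_biUnion] at this ⊢
      rcases this with h | ⟨j, hj, h⟩
      · exact Or.inl ⟨hv, h⟩
      · exact Or.inr ⟨j, hj, hv, h⟩
    have h1 := (Finset.card_le_card hs).trans (Finset.card_union_le _ _)
    have h2 := Finset.card_biUnion_le_card_mul J (fun j => X ∩ pr j) 1 (by
      intro j hj
      have h3 : (X ∩ pr j) ⊂ pr j := by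
        refine Finset.ssubset_iff_subset_ne.2 ⟨Finset.inter_subset_right, fun he => ?_⟩
        exact hpair j hj (Finset.inter_eq_right.1 he)
      have := Finset.card_lt_card h3
      have := hpr j hj
      omega)
    omega
  have hXF : (X ∩ F).card ≤ 5 := (Finset.card_le_card Finset.inter_subset_right).trans hFc
  have hcap : ∀ v ∈ X, 7 ≤ (L v ∩ D).card + (X ∩ F).card := by
    intro v hv
    have h1 := Finset.card_le_card (hRv v hv)
    have h2 := Finset.card_sdiff_add_card_inter (L v) D
    have h3 := hL v (hX hv)
    omega
  have hRD : ∀ A : Finset ℕ, A ⊆ R ∪ D → A.card ≤ n + (X ∩ F).card + 3 := by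
    intro A hA
    have := (Finset.card_le_card hA).trans (Finset.card_union_le _ _)
    omega
  have hvD : ∀ v ∈ X, L v ⊆ R ∪ D := by
    intro v hv x hx
    by_cases hxD : x ∈ D
    · exact Finset.mem_union_right _ hxD
    · exact Finset.mem_union_left _ (hRv v hv (Finset.mem_sdiff.2 ⟨hx, hxD⟩))
  have hDR : D ⊆ R ∪ D := Finset.subset_union_right
  have hiD : ∀ v, (L v ∩ D).card ≤ 4 := fun v =>
    (Finset.card_le_card Finset.inter_subset_right).trans hD
  have hi3 : ∀ v d, d ∈ D → d ∉ L v → (L v ∩ D).card ≤ 3 := by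
    intro v d hd hdv
    have hs : L v ∩ D ⊆ D.erase d := by
      intro x hx
      rw [Finset.mem_inter] at hx
      exact Finset.mem_erase.2 ⟨fun h => hdv (h ▸ hx.1), hx.2⟩
    have := Finset.card_le_card hs
    rw [Finset.card_erase_of_mem hd] at this
    omega
  obtain ⟨v0, hv0⟩ := Finset.card_pos.1 (show 0 < X.card by omega)
  have hm3 : 3 ≤ (X ∩ F).card := by
    have := hcap v0 hv0
    have := hiD v0
    omega
  obtain ⟨f1, f2, f3, f4, f5⟩ := hNF
  have hsubF : ∀ G : Finset V, X ∩ F ⊆ G → G.card ≤ (X ∩ F).card → ∀ v ∈ G, v ∈ X := by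
    intro G hG hGc v hv
    rw [← Finset.eq_of_subset_of_card_le hG hGc] at hv
    exact (Finset.mem_inter.1 hv).1
  have hyF : y ∈ F := by simp [hF, hy]
  have hw1F : w1 ∈ F := by simp [hF]
  have hw2F : w2 ∈ F := by simp [hF]
  rcases (show (X ∩ F).card = 3 ∨ (X ∩ F).card = 4 ∨ (X ∩ F).card = 5 by omega) with hm | hm | hm
  · have n1 : w1 ∉ X := fun h => by
      have := hcap w1 h
      have := hi3 w1 d1 hd1 hw1
      omega
    have n2 : w2 ∉ X := fun h => by
      have := hcap w2 h
      have := hi3 w2 d2 hd2 hw2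
      omega
    have hyX : y ∈ X := hsubF Y (by
      intro v hv
      rw [Finset.mem_inter, hF, Finset.mem_insert, Finset.mem_insert] at hv
      rcases hv with ⟨hv, rfl | rfl | h⟩
      · exact absurd hv n1
      · exact absurd hv n2
      · exact h) (by omega) y hy
    apply f5
    have h1 := hcap y hyX
    have := Finset.eq_of_subset_of_card_le (Finset.inter_subset_right : L y ∩ D ⊆ D) (by omega)
    exact Finset.inter_eq_right.1 this
  · by_cases n1 : w1 ∈ X
    · have i1 := hcap w1 n1
      by_cases n2 : w2 ∈ X
      · have i2 := hcap w2 n2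
        exact f2 ⟨by omega, by omega⟩
      · have hyX : y ∈ X := hsubF (insert w1 Y) (by
          intro v hv
          rw [Finset.mem_inter, hF, Finset.mem_insert, Finset.mem_insert] at hv
          rw [Finset.mem_insert]
          rcases hv with ⟨hv, rfl | rfl | h⟩
          · exact Or.inl rfl
          · exact absurd hv n2
          · exact Or.inr h) (by omega) y (by simp [hy])
        refine f3 ⟨?_, by omega⟩
        have := hRD _ (Finset.union_subset (Finset.union_subset (hvD y hyX) (hvD w1 n1)) hDR)
        omega
    · have hs : X ∩ F ⊆ insert w2 Y := by
        intro v hv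
        rw [Finset.mem_inter, hF, Finset.mem_insert] at hv
        rcases hv with ⟨hv, rfl | h⟩
        · exact absurd hv n1
        · exact h
      have hyX := hsubF _ hs (by omega) y (by simp [hy])
      have n2 := hsubF _ hs (by omega) w2 (by simp)
      have i2 := hcap w2 n2
      refine f4 ⟨?_, by omega⟩
      have := hRD _ (Finset.union_subset (Finset.union_subset (hvD y hyX) (hvD w2 n2)) hDR)
      omega
  · have hall := hsubF F Finset.inter_subset_right (by omega)
    have i1 := hcap w1 (hall w1 hw1F)
    have i2 := hcap w2 (hall w2 hw2F)
    refine f1 ⟨?_, by omega, by omega⟩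
    have := hRD _ (Finset.union_subset (Finset.union_subset (Finset.union_subset
      (hvD y (hall y hyF)) (hvD w1 (hall w1 hw1F))) (hvD w2 (hall w2 hw2F))) hDR)
    omega

theorem thmG {V ι : Type} [DecidableEq V] [DecidableEq ι] (π : V → ι) (P Q1 Q2 Y : Finset V)
    (i0 i1 i2 : ι) (hP : P.card = 4) (hQ1 : Q1.card = 3) (hQ2 : Q2.card = 3)
    (hπ0 : ∀ v ∈ P, π v = i0) (hπ1 : ∀ v ∈ Q1, π v = i1) (hπ2 : ∀ v ∈ Q2, π v = i2)
    (h01 : i0 ≠ i1) (h02 : i0 ≠ i2) (h12 : i1 ≠ i2) (hY : Y.card = 3)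
    (pr : ι → Finset V) (n : ℕ) : ∀ (J : Finset ι), J.card = n →
    (∀ j ∈ J, (pr j).card = 2 ∧ ∀ v ∈ pr j, π v = j) → ∀ L : V → Finset ℕ,
    (∀ v ∈ P ∪ Q1 ∪ Q2 ∪ Y ∪ J.biUnion pr, n + 6 ≤ (L v).card) →
    LC π (P ∪ Q1 ∪ Q2 ∪ Y ∪ J.biUnion pr) L := by
  induction n using Nat.strong_induction_on with
  | _ n ih =>
  intro J hJ hpr L hL
  refine small_pot π _ (fun _ => n + 6) (2 * n + 12) ?_ ?_ ?_ L hL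
  · have h1 := Finset.card_union_le (P ∪ Q1 ∪ Q2) Y
    have h2 := Finset.card_union_le (P ∪ Q1) Q2
    have h3 := Finset.card_union_le P Q1
    have h4 := Finset.card_union_le (P ∪ Q1 ∪ Q2 ∪ Y) (J.biUnion pr)
    have h5 := Finset.card_biUnion_le_card_mul J pr 2 (fun j hj => (hpr j hj).1.le)
    omega
  · intro v _; omega
  clear hL L
  intro L hL hC
  set S := P ∪ Q1 ∪ Q2 ∪ Y ∪ J.biUnion pr with hS
  set C := S.biUnion L with hCdef
  have hsub : ∀ v ∈ S, L v ⊆ C := fun v hv => Finset.subset_biUnion_of_mem L hv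
  have hPS : ∀ v ∈ P, v ∈ S := fun v hv => by simp [hS, hv]
  have hQ1S : ∀ v ∈ Q1, v ∈ S := fun v hv => by simp [hS, hv]
  have hQ2S : ∀ v ∈ Q2, v ∈ S := fun v hv => by simp [hS, hv]
  have hYS : ∀ v ∈ Y, v ∈ S := fun v hv => by simp [hS, hv]
  have hJS : ∀ v ∈ J.biUnion pr, v ∈ S := fun v hv => Finset.mem_union_right _ hv
  by_cases hpc : ∃ j ∈ J, ∃ c, ∀ v ∈ pr j, c ∈ L v
  · obtain ⟨j, hj, c, hc⟩ := hpc
    have hn : 0 < n := by rw [← hJ]; exact Finset.card_pos.2 ⟨j, hj⟩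
    refine LC.step' (pr j) j c (fun v hv => ⟨(hpr j hj).2 v hv, hc v hv⟩) ?_
    refine (ih (n - 1) (by omega) (J.erase j) (by rw [Finset.card_erase_of_mem hj]; omega)
      (fun i hi => hpr i (Finset.mem_of_mem_erase hi)) (fun v => L v \ {c}) ?_).mono ?_
      (fun _ _ => Finset.Subset.refl _)
    · intro v hv
      apply card_sdiff_one
      rw [hL v (Finset.union_subset_union (Finset.Subset.refl _)
        (Finset.biUnion_subset_biUnion_of_subset_left pr (Finset.erase_subset _ _)) hv)]
      omega
    · intro v hv
      rw [Finset.mem_sdiff, Finset.mem_union] at hv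
      rw [Finset.mem_union]
      obtain ⟨h | h, h'⟩ := hv
      · exact Or.inl h
      · right
        obtain ⟨i, hi, hvi⟩ := Finset.mem_biUnion.1 h
        refine Finset.mem_biUnion.2 ⟨i, Finset.mem_erase.2 ⟨?_, hi⟩, hvi⟩
        rintro rfl
        exact h' hvi
  push Not at hpc
  by_cases h3 : ∃ c, 3 ≤ (P.filter (fun v => c ∈ L v)).card
  · obtain ⟨c, hc⟩ := h3
    obtain ⟨w, hw, hwo⟩ := three_of_four P hP L c hc
    have hwQ1 : w ∉ Q1 := fun h => h01 ((hπ0 w hw).symm.trans (hπ1 w h))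
    have hwQ2 : w ∉ Q2 := fun h => h02 ((hπ0 w hw).symm.trans (hπ2 w h))
    refine LC.step (P.erase w) i0 c (fun v hv => ?_) ?_
    · rw [Finset.mem_erase] at hv
      exact ⟨hπ0 v hv.2, hwo v hv.2 hv.1⟩
    refine (thmA π Q1 Q2 Y w i1 i2 hQ1 hQ2 hπ1 hπ2 h12 hY.le hwQ1 hwQ2 pr n J hJ hpr
      (fun v => if π v = i0 then L v else L v \ {c}) ?_ ?_).mono ?_
      (fun _ _ => Finset.Subset.refl _)
    · intro v hv
      have hvS : v ∈ S := by
        simp only [hS, Finset.mem_union, Finset.mem_singleton] at hv ⊢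
        rcases hv with (((h | h) | h) | h) | h
        · simp [h]
        · simp [h]
        · simp [h]
        · simp [h, hw]
        · exact Or.inr h
      have := hL v hvS
      split_ifs
      · omega
      · exact card_sdiff_one _ _ _ this.ge
    · simp only [hπ0 w hw, if_true]
      exact (hL w (hPS w hw)).ge
    · intro v hv
      simp only [hS, Finset.mem_sdiff, Finset.mem_union, Finset.mem_singleton,
        Finset.mem_erase] at hv ⊢
      clear * - hv
      grind
  push Not at h3
  have hsum := sum_cnt P L C (fun v hv => hsub v (hPS v hv))
  have hs1 : ∑ v ∈ P, (L v).card = 4 * (n + 6) := by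
    rw [Finset.sum_congr rfl (fun v hv => hL v (hPS v hv))]
    simp [hP]
  have hs2 : ∑ c ∈ C, (P.filter (fun v => c ∈ L v)).card ≤ C.card * 2 := by
    have := Finset.sum_le_card_nsmul C
      (fun c => (P.filter (fun v => c ∈ L v)).card) 2 (fun c _ => by have := h3 c; omega)
    rwa [smul_eq_mul] at this
  have hCc : C.card = 2 * (n + 6) := by omega
  have h2 : ∀ c ∈ C, (P.filter (fun v => c ∈ L v)).card = 2 := by
    have := (Finset.sum_eq_sum_iff_of_le (s := C)
      (f := fun c => (P.filter (fun v => c ∈ L v)).card) (g := fun _ => 2)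
      (fun c _ => by have := h3 c; omega)).1 (by
        rw [Finset.sum_const, smul_eq_mul, ← hsum]; omega)
    exact this
  by_cases hcom1 : ∃ c, ∀ v ∈ Q1, c ∈ L v
  · obtain ⟨c, hc⟩ := hcom1
    refine LC.step' Q1 i1 c (fun v hv => ⟨hπ1 v hv, hc v hv⟩) ?_
    refine (thmB π P Q2 Y i0 i2 hP hQ2 hπ0 hπ2 h02 hY.le pr n J hJ hpr (fun v => L v \ {c})
      ?_).mono ?_ (fun _ _ => Finset.Subset.refl _)
    · intro v hv
      apply card_sdiff_one
      refine (hL v ?_).ge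
      simp only [hS, Finset.mem_union] at hv ⊢
      tauto
    · intro v hv
      simp only [hS, Finset.mem_sdiff, Finset.mem_union] at hv ⊢
      tauto
  by_cases hcom2 : ∃ c, ∀ v ∈ Q2, c ∈ L v
  · obtain ⟨c, hc⟩ := hcom2
    refine LC.step' Q2 i2 c (fun v hv => ⟨hπ2 v hv, hc v hv⟩) ?_
    refine (thmB π P Q1 Y i0 i1 hP hQ1 hπ0 hπ1 h01 hY.le pr n J hJ hpr (fun v => L v \ {c})
      ?_).mono ?_ (fun _ _ => Finset.Subset.refl _)
    · intro v hv
      apply card_sdiff_one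
      refine (hL v ?_).ge
      simp only [hS, Finset.mem_union] at hv ⊢
      tauto
    · intro v hv
      simp only [hS, Finset.mem_sdiff, Finset.mem_union] at hv ⊢
      tauto
  push Not at hcom1 hcom2
  obtain ⟨φ, hφi, hφ⟩ := exists_phi P hP L C (n + 6) (fun v hv => hsub v (hPS v hv)) hCc
    (fun v hv => hL v (hPS v hv)) h2
  obtain ⟨y, hy⟩ := Finset.card_pos.1 (show 0 < Y.card by omega)
  obtain ⟨d1, w1, d2, w2, -, -, hd, p1, p2, c, hcC, c1, c2, c3, c4, hNF⟩ :=
    choice_main (n + 6) (by omega) C (L y) φ hφi hCc (hL y (hYS y hy)) L Q1 Q2 hQ1 hQ2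
      (fun v hv => ⟨hL v (hQ1S v hv), hsub v (hQ1S v hv)⟩)
      (fun v hv => ⟨hL v (hQ2S v hv), hsub v (hQ2S v hv)⟩) hcom1 hcom2
  obtain ⟨hw1, hdw1, ho1⟩ := p1
  obtain ⟨hw2, hdw2, ho2⟩ := p2
  have hfin := hall_final π n Y w1 w2 y hY hy pr J hJ (fun j hj => (hpr j hj).1) L
    {c, φ c, d1, d2} Finset.card_le_four d1 d2 (by simp) (by simp) hdw1 hdw2 (by
      intro v hv
      apply hL v
      simp only [Finset.mem_union, Finset.mem_insert] at hv
      rcases hv with (rfl | rfl | h) | h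
      · exact hQ1S _ hw1
      · exact hQ2S _ hw2
      · exact hYS _ h
      · exact hJS _ h) hpc hNF
  refine LC.step' (P.filter (fun v => c ∈ L v)) i0 c (fun v hv => ?_) ?_
  · rw [Finset.mem_filter] at hv
    exact ⟨hπ0 v hv.1, hv.2⟩
  refine LC.step' (P.filter (fun v => c ∉ L v)) i0 (φ c) (fun v hv => ?_) ?_
  · rw [Finset.mem_filter] at hv
    have h := hφ c hcC v hv.1 hv.2
    refine ⟨hπ0 v hv.1, Finset.mem_sdiff.2 ⟨h, ?_⟩⟩
    rw [Finset.mem_singleton]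
    intro he
    exact hv.2 (he ▸ h)
  refine LC.step' (Q1.erase w1) i1 d1 (fun v hv => ?_) ?_
  · rw [Finset.mem_erase] at hv
    refine ⟨hπ1 v hv.2, ?_⟩
    simp only [Finset.mem_sdiff, Finset.mem_singleton]
    exact ⟨⟨ho1 v hv.2 hv.1, c1.symm⟩, c3.symm⟩
  refine LC.step' (Q2.erase w2) i2 d2 (fun v hv => ?_) ?_
  · rw [Finset.mem_erase] at hv
    refine ⟨hπ2 v hv.2, ?_⟩
    simp only [Finset.mem_sdiff, Finset.mem_singleton]
    exact ⟨⟨⟨ho2 v hv.2 hv.1, c2.symm⟩, c4.symm⟩, hd.symm⟩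
  refine hfin.mono ?_ ?_
  · intro v hv
    simp only [hS, Finset.mem_sdiff, Finset.mem_union, Finset.mem_filter, Finset.mem_insert,
      Finset.mem_erase] at hv ⊢
    clear * - hv
    grind
  · intro v _ x hx
    simp only [Finset.mem_sdiff, Finset.mem_singleton, Finset.mem_insert] at hx ⊢
    clear * - hx
    grind

end Ohba

/-- Ohba's conjecture holds for `K_{4,3*2,2*(k-6),1*3}`: its choice number is exactly `k`. -/
theorem choiceNumber_K4_3x2_2xk6_1x3 (k : ℕ) (hk : 6 ≤ k) :
    IsLeast {n | Choosable (SimpleGraph.completeMultipartiteGraph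
      (fun i : Fin k => Fin (if i.val = 0 then 4 else if i.val ≤ 2 then 3
        else if i.val < k - 3 then 2 else 1))) n} k := by
  set s : Fin k → ℕ := fun i => if i.val = 0 then 4 else if i.val ≤ 2 then 3
        else if i.val < k - 3 then 2 else 1 with hs
  have hpos : ∀ i, 0 < s i := by
    intro i
    simp only [hs]
    split_ifs <;> omega
  constructor
  · intro L hL
    let part : Fin k → Finset (Σ i : Fin k, Fin (s i)) := fun i =>
      Finset.univ.map (Function.Embedding.sigmaMk i)
    have hcard : ∀ i, (part i).card = s i := by
      intro i; simp [part]
    have hmem : ∀ i (v : Σ i : Fin k, Fin (s i)), v ∈ part i ↔ v.1 = i := by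
      intro i v
      obtain ⟨a, b⟩ := v
      simp only [part, Finset.mem_map, Finset.mem_univ, true_and,
        Function.Embedding.sigmaMk_apply]
      constructor
      · rintro ⟨b', h⟩
        exact (congrArg Sigma.fst h).symm
      · rintro rfl
        exact ⟨b, rfl⟩
    let j0 : Fin k := ⟨0, by omega⟩
    let j1 : Fin k := ⟨1, by omega⟩
    let j2 : Fin k := ⟨2, by omega⟩
    let a : Fin k := ⟨k - 3, by omega⟩
    let b : Fin k := ⟨k - 2, by omega⟩
    let c : Fin k := ⟨k - 1, by omega⟩
    let J : Finset (Fin k) := Finset.univ.filter (fun i => 3 ≤ i.val ∧ i.val < k - 3)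
    have hJ : J.card = k - 6 := by
      have h1 : J.map Fin.valEmbedding = Finset.Ico 3 (k - 3) := by
        ext x
        simp only [J, Finset.mem_map, Finset.mem_filter, Finset.mem_univ, true_and,
          Fin.valEmbedding_apply, Finset.mem_Ico]
        constructor
        · rintro ⟨i, hi, rfl⟩; exact hi
        · intro hx
          exact ⟨⟨x, by omega⟩, hx, rfl⟩
      rw [← Finset.card_map Fin.valEmbedding, h1, Nat.card_Ico]
      omega
    have hY : (part a ∪ part b ∪ part c).card = 3 := by
      have hd : ∀ i j, i ≠ j → Disjoint (part i) (part j) := by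
        intro i j hij
        rw [Finset.disjoint_left]
        intro v h1 h2
        exact hij (((hmem i v).1 h1).symm.trans ((hmem j v).1 h2))
      have ab : a ≠ b := by simp only [a, b, ne_eq, Fin.mk.injEq]; omega
      have ac : a ≠ c := by simp only [a, c, ne_eq, Fin.mk.injEq]; omega
      have bc : b ≠ c := by simp only [b, c, ne_eq, Fin.mk.injEq]; omega
      rw [Finset.card_union_of_disjoint (Finset.disjoint_union_left.2 ⟨hd _ _ ac, hd _ _ bc⟩),
        Finset.card_union_of_disjoint (hd _ _ ab), hcard, hcard, hcard]
      have sa : s a = 1 := by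
        simp only [hs, a]
        rw [if_neg (by omega), if_neg (by omega), if_neg (by omega)]
      have sb : s b = 1 := by
        simp only [hs, b]
        rw [if_neg (by omega), if_neg (by omega), if_neg (by omega)]
      have sc : s c = 1 := by
        simp only [hs, c]
        rw [if_neg (by omega), if_neg (by omega), if_neg (by omega)]
      omega
    obtain ⟨f, hf, hp⟩ := Ohba.thmG (Sigma.fst : (Σ i : Fin k, Fin (s i)) → Fin k)
      (part j0) (part j1) (part j2) (part a ∪ part b ∪ part c) j0 j1 j2
      (by rw [hcard]; simp [hs, j0]) (by rw [hcard]; simp [hs, j1]) (by rw [hcard]; simp [hs, j2])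
      (fun v hv => (hmem _ v).1 hv) (fun v hv => (hmem _ v).1 hv) (fun v hv => (hmem _ v).1 hv)
      (by simp [j0, j1]) (by simp [j0, j2]) (by simp [j1, j2]) hY part (k - 6) J hJ
      (by
        intro j hj
        refine ⟨?_, fun v hv => (hmem j v).1 hv⟩
        simp only [J, Finset.mem_filter, Finset.mem_univ, true_and] at hj
        rw [hcard]
        simp only [hs]
        rw [if_neg (by omega), if_neg (by omega), if_pos (by omega)])
      L (by
        intro v _
        have := hL v
        omega)
    have hall : ∀ v : Σ i : Fin k, Fin (s i),
        v ∈ part j0 ∪ part j1 ∪ part j2 ∪ (part a ∪ part b ∪ part c) ∪ J.biUnion part := by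
      intro v
      simp only [Finset.mem_union, hmem, Finset.mem_biUnion, J, Finset.mem_filter,
        Finset.mem_univ, true_and, j0, j1, j2, a, b, c, Fin.ext_iff]
      have := v.1.isLt
      by_cases h : 3 ≤ v.1.val ∧ v.1.val < k - 3
      · exact Or.inr ⟨v.1, h, rfl⟩
      · left; omega
    refine ⟨f, fun v => hf v (hall v), fun u w huw => hp u (hall u) w (hall w) ?_⟩
    simpa using huw
  · intro n hn
    obtain ⟨c, hc, hp⟩ := hn (fun _ => Finset.range n) (fun _ => by simp)
    have hlt : ∀ v, c v < n := fun v => Finset.mem_range.1 (hc v)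
    have hinj : Function.Injective (fun i : Fin k => (⟨c ⟨i, ⟨0, hpos i⟩⟩, hlt _⟩ : Fin n)) := by
      intro i j hij
      by_contra hne
      simp only [Fin.mk.injEq] at hij
      refine hp ?_ hij
      simpa using hne
    simpa using Fintype.card_le_of_injective _ hinj
end

section
/- For every integer k ≥ 5, the complete k-partite graph K_{3*3,2*(k-5),1*2} (three parts of size 3, k−5 parts of size 2, and two parts of size 1) has choice number exactly k. -/
namespace OhbaAux
open Finset

/-- Hall's theorem on a finset. -/
lemma hallF {V : Type*} [DecidableEq V] (U : Finset V) (t : V → Finset ℕ)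
    (h : ∀ S ⊆ U, #S ≤ #(S.biUnion t)) :
    ∃ f : V → ℕ, (∀ v ∈ U, f v ∈ t v) ∧ ∀ u ∈ U, ∀ w ∈ U, f u = f w → u = w := by
  have key := (Finset.all_card_le_biUnion_card_iff_exists_injective
    (fun v : {v // v ∈ U} => t v.1)).1 (by
      intro s
      have h1 := h (s.map (Function.Embedding.subtype _)) (by
        intro v hv
        simp only [Finset.mem_map, Function.Embedding.coe_subtype] at hv
        obtain ⟨a, _, rfl⟩ := hv
        exact a.2)
      rw [Finset.card_map] at h1
      refine h1.trans (Finset.card_le_card ?_)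
      intro c hc
      simp only [Finset.mem_biUnion, Finset.mem_map, Function.Embedding.coe_subtype] at hc ⊢
      obtain ⟨_, ⟨a, ha, rfl⟩, hc⟩ := hc
      exact ⟨a, ha, hc⟩)
  obtain ⟨f, hf, hft⟩ := key
  refine ⟨fun v => if hv : v ∈ U then f ⟨v, hv⟩ else 0, ?_, ?_⟩
  · intro v hv
    simp only [hv, dif_pos]
    exact hft ⟨v, hv⟩
  · intro u hu w hw huw
    simp only [hu, hw, dif_pos] at huw
    exact congrArg Subtype.val (hf huw)

/-- Colorability of the vertices in `U` from `L`, where vertices in different parts are adjacent. -/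
def Col {V ι : Type*} (π : V → ι) (U : Finset V) (L : V → Finset ℕ) : Prop :=
  ∃ c : V → ℕ, (∀ v ∈ U, c v ∈ L v) ∧ ∀ u ∈ U, ∀ w ∈ U, π u ≠ π w → c u ≠ c w

/-- The small pot lemma. -/
lemma smallPot {V ι : Type*} [DecidableEq V] (π : V → ι) (U : Finset V) (m : ℕ)
    (H : ∀ L : V → Finset ℕ, (∀ v ∈ U, #(L v) = m) → #(U.biUnion L) < #U → Col π U L)
    (L : V → Finset ℕ) (hL : ∀ v ∈ U, m ≤ #(L v)) : Col π U L := by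
  classical
  -- trim
  have htrim : ∀ v, ∃ A, A ⊆ L v ∧ (v ∈ U → #A = m) := by
    intro v
    by_cases hv : v ∈ U
    · obtain ⟨A, hA, hc⟩ := Finset.exists_subset_card_eq (hL v hv)
      exact ⟨A, hA, fun _ => hc⟩
    · exact ⟨L v, Subset.rfl, fun h => absurd h hv⟩
  choose M hML hM using htrim
  suffices hs : Col π U M by
    obtain ⟨c, h1, h2⟩ := hs
    exact ⟨c, fun v hv => hML v (h1 v hv), h2⟩
  by_cases hh : ∀ S ⊆ U, #S ≤ #(S.biUnion M)
  · obtain ⟨f, h1, h2⟩ := hallF U M hh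
    exact ⟨f, h1, fun u hu w hw hne he => hne (by rw [h2 u hu w hw he])⟩
  · push Not at hh
    obtain ⟨S0, hS0, hS0'⟩ := hh
    obtain ⟨S, hS, hmax⟩ := Finset.exists_max_image
      (U.powerset.filter (fun S => #(S.biUnion M) < #S)) Finset.card
      ⟨S0, by simp [hS0, hS0']⟩
    simp only [Finset.mem_filter, Finset.mem_powerset] at hS hmax
    obtain ⟨hSU, hSd⟩ := hS
    set N := S.biUnion M with hN
    have hne : S.Nonempty := by
      rw [← Finset.card_pos]; omega
    obtain ⟨s0, hs0⟩ := hne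
    obtain ⟨f, hf1, hf2⟩ := hallF (U \ S) (fun v => M v \ N) (by
      intro T hT
      by_contra hlt
      push Not at hlt
      have hdisj : Disjoint S T := by
        rw [Finset.disjoint_left]
        intro v hv hv'
        exact (Finset.mem_sdiff.1 (hT hv')).2 hv
      have hTpos : 0 < #T := by omega
      have h3 := hmax (S ∪ T) ⟨Finset.union_subset hSU (hT.trans Finset.sdiff_subset), by
        have : (S ∪ T).biUnion M ⊆ N ∪ T.biUnion (fun v => M v \ N) := by
          intro c hc
          simp only [Finset.mem_biUnion, Finset.mem_union, Finset.mem_sdiff] at hc ⊢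
          obtain ⟨v, hv | hv, hc⟩ := hc
          · exact Or.inl (Finset.mem_biUnion.2 ⟨v, hv, hc⟩)
          · by_cases hcN : c ∈ N
            · exact Or.inl hcN
            · exact Or.inr ⟨v, hv, hc, hcN⟩
        have h4 := (Finset.card_le_card this).trans (Finset.card_union_le _ _)
        rw [Finset.card_union_of_disjoint hdisj]
        omega⟩
      rw [Finset.card_union_of_disjoint hdisj] at h3
      omega)
    obtain ⟨g, hg1, hg2⟩ := H (fun v => if v ∈ S then M v else M s0) (by
        intro v hv
        by_cases hvS : v ∈ S
        · simp [hvS, hM v hv]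
        · simp [hvS, hM s0 (hSU hs0)]) (by
        have : (U.biUnion fun v => if v ∈ S then M v else M s0) ⊆ N := by
          intro c hc
          simp only [Finset.mem_biUnion] at hc
          obtain ⟨v, hv, hc⟩ := hc
          by_cases hvS : v ∈ S
          · simp only [hvS, if_true] at hc
            exact Finset.mem_biUnion.2 ⟨v, hvS, hc⟩
          · simp only [hvS, if_false] at hc
            exact Finset.mem_biUnion.2 ⟨s0, hs0, hc⟩
        have h1 := Finset.card_le_card this
        have h2 := Finset.card_le_card hSU
        omega)
    have hgS : ∀ v ∈ S, g v ∈ M v := by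
      intro v hv
      have := hg1 v (hSU hv)
      simpa [hv] using this
    have hgN : ∀ v ∈ S, g v ∈ N := fun v hv => Finset.mem_biUnion.2 ⟨v, hv, hgS v hv⟩
    have hfM : ∀ v ∈ U, v ∉ S → f v ∈ M v ∧ f v ∉ N := by
      intro v hv hvS
      exact Finset.mem_sdiff.1 (hf1 v (Finset.mem_sdiff.2 ⟨hv, hvS⟩))
    refine ⟨fun v => if v ∈ S then g v else f v, ?_, ?_⟩
    · intro v hv
      by_cases hvS : v ∈ S
      · simp [hvS, hgS v hvS]
      · simp [hvS, (hfM v hv hvS).1]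
    · intro u hu w hw hne
      by_cases huS : u ∈ S <;> by_cases hwS : w ∈ S <;> simp only [huS, hwS, if_true, if_false]
      · exact hg2 u hu w hw hne
      · intro he
        exact (hfM w hw hwS).2 (he ▸ hgN u huS)
      · intro he
        exact (hfM u hu huS).2 (he ▸ hgN w hwS)
      · intro he
        exact hne (by rw [hf2 u (by simp [hu, huS]) w (by simp [hw, hwS]) he])

lemma card_pair_union (A B D : Finset ℕ) (h0 : A ∩ B ∩ D = ∅) :
    #(A ∩ B ∪ D) = #(A ∩ B) + #D :=
  Finset.card_union_of_disjoint (Finset.disjoint_iff_inter_eq_empty.2 h0)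

lemma pair_sum (A B D : Finset ℕ) (m : ℕ) (hA : #A = m) (hB : #B = m) (hD : #D = m)
    (hu : #(A ∪ B ∪ D) + 5 ≤ 3 * m) :
    5 ≤ #(A ∩ B) + #(A ∩ D) + #(B ∩ D) := by
  have h1 := Finset.card_union_add_card_inter A B
  have h2 := Finset.card_union_add_card_inter (A ∪ B) D
  have h3 : #((A ∪ B) ∩ D) ≤ #(A ∩ D) + #(B ∩ D) := by
    rw [Finset.union_inter_distrib_right]
    exact Finset.card_union_le _ _
  omega

/-- There is a mergeable pair whose class lists are not all inside `W`. -/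
lemma triple_N (A B D W : Finset ℕ) (m : ℕ) (hm : 5 ≤ m)
    (hA : #A = m) (hB : #B = m) (hD : #D = m)
    (h0 : A ∩ B ∩ D = ∅) (hu : #(A ∪ B ∪ D) + 5 ≤ 3 * m) (hW : #W ≤ m + 2) :
    (2 ≤ #(A ∩ B) ∧ ¬ (A ∩ B ∪ D ⊆ W)) ∨ (2 ≤ #(A ∩ D) ∧ ¬ (A ∩ D ∪ B ⊆ W)) ∨
      (2 ≤ #(B ∩ D) ∧ ¬ (B ∩ D ∪ A ⊆ W)) := by
  have hs := pair_sum A B D m hA hB hD hu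
  have h02 : A ∩ D ∩ B = ∅ := by rw [← h0]; ext; simp <;> tauto
  have h03 : B ∩ D ∩ A = ∅ := by rw [← h0]; ext; simp <;> tauto
  have c1 := card_pair_union A B D h0
  have c2 := card_pair_union A D B h02
  have c3 := card_pair_union B D A h03
  have u1 := Finset.card_union_add_card_inter A B
  have u2 := Finset.card_union_add_card_inter A D
  have u3 := Finset.card_union_add_card_inter B D
  by_contra hcon
  push Not at hcon
  obtain ⟨n1, n2, n3⟩ := hcon
  have le1 : #(A ∩ B) ≤ 2 := by
    by_contra h
    have := Finset.card_le_card (n1 (by omega)); omega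
  have le2 : #(A ∩ D) ≤ 2 := by
    by_contra h
    have := Finset.card_le_card (n2 (by omega)); omega
  have le3 : #(B ∩ D) ≤ 2 := by
    by_contra h
    have := Finset.card_le_card (n3 (by omega)); omega
  by_cases e1 : 2 ≤ #(A ∩ B)
  · have s1 : D ⊆ W := Finset.subset_union_right.trans (n1 e1)
    by_cases e2 : 2 ≤ #(A ∩ D)
    · have s2 : B ⊆ W := Finset.subset_union_right.trans (n2 e2)
      have := Finset.card_le_card (Finset.union_subset s2 s1)
      omega
    · have s2 : A ⊆ W := Finset.subset_union_right.trans (n3 (by omega))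
      have := Finset.card_le_card (Finset.union_subset s2 s1)
      omega
  · have s2 : B ⊆ W := Finset.subset_union_right.trans (n2 (by omega))
    have s1 : A ⊆ W := Finset.subset_union_right.trans (n3 (by omega))
    have := Finset.card_le_card (Finset.union_subset s1 s2)
    omega

/-- There is a mergeable pair whose common list is not inside `W`. -/
lemma triple_P (A B D W : Finset ℕ) (m : ℕ)
    (hA : #A = m) (hB : #B = m) (hD : #D = m)
    (h0 : A ∩ B ∩ D = ∅) (hu : #(A ∪ B ∪ D) + 5 ≤ 3 * m) (hW : #W ≤ 2) :
    (2 ≤ #(A ∩ B) ∧ ¬ (A ∩ B ⊆ W)) ∨ (2 ≤ #(A ∩ D) ∧ ¬ (A ∩ D ⊆ W)) ∨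
      (2 ≤ #(B ∩ D) ∧ ¬ (B ∩ D ⊆ W)) := by
  have hs := pair_sum A B D m hA hB hD hu
  have d1 : Disjoint (A ∩ B) (A ∩ D) := by
    rw [Finset.disjoint_iff_inter_eq_empty, ← h0]; ext; simp <;> tauto
  have d2 : Disjoint (A ∩ B) (B ∩ D) := by
    rw [Finset.disjoint_iff_inter_eq_empty, ← h0]; ext; simp <;> tauto
  have d3 : Disjoint (A ∩ D) (B ∩ D) := by
    rw [Finset.disjoint_iff_inter_eq_empty, ← h0]; ext; simp <;> tauto
  have u1 := Finset.card_union_of_disjoint d1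
  have u2 := Finset.card_union_of_disjoint d2
  have u3 := Finset.card_union_of_disjoint d3
  by_contra hcon
  push Not at hcon
  obtain ⟨n1, n2, n3⟩ := hcon
  have le1 : #(A ∩ B) ≤ 2 := by
    by_contra h
    have := Finset.card_le_card (n1 (by omega)); omega
  have le2 : #(A ∩ D) ≤ 2 := by
    by_contra h
    have := Finset.card_le_card (n2 (by omega)); omega
  have le3 : #(B ∩ D) ≤ 2 := by
    by_contra h
    have := Finset.card_le_card (n3 (by omega)); omega
  by_cases e1 : 2 ≤ #(A ∩ B)
  · by_cases e2 : 2 ≤ #(A ∩ D)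
    · have := Finset.card_le_card (Finset.union_subset (n1 e1) (n2 e2))
      omega
    · have := Finset.card_le_card (Finset.union_subset (n1 e1) (n3 (by omega)))
      omega
  · have := Finset.card_le_card (Finset.union_subset (n2 (by omega)) (n3 (by omega)))
    omega

/-- `t = (x, y, z)` enumerates `F`, and `x, y` have at least two common colors. -/
def Good {V : Type*} [DecidableEq V] (L : V → Finset ℕ) (F : Finset V) (t : V × V × V) : Prop :=
  F = {t.1, t.2.1, t.2.2} ∧ t.1 ≠ t.2.1 ∧ t.1 ≠ t.2.2 ∧ t.2.1 ≠ t.2.2 ∧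
    2 ≤ #(L t.1 ∩ L t.2.1)

section triples
variable {V : Type*} [DecidableEq V] (L : V → Finset ℕ) (F : Finset V) (m : ℕ)

lemma good_N (hF : #F = 3) (hL : ∀ v ∈ F, #(L v) = m)
    (h0 : ∀ γ, ∃ v ∈ F, γ ∉ L v) (hu : #(F.biUnion L) + 5 ≤ 3 * m) (hm : 5 ≤ m)
    (W : Finset ℕ) (hW : #W ≤ m + 2) :
    ∃ t, Good L F t ∧ ¬ (L t.1 ∩ L t.2.1 ∪ L t.2.2 ⊆ W) := by
  obtain ⟨x, y, z, hxy, hxz, hyz, rfl⟩ := Finset.card_eq_three.1 hF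
  have hu' : #(L x ∪ L y ∪ L z) + 5 ≤ 3 * m := by
    convert hu using 3
    ext; simp
  have h0' : L x ∩ L y ∩ L z = ∅ := by
    ext γ
    obtain ⟨v, hv, hγ⟩ := h0 γ
    simp only [Finset.mem_insert, Finset.mem_singleton] at hv
    rcases hv with rfl | rfl | rfl <;> simp [hγ]
  rcases triple_N (L x) (L y) (L z) W m hm (hL x (by simp)) (hL y (by simp)) (hL z (by simp))
    h0' hu' hW with h | h | h
  · exact ⟨(x, y, z), ⟨rfl, hxy, hxz, hyz, h.1⟩, h.2⟩
  · exact ⟨(x, z, y), ⟨by ext; simp; tauto, hxz, hxy, hyz.symm, h.1⟩, h.2⟩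
  · exact ⟨(y, z, x), ⟨by ext; simp; tauto, hyz, hxy.symm, hxz.symm, h.1⟩, h.2⟩

lemma good_P (hF : #F = 3) (hL : ∀ v ∈ F, #(L v) = m)
    (h0 : ∀ γ, ∃ v ∈ F, γ ∉ L v) (hu : #(F.biUnion L) + 5 ≤ 3 * m)
    (W : Finset ℕ) (hW : #W ≤ 2) :
    ∃ t, Good L F t ∧ ¬ (L t.1 ∩ L t.2.1 ⊆ W) := by
  obtain ⟨x, y, z, hxy, hxz, hyz, rfl⟩ := Finset.card_eq_three.1 hF
  have hu' : #(L x ∪ L y ∪ L z) + 5 ≤ 3 * m := by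
    convert hu using 3
    ext; simp
  have h0' : L x ∩ L y ∩ L z = ∅ := by
    ext γ
    obtain ⟨v, hv, hγ⟩ := h0 γ
    simp only [Finset.mem_insert, Finset.mem_singleton] at hv
    rcases hv with rfl | rfl | rfl <;> simp [hγ]
  rcases triple_P (L x) (L y) (L z) W m (hL x (by simp)) (hL y (by simp)) (hL z (by simp))
    h0' hu' hW with h | h | h
  · exact ⟨(x, y, z), ⟨rfl, hxy, hxz, hyz, h.1⟩, h.2⟩
  · exact ⟨(x, z, y), ⟨by ext; simp; tauto, hxz, hxy, hyz.symm, h.1⟩, h.2⟩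
  · exact ⟨(y, z, x), ⟨by ext; simp; tauto, hyz, hxy.symm, hxz.symm, h.1⟩, h.2⟩

end triples

/-- A simultaneous choice of merged pairs. -/
lemma exists_choice {V ι : Type*} [Nonempty V] [DecidableEq V] [DecidableEq ι] (L : V → Finset ℕ)
    (F : ι → Finset V) (T : Finset ι) (m : ℕ) (hT : #T ≤ 3) (hm : #T = 3 → 5 ≤ m)
    (hF : ∀ i ∈ T, #(F i) = 3) (hL : ∀ i ∈ T, ∀ v ∈ F i, #(L v) = m)
    (h0 : ∀ i ∈ T, ∀ γ, ∃ v ∈ F i, γ ∉ L v)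
    (hu : ∀ i ∈ T, #((F i).biUnion L) + 5 ≤ 3 * m) :
    ∃ x y z : ι → V, (∀ i ∈ T, Good L (F i) (x i, y i, z i)) ∧
      (#T = 3 → m + 3 ≤ #(T.biUnion fun i => L (x i) ∩ L (y i) ∪ L (z i)) ∧
        3 ≤ #(T.biUnion fun i => L (x i) ∩ L (y i))) := by
  suffices hs : ∃ t : ι → V × V × V, (∀ i ∈ T, Good L (F i) (t i)) ∧
      (#T = 3 → m + 3 ≤ #(T.biUnion fun i => L (t i).1 ∩ L (t i).2.1 ∪ L (t i).2.2) ∧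
        3 ≤ #(T.biUnion fun i => L (t i).1 ∩ L (t i).2.1)) by
    obtain ⟨t, h1, h2⟩ := hs
    exact ⟨fun i => (t i).1, fun i => (t i).2.1, fun i => (t i).2.2, h1, h2⟩
  have gP : ∀ i ∈ T, ∀ W : Finset ℕ, #W ≤ 2 → ∃ t, Good L (F i) t ∧ ¬ (L t.1 ∩ L t.2.1 ⊆ W) :=
    fun i hi W hW => good_P L (F i) m (hF i hi) (hL i hi) (h0 i hi) (hu i hi) W hW
  have base : ∀ i ∈ T, ∃ t, Good L (F i) t := fun i hi => by
    obtain ⟨t, ht, _⟩ := gP i hi ∅ (by simp)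
    exact ⟨t, ht⟩
  by_cases h3 : #T = 3
  · have hm5 := hm h3
    have gN : ∀ i ∈ T, ∀ W : Finset ℕ, #W ≤ m + 2 →
        ∃ t, Good L (F i) t ∧ ¬ (L t.1 ∩ L t.2.1 ∪ L t.2.2 ⊆ W) :=
      fun i hi W hW => good_N L (F i) m (hF i hi) (hL i hi) (h0 i hi) (hu i hi) hm5 W hW
    have cardN : ∀ i ∈ T, ∀ t, Good L (F i) t → m + 2 ≤ #(L t.1 ∩ L t.2.1 ∪ L t.2.2) := by
      intro i hi t ht
      obtain ⟨hFi, -, -, -, hp⟩ := ht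
      rw [card_pair_union, hL i hi t.2.2 (by rw [hFi]; simp)]
      · omega
      · ext γ
        obtain ⟨v, hv, hγ⟩ := h0 i hi γ
        rw [hFi] at hv
        simp only [Finset.mem_insert, Finset.mem_singleton] at hv
        rcases hv with rfl | rfl | rfl <;> simp [hγ]
    have big : ∀ (A W : Finset ℕ) (n : ℕ), n ≤ #A → n ≤ #W → (#W ≤ n → ¬ A ⊆ W) →
        n + 1 ≤ #(W ∪ A) := by
      intro A W n hA hW h
      by_contra hlt
      have l1 : #W ≤ #(W ∪ A) := Finset.card_le_card Finset.subset_union_left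
      refine h (by omega) ?_
      have : W = W ∪ A := Finset.eq_of_subset_of_card_le Finset.subset_union_left (by omega)
      rw [this]
      exact Finset.subset_union_right
    obtain ⟨i1, i2, i3, h12, h13, h23, rfl⟩ := Finset.card_eq_three.1 h3
    obtain ⟨t2, ht2⟩ := base i2 (by simp)
    have e1 : ∃ t, Good L (F i1) t ∧ m + 3 ≤
        #((L t2.1 ∩ L t2.2.1 ∪ L t2.2.2) ∪ (L t.1 ∩ L t.2.1 ∪ L t.2.2)) := by
      have c2 := cardN i2 (by simp) t2 ht2
      by_cases hW : #(L t2.1 ∩ L t2.2.1 ∪ L t2.2.2) ≤ m + 2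
      · obtain ⟨t, ht, hn⟩ := gN i1 (by simp) _ hW
        exact ⟨t, ht, big _ _ (m + 2) (cardN i1 (by simp) t ht) c2 (fun _ => hn)⟩
      · obtain ⟨t, ht⟩ := base i1 (by simp)
        refine ⟨t, ht, ?_⟩
        exact le_trans (by omega) (Finset.card_le_card Finset.subset_union_left)
    obtain ⟨t1, ht1, hb1⟩ := e1
    have e3 : ∃ t, Good L (F i3) t ∧ 3 ≤ #((L t1.1 ∩ L t1.2.1) ∪ (L t.1 ∩ L t.2.1)) := by
      have c2 := ht1.2.2.2.2
      by_cases hW : #(L t1.1 ∩ L t1.2.1) ≤ 2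
      · obtain ⟨t, ht, hn⟩ := gP i3 (by simp) _ hW
        exact ⟨t, ht, big _ _ 2 ht.2.2.2.2 c2 (fun _ => hn)⟩
      · obtain ⟨t, ht⟩ := base i3 (by simp)
        refine ⟨t, ht, ?_⟩
        exact le_trans (by omega) (Finset.card_le_card Finset.subset_union_left)
    obtain ⟨t3, ht3, hb3⟩ := e3
    have v1 : (fun i => if i = i1 then t1 else if i = i2 then t2 else t3) i1 = t1 := by simp
    have v2 : (fun i => if i = i1 then t1 else if i = i2 then t2 else t3) i2 = t2 := by
      simp [h12.symm]
    have v3 : (fun i => if i = i1 then t1 else if i = i2 then t2 else t3) i3 = t3 := by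
      simp [h13.symm, h23.symm]
    generalize (fun i => if i = i1 then t1 else if i = i2 then t2 else t3) = t at v1 v2 v3
    refine ⟨t, ?_, fun _ => ⟨hb1.trans (Finset.card_le_card ?_),
      hb3.trans (Finset.card_le_card ?_)⟩⟩
    · intro i hi
      simp only [Finset.mem_insert, Finset.mem_singleton] at hi
      rcases hi with rfl | rfl | rfl
      · rwa [v1]
      · rwa [v2]
      · rwa [v3]
    · refine Finset.union_subset ?_ ?_
      · rw [← v2]
        exact Finset.subset_biUnion_of_mem
          (fun i => L (t i).1 ∩ L (t i).2.1 ∪ L (t i).2.2) (by simp)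
      · rw [← v1]
        exact Finset.subset_biUnion_of_mem
          (fun i => L (t i).1 ∩ L (t i).2.1 ∪ L (t i).2.2) (by simp)
    · refine Finset.union_subset ?_ ?_
      · rw [← v1]
        exact Finset.subset_biUnion_of_mem (fun i => L (t i).1 ∩ L (t i).2.1) (by simp)
      · rw [← v3]
        exact Finset.subset_biUnion_of_mem (fun i => L (t i).1 ∩ L (t i).2.1) (by simp)
  · obtain ⟨v0⟩ := (inferInstance : Nonempty V)
    have : ∀ i, ∃ t, i ∈ T → Good L (F i) t := by
      intro i
      by_cases hi : i ∈ T
      · obtain ⟨t, ht⟩ := base i hi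
        exact ⟨t, fun _ => ht⟩
      · exact ⟨(v0, v0, v0), fun h => absurd h hi⟩
    choose t ht using this
    exact ⟨t, ht, fun h => absurd h h3⟩

/-- The merging step: no part of size at least two has a common color. -/
lemma merge_step {V ι : Type*} [Fintype V] [DecidableEq V] [DecidableEq ι] (π : V → ι)
    (F : ι → Finset V) (hFm : ∀ i v, v ∈ F i ↔ π v = i)
    (I : Finset ι) (hs : ∀ i ∈ I, #(F i) = 1 ∨ #(F i) = 2 ∨ #(F i) = 3)
    (h1 : #{i ∈ I | #(F i) = 1} = 2) (h3 : #{i ∈ I | #(F i) = 3} ≤ 3)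
    (U : Finset V) (hU : ∀ v, v ∈ U ↔ π v ∈ I)
    (L : V → Finset ℕ) (hL : ∀ v ∈ U, #(L v) = #I) (hpot : #(U.biUnion L) < #U)
    (h0 : ∀ i ∈ I, 2 ≤ #(F i) → ∀ γ, ∃ v ∈ F i, γ ∉ L v) : Col π U L := by
  classical
  set T := I.filter (fun i => #(F i) = 3) with hTdef
  set m := #I with hm
  have hFU : ∀ i ∈ I, F i ⊆ U := by
    intro i hi v hv
    rw [hU, (hFm i v).1 hv]; exact hi
  have hTI : T ⊆ I := Finset.filter_subset _ _
  -- count the vertices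
  have fib : ∀ S ⊆ U, #S = ∑ i ∈ I, #(S.filter (fun v => π v = i)) := by
    intro S hS
    exact Finset.card_eq_sum_card_fiberwise (fun v hv => (hU v).1 (hS hv))
  have hUF : ∀ i ∈ I, U.filter (fun v => π v = i) = F i := by
    intro i hi
    ext v
    rw [Finset.mem_filter, hFm, hU]
    exact ⟨fun h => h.2, fun h => ⟨h ▸ hi, h⟩⟩
  have hUcard : #U + 2 = 2 * m + #T := by
    have h2m : 2 * m = ∑ i ∈ I, 2 := by simp [hm, mul_comm]
    have h11 : (2 : ℕ) = ∑ i ∈ I, if #(F i) = 1 then 1 else 0 := by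
      rw [← Finset.card_filter, h1]
    have hTc : #T = ∑ i ∈ I, if #(F i) = 3 then 1 else 0 := by
      rw [hTdef, Finset.card_filter]
    have hUs : #U = ∑ i ∈ I, #(F i) := by
      rw [fib U Subset.rfl]
      exact Finset.sum_congr rfl (fun i hi => by rw [hUF i hi])
    rw [h2m, hUs, hTc, ← Finset.sum_add_distrib]
    refine (congrArg (fun t => ∑ i ∈ I, #(F i) + t) h11).trans ?_
    rw [← Finset.sum_add_distrib]
    refine Finset.sum_congr rfl fun i hi => ?_
    rcases hs i hi with h | h | h <;> simp [h]
  have hmT : #T + 2 ≤ m := by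
    rw [← h1, hm, hTdef, ← Finset.card_union_of_disjoint]
    · exact Finset.card_le_card (Finset.union_subset (Finset.filter_subset _ _)
        (Finset.filter_subset _ _))
    · rw [Finset.disjoint_left]
      intro i hi hi'
      simp only [Finset.mem_filter] at hi hi'
      omega
  have hTF : ∀ i ∈ T, #(F i) = 3 := fun i hi => (Finset.mem_filter.1 hi).2
  have hUne : Nonempty V := by
    have : 0 < #U := by omega
    obtain ⟨v, _⟩ := Finset.card_pos.1 this
    exact ⟨v⟩
  obtain ⟨x, y, z, hg, hg3⟩ := exists_choice L F T m h3 (by omega) hTF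
    (fun i hi v hv => hL v (hFU i (hTI hi) hv))
    (fun i hi => h0 i (hTI hi) (by rw [hTF i hi]; omega))
    (fun i hi => by
      have := Finset.card_le_card (Finset.biUnion_subset_biUnion_of_subset_left L (hFU i (hTI hi)))
      omega)
  have hx : ∀ i ∈ T, π (x i) = i := fun i hi => by
    rw [← hFm, (hg i hi).1]; simp
  have hy : ∀ i ∈ T, π (y i) = i := fun i hi => by
    rw [← hFm, (hg i hi).1]; simp
  have hz : ∀ i ∈ T, π (z i) = i := fun i hi => by
    rw [← hFm, (hg i hi).1]; simp
  have hxy : ∀ i ∈ T, x i ≠ y i := fun i hi => (hg i hi).2.1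
  have hxz : ∀ i ∈ T, x i ≠ z i := fun i hi => (hg i hi).2.2.1
  have hp : ∀ i ∈ T, 2 ≤ #(L (x i) ∩ L (y i)) := fun i hi => (hg i hi).2.2.2.2
  set R := U \ T.image y with hR
  have hRcard : #R + 2 = 2 * m := by
    have hinj : Set.InjOn y (T : Set ι) := by
      intro i hi j hj hij
      rw [← hy i hi, ← hy j hj, hij]
    have hsub : T.image y ⊆ U := by
      intro v hv
      obtain ⟨i, hi, rfl⟩ := Finset.mem_image.1 hv
      rw [hU, hy i hi]; exact hTI hi
    have : #R + #(T.image y) = #U := Finset.card_sdiff_add_card_eq_card hsub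
    rw [Finset.card_image_of_injOn hinj] at this
    omega
  set M : V → Finset ℕ := fun v =>
    if π v ∈ T ∧ v = x (π v) then L v ∩ L (y (π v)) else L v with hM
  have hMx : ∀ i ∈ T, M (x i) = L (x i) ∩ L (y i) := by
    intro i hi
    simp [hM, hx i hi, hi]
  have hMn : ∀ v, ¬ (π v ∈ T ∧ v = x (π v)) → M v = L v := by
    intro v hv
    simp only [hM, if_neg hv]
  have hMz : ∀ i ∈ T, M (z i) = L (z i) := by
    intro i hi
    apply hMn
    rw [hz i hi]
    exact fun h => hxz i hi h.2.symm
  have hall : ∀ S ⊆ R, #S ≤ #(S.biUnion M) := by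
    intro S hSR
    have hSU : S ⊆ U := hSR.trans Finset.sdiff_subset
    have hsubM : ∀ v ∈ S, M v ⊆ S.biUnion M := fun v hv => Finset.subset_biUnion_of_mem M hv
    have hSc : #S ≤ #R := Finset.card_le_card hSR
    by_cases c1 : ∃ i ∈ I, #(F i) = 2 ∧ F i ⊆ S
    · obtain ⟨i, hi, hF2, hFS⟩ := c1
      obtain ⟨u, v, huv, hFe⟩ := Finset.card_eq_two.1 hF2
      have hiT : i ∉ T := fun h => by have := hTF i h; omega
      have hu : π u = i := by rw [← hFm, hFe]; simp
      have hv : π v = i := by rw [← hFm, hFe]; simp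
      have huS : u ∈ S := hFS (by rw [hFe]; simp)
      have hvS : v ∈ S := hFS (by rw [hFe]; simp)
      have d : Disjoint (L u) (L v) := by
        rw [Finset.disjoint_left]
        intro γ hγ hγ'
        obtain ⟨w, hw, hwγ⟩ := h0 i hi (by omega) γ
        rw [hFe] at hw
        simp only [Finset.mem_insert, Finset.mem_singleton] at hw
        rcases hw with rfl | rfl <;> contradiction
      have hc := Finset.card_le_card (Finset.union_subset (hsubM u huS) (hsubM v hvS))
      rw [hMn u (by rw [hu]; exact fun h => hiT h.1),
        hMn v (by rw [hv]; exact fun h => hiT h.1), Finset.card_union_of_disjoint d,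
        hL u (hSU huS), hL v (hSU hvS)] at hc
      omega
    -- bounds for each part
    have b2 : ∀ i ∈ T, S.filter (fun v => π v = i) ⊆ {x i, z i} := by
      intro i hi v hv
      simp only [Finset.mem_filter] at hv
      have hvF := (hFm i v).2 hv.2
      rw [(hg i hi).1] at hvF
      have hvR := hSR hv.1
      simp only [hR, Finset.mem_sdiff, Finset.mem_image, not_exists, not_and] at hvR
      have := hvR.2 i hi
      simp only [Finset.mem_insert, Finset.mem_singleton] at hvF ⊢
      rcases hvF with h | h | h
      · exact Or.inl h
      · exact absurd h.symm this
      · exact Or.inr h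
    have b2' : ∀ i ∈ T, #(S.filter (fun v => π v = i)) ≤ 2 := fun i hi =>
      (Finset.card_le_card (b2 i hi)).trans Finset.card_le_two
    have full : ∀ i ∈ T, 2 ≤ #(S.filter (fun v => π v = i)) → x i ∈ S ∧ z i ∈ S := by
      intro i hi hc
      have he := Finset.eq_of_subset_of_card_le (b2 i hi) (Finset.card_le_two.trans hc)
      have ex : x i ∈ S.filter (fun v => π v = i) := by rw [he]; simp
      have ez : z i ∈ S.filter (fun v => π v = i) := by rw [he]; simp
      exact ⟨(Finset.mem_filter.1 ex).1, (Finset.mem_filter.1 ez).1⟩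
    have b1 : ∀ i ∈ I, i ∉ T → #(S.filter (fun v => π v = i)) ≤ 1 := by
      intro i hi hiT
      have hsub : S.filter (fun v => π v = i) ⊆ F i := by
        intro v hv
        exact (hFm i v).2 (Finset.mem_filter.1 hv).2
      have hc := Finset.card_le_card hsub
      rcases hs i hi with h | h | h
      · omega
      · by_contra hlt
        have he := Finset.eq_of_subset_of_card_le hsub (by omega)
        exact c1 ⟨i, hi, h, he ▸ Finset.filter_subset _ _⟩
      · exact absurd (Finset.mem_filter.2 ⟨hi, h⟩) hiT
    have hSsum := fib S hSU
    have hNsub : ∀ i ∈ T, x i ∈ S → z i ∈ S →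
        L (x i) ∩ L (y i) ∪ L (z i) ⊆ S.biUnion M := by
      intro i hi hxS hzS
      rw [← hMx i hi, ← hMz i hi]
      exact Finset.union_subset (hsubM _ hxS) (hsubM _ hzS)
    by_cases c2 : ∀ v ∈ S, π v ∈ T ∧ v = x (π v)
    · -- only merged pairs
      have hST : S ⊆ T.image x := fun v hv =>
        Finset.mem_image.2 ⟨π v, (c2 v hv).1, (c2 v hv).2.symm⟩
      have hc : #S ≤ #T := (Finset.card_le_card hST).trans Finset.card_image_le
      rcases S.eq_empty_or_nonempty with rfl | ⟨v, hv⟩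
      · simp
      have h2 : 2 ≤ #(S.biUnion M) := by
        have := Finset.card_le_card (hsubM v hv)
        obtain ⟨ha, hb⟩ := c2 v hv
        rw [hb, hMx _ ha] at this
        exact (hp _ ha).trans this
      by_cases hS2 : #S ≤ 2
      · omega
      have hT3 : #T = 3 := by omega
      have he : S = T.image x :=
        Finset.eq_of_subset_of_card_le hST (Finset.card_image_le.trans (by omega))
      have h4 := (hg3 hT3).2
      have h5 : (T.biUnion fun i => L (x i) ∩ L (y i)) ⊆ S.biUnion M := by
        refine Finset.biUnion_subset.2 fun i hi => ?_
        rw [← hMx i hi]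
        exact hsubM _ (by rw [he]; exact Finset.mem_image_of_mem x hi)
      have := Finset.card_le_card h5
      omega
    · push Not at c2
      obtain ⟨v, hv, hvn⟩ := c2
      have hNm : m ≤ #(S.biUnion M) := by
        have := Finset.card_le_card (hsubM v hv)
        rwa [hMn v (fun h => hvn h.1 h.2), hL v (hSU hv)] at this
      by_cases c3 : ∃ i ∈ T, 2 ≤ #(S.filter (fun v => π v = i))
      · obtain ⟨i, hi, hci⟩ := c3
        obtain ⟨hxS, hzS⟩ := full i hi hci
        have hN2 : m + 2 ≤ #(S.biUnion M) := by
          have hcc := Finset.card_le_card (hNsub i hi hxS hzS)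
          rw [card_pair_union, hL (z i) (hSU hzS)] at hcc
          · have := hp i hi
            omega
          · ext γ
            obtain ⟨w, hw, hγ⟩ := h0 i (hTI hi) (by rw [hTF i hi]; omega) γ
            rw [(hg i hi).1] at hw
            simp only [Finset.mem_insert, Finset.mem_singleton] at hw
            rcases hw with rfl | rfl | rfl <;> simp [hγ]
        by_cases hS2 : #S ≤ m + 2
        · omega
        have hle : ∀ i ∈ I, #(S.filter (fun v => π v = i)) ≤ 1 + if i ∈ T then 1 else 0 := by
          intro i hi
          by_cases hiT : i ∈ T
          · simp only [hiT, if_true]; exact b2' i hiT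
          · simp only [hiT, if_false]; exact b1 i hi hiT
        have htot : ∑ i ∈ I, (1 + if i ∈ T then 1 else 0) = m + #T := by
          rw [Finset.sum_add_distrib, ← Finset.card_filter, Finset.filter_mem_eq_inter,
            Finset.inter_eq_right.2 hTI]
          simp [hm]
        have hT3 : #T = 3 := by
          have := Finset.sum_le_sum hle
          omega
        have hfull : ∀ j ∈ T, x j ∈ S ∧ z j ∈ S := by
          intro j hj
          apply full j hj
          by_contra hlt
          have := Finset.sum_lt_sum hle ⟨j, hTI hj, by simp only [hj, if_true]; omega⟩
          omega
        have h4 := (hg3 hT3).1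
        have h5 : (T.biUnion fun i => L (x i) ∩ L (y i) ∪ L (z i)) ⊆ S.biUnion M :=
          Finset.biUnion_subset.2 fun i hi => hNsub i hi (hfull i hi).1 (hfull i hi).2
        have h6 := Finset.card_le_card h5
        have := Finset.sum_le_sum hle
        omega
      · push Not at c3
        have : #S ≤ ∑ i ∈ I, 1 := by
          rw [hSsum]
          refine Finset.sum_le_sum fun i hi => ?_
          by_cases hiT : i ∈ T
          · have := c3 i hiT; omega
          · exact b1 i hi hiT
        simp only [Finset.sum_const, smul_eq_mul, mul_one] at this
        omega
  obtain ⟨f, hf1, hf2⟩ := hallF R M hall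
  -- the representative of a vertex
  set r : V → V := fun v => if π v ∈ T ∧ v = y (π v) then x (π v) else v with hr
  have hrπ : ∀ v, π (r v) = π v := by
    intro v
    by_cases h : π v ∈ T ∧ v = y (π v)
    · simp only [hr, if_pos h]; exact hx _ h.1
    · simp only [hr, if_neg h]
  have hrR : ∀ v ∈ U, r v ∈ R := by
    intro v hv
    rw [hR, Finset.mem_sdiff]
    refine ⟨by rw [hU, hrπ, ← hU]; exact hv, ?_⟩
    intro hmem
    obtain ⟨i, hi, hyi⟩ := Finset.mem_image.1 hmem
    have hiv : i = π v := by rw [← hrπ v, ← hyi, hy i hi]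
    subst hiv
    by_cases h : π v ∈ T ∧ v = y (π v)
    · simp only [hr, if_pos h] at hyi
      exact hxy _ hi hyi.symm
    · simp only [hr, if_neg h] at hyi
      exact h ⟨hi, hyi.symm⟩
  refine ⟨fun v => f (r v), ?_, ?_⟩
  · intro v hv
    have h := hf1 _ (hrR v hv)
    by_cases hc : π v ∈ T ∧ v = y (π v)
    · have hrv : r v = x (π v) := by simp only [hr, if_pos hc]
      show f (r v) ∈ L v
      rw [hrv] at h ⊢
      rw [hMx _ hc.1] at h
      have := (Finset.mem_inter.1 h).2
      rwa [← hc.2] at this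
    · have hrv : r v = v := by simp only [hr, if_neg hc]
      show f (r v) ∈ L v
      rw [hrv] at h ⊢
      by_cases hc' : π v ∈ T ∧ v = x (π v)
      · simp only [hM, if_pos hc'] at h
        exact (Finset.mem_inter.1 h).1
      · rwa [hMn v hc'] at h
  · intro u hu w hw hne he
    have := hf2 _ (hrR u hu) _ (hrR w hw) he
    exact hne (by rw [← hrπ u, this, hrπ w])

/-- The induction over the set of parts. -/
lemma main_ind {V ι : Type*} [Fintype V] [DecidableEq V] [DecidableEq ι] (π : V → ι)
    (F : ι → Finset V) (hFm : ∀ i v, v ∈ F i ↔ π v = i) (n : ℕ) :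
    ∀ I : Finset ι, #I = n → (∀ i ∈ I, #(F i) = 1 ∨ #(F i) = 2 ∨ #(F i) = 3) →
      #{i ∈ I | #(F i) = 1} = 2 → #{i ∈ I | #(F i) = 3} ≤ 3 →
      ∀ L : V → Finset ℕ, (∀ v, π v ∈ I → n ≤ #(L v)) →
        Col π (univ.filter fun v => π v ∈ I) L := by
  classical
  induction n with
  | zero =>
    intro I hI hs h1
    rw [Finset.card_eq_zero] at hI
    subst hI
    simp at h1
  | succ n ih =>
    intro I hI hs h1 h3 L hL
    refine smallPot π _ (n + 1) ?_ L (fun v hv => hL v (Finset.mem_filter.1 hv).2)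
    clear hL L
    intro L hL hpot
    by_cases h0 : ∀ i ∈ I, 2 ≤ #(F i) → ∀ γ, ∃ v ∈ F i, γ ∉ L v
    · exact merge_step π F hFm I hs h1 h3 _ (by simp) L (by rw [hI]; exact hL) hpot h0
    push Not at h0
    obtain ⟨i, hi, hF2, γ, hγ⟩ := h0
    have hsub : ∀ k, #{j ∈ I.erase i | #(F j) = k} ≤ #{j ∈ I | #(F j) = k} := fun k =>
      Finset.card_le_card (Finset.filter_subset_filter _ (Finset.erase_subset _ _))
    obtain ⟨c, hc1, hc2⟩ := ih (I.erase i) (by rw [Finset.card_erase_of_mem hi, hI]; rfl)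
      (fun j hj => hs j (Finset.mem_of_mem_erase hj))
      (by
        rw [← h1]
        congr 1
        ext j
        simp only [Finset.mem_filter, Finset.mem_erase]
        constructor
        · exact fun h => ⟨h.1.2, h.2⟩
        · refine fun h => ⟨⟨?_, h.1⟩, h.2⟩
          rintro rfl
          omega)
      ((hsub 3).trans h3)
      (fun v => (L v).erase γ)
      (by
        intro v hv
        have h := hL v (by simp [Finset.mem_of_mem_erase hv])
        have := Finset.pred_card_le_card_erase (s := L v) (a := γ)
        omega)
    have key : ∀ v, π v ∈ I → π v ≠ i → c v ∈ L v ∧ c v ≠ γ := by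
      intro v hv hvi
      have := hc1 v (by simp [hv, hvi])
      rw [Finset.mem_erase] at this
      exact ⟨this.2, this.1⟩
    refine ⟨fun v => if π v = i then γ else c v, ?_, ?_⟩
    · intro v hv
      have hvI := (Finset.mem_filter.1 hv).2
      by_cases h : π v = i
      · simp only [h, if_true]
        exact hγ v ((hFm i v).2 h)
      · simp only [h, if_false]
        exact (key v hvI h).1
    · intro u hu w hw hne
      have huI := (Finset.mem_filter.1 hu).2
      have hwI := (Finset.mem_filter.1 hw).2
      by_cases h : π u = i <;> by_cases h' : π w = i <;> simp only [h, h', if_true, if_false]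
      · exact absurd (h.trans h'.symm) hne
      · exact (key w hwI h').2.symm
      · exact (key u huI h).2
      · exact hc2 u (by simp [huI, h]) w (by simp [hwI, h']) hne

end OhbaAux

/-- Ohba's conjecture holds for `K_{3*3,2*(k-5),1*2}`: its choice number is exactly `k`. -/
theorem choiceNumber_K3x3_2xk5_1x2 (k : ℕ) (hk : 5 ≤ k) :
    IsLeast {n | Choosable (SimpleGraph.completeMultipartiteGraph
      (fun i : Fin k => Fin (if i.val < 3 then 3
        else if i.val < k - 2 then 2 else 1))) n} k := by
  constructor
  · intro L hL
    have hfc : ∀ i : Fin k, Finset.card ((Finset.univ.filter fun v : (Σ i : Fin k, Fin (if i.val < 3 then 3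
        else if i.val < k - 2 then 2 else 1)) => v.1 = i)) = (if i.val < 3 then 3
        else if i.val < k - 2 then 2 else 1) := by
      intro i
      have : (Finset.univ.filter fun v : (Σ i : Fin k, Fin (if i.val < 3 then 3
          else if i.val < k - 2 then 2 else 1)) => v.1 = i) =
          (Finset.univ : Finset (Fin (if i.val < 3 then 3
            else if i.val < k - 2 then 2 else 1))).map (Function.Embedding.sigmaMk i) := by
        ext ⟨j, a⟩
        simp only [Finset.mem_filter, Finset.mem_univ, true_and, Finset.mem_map,
          Function.Embedding.sigmaMk_apply]
        constructor
        · rintro rfl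
          exact ⟨a, rfl⟩
        · rintro ⟨b, hb⟩
          exact (congrArg Sigma.fst hb).symm
      rw [this, Finset.card_map, Finset.card_univ, Fintype.card_fin]
    obtain ⟨c, h1, h2⟩ := OhbaAux.main_ind
      (fun v : (Σ i : Fin k, Fin (if i.val < 3 then 3
        else if i.val < k - 2 then 2 else 1)) => v.1)
      (fun i => Finset.univ.filter fun v => v.1 = i) (by simp) k Finset.univ (by simp)
      (by
        intro i _
        rw [hfc]
        split_ifs <;> simp)
      (by
        simp only [hfc]
        have : (Finset.univ.filter fun i : Fin k => (if i.val < 3 then 3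
            else if i.val < k - 2 then 2 else 1) = 1) =
            {⟨k - 2, by omega⟩, ⟨k - 1, by omega⟩} := by
          ext i
          simp only [Finset.mem_filter, Finset.mem_univ, true_and, Finset.mem_insert,
            Finset.mem_singleton, Fin.ext_iff]
          have := i.2
          split_ifs <;> omega
        rw [this, Finset.card_pair]
        simp only [ne_eq, Fin.ext_iff]
        omega)
      (by
        simp only [hfc]
        have : (Finset.univ.filter fun i : Fin k => (if i.val < 3 then 3
            else if i.val < k - 2 then 2 else 1) = 3) ⊆
            {⟨0, by omega⟩, ⟨1, by omega⟩, ⟨2, by omega⟩} := by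
          intro i
          simp only [Finset.mem_filter, Finset.mem_univ, true_and, Finset.mem_insert,
            Finset.mem_singleton, Fin.ext_iff]
          split_ifs <;> omega
        exact (Finset.card_le_card this).trans Finset.card_le_three)
      L (fun v _ => hL v)
    refine ⟨c, fun v => h1 v (by simp), ?_⟩
    intro u w huw
    exact h2 u (by simp) w (by simp) huw
  · intro n hn
    obtain ⟨c, h1, h2⟩ := hn (fun _ => Finset.range n) (by simp)
    have hpos : ∀ i : Fin k, 0 < (if i.val < 3 then 3
        else if i.val < k - 2 then 2 else 1) := by
      intro i
      split_ifs <;> simp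
    have hcard := Finset.card_le_card_of_injOn (s := (Finset.univ : Finset (Fin k)))
      (t := Finset.range n) (fun i => c ⟨i, ⟨0, hpos i⟩⟩) (fun i _ => h1 _) (by
        intro i _ j _ hij
        by_contra hne
        exact h2 (u := ⟨i, ⟨0, hpos i⟩⟩) (w := ⟨j, ⟨0, hpos j⟩⟩) hne hij)
    simpa using hcard
end

section
/- (Kierstead) For every integer k ≥ 1, the complete k-partite graph K_{3*k}, in which every part has exactly 3 vertices, has choice number exactly ⌈(4k−1)/3⌉. -/
open Finset

namespace KThree

/-- Hall's theorem relative to a finite index set. -/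
lemma hall_on {α : Type*} [DecidableEq α] (V : Finset α) (M : α → Finset ℕ)
    (h : ∀ S ⊆ V, S.card ≤ (S.biUnion M).card) :
    ∃ f : α → ℕ, (∀ x ∈ V, f x ∈ M x) ∧ Set.InjOn f V := by
  have := (Finset.all_card_le_biUnion_card_iff_exists_injective
    (fun x : {x // x ∈ V} => M x.1)).1 (by
      intro S
      have h1 := h (S.image Subtype.val) (by
        intro x hx
        obtain ⟨y, -, rfl⟩ := Finset.mem_image.1 hx
        exact y.2)
      rw [Finset.card_image_of_injective _ Subtype.val_injective, Finset.image_biUnion] at h1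
      exact h1)
  obtain ⟨f, hf, hm⟩ := this
  refine ⟨fun x => if hx : x ∈ V then f ⟨x, hx⟩ else 0, ?_, ?_⟩
  · intro x hx
    simp only [hx, dif_pos]
    exact hm ⟨x, hx⟩
  · intro x hx y hy hxy
    have hx' : x ∈ V := hx
    have hy' : y ∈ V := hy
    simp only [hx', hy', dif_pos] at hxy
    exact congrArg Subtype.val (hf hxy)

/-- Greedy choice of distinct representatives avoiding a set. -/
lemma greedy {ι : Type*} [DecidableEq ι] (T : Finset ι) (F : ι → Finset ℕ) (X : Finset ℕ)
    (h : ∀ i ∈ T, T.card + X.card ≤ (F i).card) :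
    ∃ f : ι → ℕ, (∀ i ∈ T, f i ∈ F i ∧ f i ∉ X) ∧ Set.InjOn f T := by
  obtain ⟨f, hf, hi⟩ := hall_on T (fun i => F i \ X) (by
    intro S hS
    rcases S.eq_empty_or_nonempty with rfl | ⟨i, hi⟩
    · simp
    · have h1 := h i (hS hi)
      have h2 := Finset.le_card_sdiff X (F i)
      have h3 := Finset.card_le_card (Finset.subset_biUnion_of_mem (fun i => F i \ X) hi)
      have h4 := Finset.card_le_card hS
      omega)
  exact ⟨f, fun i hi => by simpa using hf i hi, hi⟩

/-- `h`-index selection. -/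
lemma hindex {ι : Type*} [DecidableEq ι] (P : Finset ι) (o : ι → ℕ) (m : ℕ) :
    ∃ T ⊆ P, T.card ≤ m ∧ (∀ i ∈ T, T.card ≤ o i) ∧
      (T.card < m → ∀ i ∈ P \ T, o i ≤ T.card) := by
  classical
  -- largest `t ≤ m` with at least `t` indices of value at least `t`
  let Q : ℕ → Prop := fun t => t ≤ (P.filter (fun i => t ≤ o i)).card
  have hQ0 : Q 0 := Nat.zero_le _
  let t := Nat.findGreatest Q m
  have ht : Q t := Nat.findGreatest_spec (Nat.zero_le m) hQ0
  have htm : t ≤ m := Nat.findGreatest_le m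
  by_cases hlt : t < m
  · have hnot : ¬ Q (t + 1) := Nat.findGreatest_is_greatest (Nat.lt_succ_self _) hlt
    have hle : (P.filter (fun i => t + 1 ≤ o i)).card ≤ t := by
      simp only [Q] at hnot; omega
    obtain ⟨T, h1, h2, h3⟩ := Finset.exists_subsuperset_card_eq
      (s := P.filter (fun i => t + 1 ≤ o i)) (t := P.filter (fun i => t ≤ o i)) (n := t)
      (by intro i hi; simp only [Finset.mem_filter] at hi ⊢; exact ⟨hi.1, by omega⟩) hle ht
    refine ⟨T, fun i hi => (Finset.mem_filter.1 (h2 hi)).1, by omega, ?_, ?_⟩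
    · intro i hi; rw [h3]; exact (Finset.mem_filter.1 (h2 hi)).2
    · intro _ i hi
      rw [Finset.mem_sdiff] at hi
      by_contra hc
      exact hi.2 (h1 (Finset.mem_filter.2 ⟨hi.1, by omega⟩))
  · obtain ⟨T, h2, h3⟩ := Finset.exists_subset_card_eq ht
    refine ⟨T, fun i hi => (Finset.mem_filter.1 (h2 hi)).1, by omega, ?_, ?_⟩
    · intro i hi; rw [h3]; exact (Finset.mem_filter.1 (h2 hi)).2
    · intro h; omega

/-- Proper coloring of the parts in `P` from the lists `L`. -/
def Col {ι : Type*} (P : Finset ι) (L : ι → Fin 3 → Finset ℕ) : Prop :=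
  ∃ c : ι → Fin 3 → ℕ, (∀ i ∈ P, ∀ j, c i j ∈ L i j) ∧
    ∀ i ∈ P, ∀ i' ∈ P, i ≠ i' → ∀ j j', c i j ≠ c i' j'

/-- Coloring is invariant under permuting vertices inside parts. -/
lemma col_perm {ι : Type*} (P : Finset ι) (L : ι → Fin 3 → Finset ℕ)
    (e : ι → Equiv.Perm (Fin 3)) (h : Col P (fun i j => L i (e i j))) : Col P L := by
  obtain ⟨c, h1, h2⟩ := h
  refine ⟨fun i j => c i ((e i).symm j), ?_, ?_⟩
  · intro i hi j
    simpa using h1 i hi ((e i).symm j)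
  · intro i hi i' hi' hne j j'
    exact h2 i hi i' hi' hne _ _

lemma card_two {A B X : Finset ℕ} {s o r : ℕ} (hA : s ≤ A.card) (hB : s ≤ B.card)
    (hAB : (A ∩ B).card ≤ o) (hX : X.card ≤ r) : 2 * s ≤ (A \ X ∪ B \ X).card + o + r := by
  have h1 := Finset.card_union_add_card_inter A B
  have h2 := Finset.le_card_sdiff X (A ∪ B)
  rw [← Finset.union_sdiff_distrib]
  omega

lemma card_three {A B C X : Finset ℕ} {s o r : ℕ} (hA : s ≤ A.card) (hB : s ≤ B.card)
    (hC : s ≤ C.card) (hAB : (A ∩ B).card ≤ o) (hAC : (A ∩ C).card ≤ o) (hBC : (B ∩ C).card ≤ o)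
    (hX : X.card ≤ r) : 3 * s ≤ (A \ X ∪ B \ X ∪ C \ X).card + 3 * o + r := by
  have h1 := Finset.card_union_add_card_inter A B
  have h3 := Finset.card_union_add_card_inter (A ∪ B) C
  have h4 : ((A ∪ B) ∩ C).card ≤ (A ∩ C).card + (B ∩ C).card := by
    rw [Finset.union_inter_distrib_right]; exact Finset.card_union_le _ _
  have h2 := Finset.le_card_sdiff X (A ∪ B ∪ C)
  rw [← Finset.union_sdiff_distrib, ← Finset.union_sdiff_distrib]
  omega

set_option maxHeartbeats 1000000 in
/-- The core step: merge and apply Hall. -/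
lemma core {ι : Type*} [DecidableEq ι] (U T R : Finset ι) (L : ι → Fin 3 → Finset ℕ)
    (hUT : Disjoint U T) (hUR : Disjoint U R) (hTR : Disjoint T R)
    (s : ℕ) (hs : s = U.card + T.card + R.card + R.card)
    (hs3 : U.card + T.card ≤ 2 * R.card + 1)
    (hL : ∀ i ∈ U ∪ T ∪ R, ∀ j, s ≤ (L i j).card)
    (hU : ∀ i ∈ U, ∀ j j', j ≠ j' → (L i j ∩ L i j').card ≤ T.card)
    (hT : ∀ i ∈ T, T.card ≤ (L i 1 ∩ L i 2).card)
    (hT0 : ∀ i ∈ T, Disjoint (L i 0) (L i 1 ∩ L i 2))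
    (f : ι → ℕ) (hfT : ∀ i ∈ T, f i ∈ L i 1 ∩ L i 2) (hfR : ∀ i ∈ R, f i ∈ L i 1 ∩ L i 2)
    (hinj : Set.InjOn f (T ∪ R : Finset ι)) :
    Col (U ∪ T ∪ R) L := by
  classical
  set X := R.image f with hX
  have hXc : X.card ≤ R.card := Finset.card_image_le
  set W : ι → Finset (Fin 3) := fun i => if i ∈ U then univ else if i ∈ T then {0, 1} else {0}
    with hW
  set V : Finset (ι × Fin 3) := (U ∪ T ∪ R).biUnion (fun i => (W i).image (fun j => (i, j)))
    with hV
  have memV : ∀ i j, (i, j) ∈ V ↔ i ∈ U ∪ T ∪ R ∧ j ∈ W i := by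
    intro i j
    simp only [hV, Finset.mem_biUnion, Finset.mem_image, Prod.mk.injEq]
    constructor
    · rintro ⟨a, ha, b, hb, rfl, rfl⟩; exact ⟨ha, hb⟩
    · rintro ⟨h1, h2⟩; exact ⟨i, h1, j, h2, rfl, rfl⟩
  set M : ι × Fin 3 → Finset ℕ := fun p =>
    if p.1 ∈ T ∧ p.2 = 1 then (L p.1 1 ∩ L p.1 2) \ X else L p.1 p.2 \ X with hM
  have hTU : ∀ i ∈ T, i ∉ U := fun i hi hi' => Finset.disjoint_left.1 hUT hi' hi
  have hUT' : ∀ i ∈ U, i ∉ T := fun i hi hi' => Finset.disjoint_left.1 hUT hi hi'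
  have hRU : ∀ i ∈ R, i ∉ U := fun i hi hi' => Finset.disjoint_left.1 hUR hi' hi
  have hRT : ∀ i ∈ R, i ∉ T := fun i hi hi' => Finset.disjoint_left.1 hTR hi' hi
  -- counting
  have count : ∀ S ⊆ V, ∀ a b c : ℕ,
      (∀ i ∈ U, (S.filter (fun p => p.1 = i)).card ≤ a) →
      (∀ i ∈ T, (S.filter (fun p => p.1 = i)).card ≤ b) →
      (∀ i ∈ R, (S.filter (fun p => p.1 = i)).card ≤ c) →
      S.card ≤ U.card * a + T.card * b + R.card * c := by
    intro S hS a b c ha hb hc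
    have h1 : S.card = ∑ i ∈ U ∪ T ∪ R, (S.filter (fun p => p.1 = i)).card :=
      Finset.card_eq_sum_card_fiberwise (fun p hp => by
        have := (memV p.1 p.2).1 (hS hp)
        exact this.1)
    rw [h1, Finset.sum_union (by
      rw [Finset.disjoint_union_left]; exact ⟨hUR, hTR⟩), Finset.sum_union hUT]
    have e1 := Finset.sum_le_card_nsmul U _ a ha
    have e2 := Finset.sum_le_card_nsmul T _ b hb
    have e3 := Finset.sum_le_card_nsmul R _ c hc
    simp only [smul_eq_mul] at e1 e2 e3
    omega
  have fib : ∀ S ⊆ V, ∀ i, (S.filter (fun p => p.1 = i)).card ≤ (W i).card := by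
    intro S hS i
    apply Finset.card_le_card_of_injOn Prod.snd
    · rintro ⟨a, b⟩ hp
      have hp' := Finset.mem_filter.1 (Finset.mem_coe.1 hp)
      have h2 := hp'.2
      simp only at h2
      subst h2
      exact ((memV _ _).1 (hS hp'.1)).2
    · rintro ⟨a, b⟩ hp ⟨a', b'⟩ hp' h
      have h1 := (Finset.mem_filter.1 (Finset.mem_coe.1 hp)).2
      have h2 := (Finset.mem_filter.1 (Finset.mem_coe.1 hp')).2
      simp only at h1 h2 h
      subst h1 h2 h; rfl
  have fibU : ∀ S ⊆ V, ∀ i ∈ U, (S.filter (fun p => p.1 = i)).card ≤ 3 := by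
    intro S hS i hi
    refine (fib S hS i).trans ?_
    simp [hW, hi]
  have fibT : ∀ S ⊆ V, ∀ i ∈ T, (S.filter (fun p => p.1 = i)).card ≤ 2 := by
    intro S hS i hi
    refine (fib S hS i).trans ?_
    simp [hW, hi, hTU i hi]
  have fibR : ∀ S ⊆ V, ∀ i ∈ R, (S.filter (fun p => p.1 = i)).card ≤ 1 := by
    intro S hS i hi
    refine (fib S hS i).trans ?_
    simp [hW, hRU i hi, hRT i hi]
  have two : ∀ S : Finset (ι × Fin 3), ∀ i, 1 < (S.filter (fun p => p.1 = i)).card →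
      ∃ j j', j ≠ j' ∧ (i, j) ∈ S ∧ (i, j') ∈ S := by
    intro S i h
    obtain ⟨⟨a, b⟩, ha, ⟨a', b'⟩, ha', hne⟩ := Finset.one_lt_card.1 h
    simp only [Finset.mem_filter] at ha ha'
    obtain ⟨h1, rfl⟩ := ha
    obtain ⟨h2, rfl⟩ := ha'
    exact ⟨b, b', fun h => hne (by rw [h]), h1, h2⟩
  have hsub : ∀ S : Finset (ι × Fin 3), ∀ p ∈ S, M p ⊆ S.biUnion M := fun S p hp =>
    Finset.subset_biUnion_of_mem M hp
  have hMU : ∀ i ∈ U, ∀ j, M (i, j) = L i j \ X := by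
    intro i hi j; simp [hM, hUT' i hi]
  -- Hall's condition
  have hall : ∀ S ⊆ V, S.card ≤ (S.biUnion M).card := by
    intro S hS
    by_cases hA : ∃ i ∈ U, 1 < (S.filter (fun p => p.1 = i)).card
    · obtain ⟨i, hi, h1⟩ := hA
      have hLi := hL i (by simp [hi])
      have hUpos : 0 < U.card := Finset.card_pos.2 ⟨i, hi⟩
      by_cases hall3 : ∀ j, (i, j) ∈ S
      · have hc := count S hS 3 2 1 (fibU S hS) (fibT S hS) (fibR S hS)
        have h3 := card_three (hLi 0) (hLi 1) (hLi 2) (hU i hi 0 1 (by decide))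
          (hU i hi 0 2 (by decide)) (hU i hi 1 2 (by decide)) hXc
        have h4 : (L i 0 \ X ∪ L i 1 \ X ∪ L i 2 \ X) ⊆ S.biUnion M := by
          refine Finset.union_subset (Finset.union_subset ?_ ?_) ?_ <;>
          · rw [← hMU i hi]; exact hsub S _ (hall3 _)
        have h5 := Finset.card_le_card h4
        omega
      · push Not at hall3
        obtain ⟨j₀, hj₀⟩ := hall3
        obtain ⟨j, j', hne, hj, hj'⟩ := two S i h1
        have hin : (i, j₀) ∈ V := (memV _ _).2 ⟨by simp [hi], by simp [hW, hi]⟩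
        have hSV : insert (i, j₀) S ⊆ V := Finset.insert_subset hin hS
        have hc := count _ hSV 3 2 1 (fibU _ hSV) (fibT _ hSV) (fibR _ hSV)
        rw [Finset.card_insert_of_notMem hj₀] at hc
        have h3 := card_two (hLi j) (hLi j') (hU i hi j j' hne) hXc
        have h4 : (L i j \ X ∪ L i j' \ X) ⊆ S.biUnion M := by
          refine Finset.union_subset ?_ ?_
          · rw [← hMU i hi]; exact hsub S _ hj
          · rw [← hMU i hi]; exact hsub S _ hj'
        have h5 := Finset.card_le_card h4
        omega
    push Not at hA
    by_cases hB : ∃ i ∈ T, 1 < (S.filter (fun p => p.1 = i)).card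
    · obtain ⟨i, hi, h1⟩ := hB
      have hLi := hL i (by simp [hi])
      have hc := count S hS 1 2 1 hA (fibT S hS) (fibR S hS)
      obtain ⟨j, j', hne, hj, hj'⟩ := two S i h1
      have w1 := ((memV _ _).1 (hS hj)).2
      have w2 := ((memV _ _).1 (hS hj')).2
      simp only [hW, hTU i hi, hi, if_true, if_false, Finset.mem_insert,
        Finset.mem_singleton] at w1 w2
      have hboth : (i, (0 : Fin 3)) ∈ S ∧ (i, (1 : Fin 3)) ∈ S := by
        rcases w1 with rfl | rfl <;> rcases w2 with rfl | rfl
        · exact absurd rfl hne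
        · exact ⟨hj, hj'⟩
        · exact ⟨hj', hj⟩
        · exact absurd rfl hne
      have m0 : M (i, 0) = L i 0 \ X := by simp [hM]
      have m1 : M (i, 1) = (L i 1 ∩ L i 2) \ X := by simp [hM, hi]
      have h4 : (L i 0 ∪ (L i 1 ∩ L i 2)) \ X ⊆ S.biUnion M := by
        rw [Finset.union_sdiff_distrib]
        refine Finset.union_subset ?_ ?_
        · rw [← m0]; exact hsub S _ hboth.1
        · rw [← m1]; exact hsub S _ hboth.2
      have h5 := Finset.card_le_card h4
      have h6 := Finset.le_card_sdiff X (L i 0 ∪ (L i 1 ∩ L i 2))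
      rw [Finset.card_union_of_disjoint (hT0 i hi)] at h6
      have h7 := hT i hi
      have h8 := hLi 0
      omega
    push Not at hB
    have hc := count S hS 1 1 1 hA hB (fibR S hS)
    by_cases hC : ∃ p ∈ S, ¬ (p.1 ∈ T ∧ p.2 = 1)
    · obtain ⟨p, hp, hn⟩ := hC
      have hm : M p = L p.1 p.2 \ X := by simp only [hM, hn, if_false]
      have h5 := Finset.card_le_card (hsub S p hp)
      rw [hm] at h5
      have h6 := Finset.le_card_sdiff X (L p.1 p.2)
      have h7 := hL p.1 ((memV p.1 p.2).1 (hS hp)).1 p.2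
      omega
    push Not at hC
    apply Finset.card_le_card_of_injOn (fun p => f p.1)
    · intro p hp
      obtain ⟨h1, h2⟩ := hC p hp
      refine hsub S p hp ?_
      simp only [hM, h1, h2, true_and, if_true, Finset.mem_sdiff]
      refine ⟨hfT _ h1, ?_⟩
      intro hx
      obtain ⟨i', hi', he⟩ := Finset.mem_image.1 hx
      have := hinj (by simp [hi']) (by simp [h1]) he
      exact hRT i' hi' (this ▸ h1)
    · intro p hp q hq he
      obtain ⟨h1, h2⟩ := hC p hp
      obtain ⟨h3, h4⟩ := hC q hq
      have := hinj (by simp [h1]) (by simp [h3]) he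
      exact Prod.ext this (h2.trans h4.symm)
  obtain ⟨g, hg, hgi⟩ := hall_on V M hall
  have hgX : ∀ p ∈ V, g p ∉ X := by
    intro p hp
    have := hg p hp
    simp only [hM] at this
    split_ifs at this <;> exact (Finset.mem_sdiff.1 this).2
  let φ : ι → Fin 3 → Fin 3 := fun i j => if i ∈ T ∧ j = 2 then 1 else j
  have hφ : ∀ i ∈ U ∪ T ∪ R, ∀ j, ¬ (i ∈ R ∧ j ≠ 0) → (i, φ i j) ∈ V := by
    intro i hi j hn
    refine (memV _ _).2 ⟨hi, ?_⟩
    simp only [Finset.mem_union] at hi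
    rcases hi with (hi | hi) | hi
    · simp [hW, hi]
    · simp only [hW, hTU i hi, hi, φ, if_true, if_false, true_and]
      fin_cases j <;> simp
    · have : j = 0 := by by_contra hj; exact hn ⟨hi, hj⟩
      subst this
      simp [hW, hRU i hi, hRT i hi, φ]
  refine ⟨fun i j => if i ∈ R ∧ j ≠ 0 then f i else g (i, φ i j), ?_, ?_⟩
  · intro i hi j
    by_cases h : i ∈ R ∧ j ≠ 0
    · simp only [h, if_true, ne_eq, not_false_eq_true, and_self]
      have := Finset.mem_inter.1 (hfR i h.1)
      have hj := h.2
      fin_cases j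
      · exact absurd rfl hj
      · exact this.1
      · exact this.2
    · simp only [if_neg h]
      have h1 := hg _ (hφ i hi j h)
      by_cases hiT : i ∈ T
      · rcases (by fin_cases j <;> simp : j = 0 ∨ j = 1 ∨ j = 2) with rfl | rfl | rfl
        · have hp : φ i 0 = 0 := if_neg (fun h => absurd h.2 (by decide))
          rw [hp] at h1 ⊢
          have hm : M (i, 0) = L i 0 \ X := if_neg (fun h => absurd h.2 (by simp))
          rw [hm] at h1
          exact (Finset.mem_sdiff.1 h1).1
        · have hp : φ i 1 = 1 := if_neg (fun h => absurd h.2 (by decide))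
          rw [hp] at h1 ⊢
          have hm : M (i, 1) = (L i 1 ∩ L i 2) \ X := if_pos ⟨hiT, rfl⟩
          rw [hm] at h1
          exact (Finset.mem_inter.1 (Finset.mem_sdiff.1 h1).1).1
        · have hp : φ i 2 = 1 := if_pos ⟨hiT, rfl⟩
          rw [hp] at h1 ⊢
          have hm : M (i, 1) = (L i 1 ∩ L i 2) \ X := if_pos ⟨hiT, rfl⟩
          rw [hm] at h1
          exact (Finset.mem_inter.1 (Finset.mem_sdiff.1 h1).1).2
      · have hp : φ i j = j := if_neg (fun h => hiT h.1)
        rw [hp] at h1 ⊢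
        have hm : M (i, j) = L i j \ X := if_neg (fun h => hiT h.1)
        rw [hm] at h1
        exact (Finset.mem_sdiff.1 h1).1
  · intro i hi i' hi' hne j j'
    by_cases h : i ∈ R ∧ j ≠ 0 <;> by_cases h' : i' ∈ R ∧ j' ≠ 0
    · simp only [if_pos h, if_pos h']
      intro he
      exact hne (hinj (by simp [h.1]) (by simp [h'.1]) he)
    · simp only [if_pos h, if_neg h']
      intro he
      exact hgX _ (hφ i' hi' j' h') (he ▸ Finset.mem_image_of_mem f h.1)
    · simp only [if_neg h, if_pos h']
      intro he
      exact hgX _ (hφ i hi j h) (he ▸ Finset.mem_image_of_mem f h'.1)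
    · simp only [if_neg h, if_neg h']
      intro he
      exact hne (congrArg Prod.fst (hgi (hφ i hi j h) (hφ i' hi' j' h') he))

/-- Case with few colors and no color common to all three vertices of a part. -/
lemma small {ι : Type*} [DecidableEq ι] (P : Finset ι) (L : ι → Fin 3 → Finset ℕ)
    (hL : ∀ i ∈ P, ∀ j, (4 * P.card + 1) / 3 ≤ (L i j).card)
    (pot : Finset ℕ) (hpot : ∀ i ∈ P, ∀ j, L i j ⊆ pot) (hpc : pot.card < 3 * P.card)
    (hno : ∀ i ∈ P, ∀ x, ¬ ∀ j, x ∈ L i j) : Col P L := by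
  classical
  obtain ⟨s, hs⟩ : ∃ s, s = (4 * P.card + 1) / 3 := ⟨_, rfl⟩
  rw [← hs] at hL
  obtain ⟨r, hr⟩ : ∃ r, s = P.card + r := ⟨s - P.card, by omega⟩
  -- best pairs
  have hbest : ∀ i, ∃ e : Equiv.Perm (Fin 3), ∀ e' : Equiv.Perm (Fin 3),
      (L i (e' 1) ∩ L i (e' 2)).card ≤ (L i (e 1) ∩ L i (e 2)).card := by
    intro i
    obtain ⟨e, -, he⟩ := Finset.exists_max_image (univ : Finset (Equiv.Perm (Fin 3)))
      (fun e => (L i (e 1) ∩ L i (e 2)).card) ⟨1, by simp⟩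
    exact ⟨e, fun e' => he e' (by simp)⟩
  choose e he using hbest
  obtain ⟨T, hTP, hTm, hTo, hTrest⟩ := hindex P
    (fun i => (L i (e i 1) ∩ L i (e i 2)).card) (P.card - r)
  have hTPc := Finset.card_sdiff_add_card_eq_card hTP
  obtain ⟨R, hRsub, hRc⟩ := Finset.exists_subset_card_eq (s := P \ T) (n := r) (by omega)
  -- doubly covered colors
  let D : ι → Finset ℕ := fun i => (L i 0 ∩ L i 1) ∪ (L i 0 ∩ L i 2) ∪ (L i 1 ∩ L i 2)
  have hD : ∀ i ∈ P, P.card ≤ (D i).card := by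
    intro i hi
    have h1 := Finset.card_union_add_card_inter (L i 0) (L i 1)
    have h2 := Finset.card_union_add_card_inter (L i 0 ∪ L i 1) (L i 2)
    have h3 : (L i 0 ∪ L i 1 ∪ L i 2).card ≤ pot.card := Finset.card_le_card
      (Finset.union_subset (Finset.union_subset (hpot i hi 0) (hpot i hi 1)) (hpot i hi 2))
    have h4 : (D i).card = (L i 0 ∩ L i 1).card + ((L i 0 ∪ L i 1) ∩ L i 2).card := by
      rw [← Finset.card_union_of_disjoint]
      · congr 1
        ext x; simp only [D, Finset.mem_union, Finset.mem_inter]; tauto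
      · rw [Finset.disjoint_left]
        intro x hx hx'
        simp only [Finset.mem_union, Finset.mem_inter] at hx hx'
        exact hno i hi x (by intro j; fin_cases j; exacts [hx.1, hx.2, hx'.2])
    have := hL i hi 0
    have := hL i hi 1
    have := hL i hi 2
    omega
  obtain ⟨f₁, hf₁, hi₁⟩ := greedy T (fun i => L i (e i 1) ∩ L i (e i 2)) ∅
    (by simpa using hTo)
  have himg : (T.image f₁).card ≤ T.card := Finset.card_image_le
  obtain ⟨f₂, hf₂, hi₂⟩ := greedy R D (T.image f₁) (by
    intro i hi
    have := hD i (Finset.mem_sdiff.1 (hRsub hi)).1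
    omega)
  have hRT : ∀ i ∈ R, i ∉ T := fun i hi => (Finset.mem_sdiff.1 (hRsub hi)).2
  have hRP : ∀ i ∈ R, i ∈ P := fun i hi => (Finset.mem_sdiff.1 (hRsub hi)).1
  -- permutations for special parts
  have hsp : ∀ i, ∃ e' : Equiv.Perm (Fin 3), i ∈ R → f₂ i ∈ L i (e' 1) ∩ L i (e' 2) := by
    intro i
    by_cases hi : i ∈ R
    · have := (hf₂ i hi).1
      simp only [D, Finset.mem_union] at this
      rcases this with (h | h) | h
      · obtain ⟨e', h1, h2⟩ : ∃ e' : Equiv.Perm (Fin 3), e' 1 = 0 ∧ e' 2 = 1 := by decide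
        exact ⟨e', fun _ => by rw [h1, h2]; exact h⟩
      · obtain ⟨e', h1, h2⟩ : ∃ e' : Equiv.Perm (Fin 3), e' 1 = 0 ∧ e' 2 = 2 := by decide
        exact ⟨e', fun _ => by rw [h1, h2]; exact h⟩
      · exact ⟨1, fun _ => by simpa using h⟩
    · exact ⟨1, fun h => absurd h hi⟩
  choose e₂ he₂ using hsp
  let E : ι → Equiv.Perm (Fin 3) := fun i => if i ∈ R then e₂ i else e i
  apply col_perm P L E
  let f : ι → ℕ := fun i => if i ∈ R then f₂ i else f₁ i
  have hTR : ∀ i ∈ T, i ∉ R := fun i hi hi' => hRT i hi' hi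
  have hU : P = ((P \ T) \ R) ∪ T ∪ R := by
    ext x
    simp only [Finset.mem_union, Finset.mem_sdiff]
    constructor
    · intro h; tauto
    · rintro ((h | h) | h)
      exacts [h.1.1, hTP h, hRP x h]
  have hUc := Finset.card_sdiff_add_card_eq_card hRsub
  have key := core ((P \ T) \ R) T R (fun i j => L i (E i j))
    (by rw [Finset.disjoint_left]; intro x hx; simp only [Finset.mem_sdiff] at hx; exact hx.1.2)
    (by rw [Finset.disjoint_left]; intro x hx; simp only [Finset.mem_sdiff] at hx; exact hx.2)
    (by rw [Finset.disjoint_left]; exact hTR)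
    s (by omega) (by omega)
    (by intro i hi j; rw [← hU] at hi; exact hL i hi _)
    (by
      intro i hi j j' hne
      simp only [Finset.mem_sdiff] at hi
      have hpos : 0 < ((P \ T) \ R).card :=
        Finset.card_pos.2 ⟨i, by simp only [Finset.mem_sdiff]; exact hi⟩
      have h1 := hTrest (by omega) i (by simp only [Finset.mem_sdiff]; exact hi.1)
      obtain ⟨e', h2, h3⟩ : ∃ e' : Equiv.Perm (Fin 3), e' 1 = E i j ∧ e' 2 = E i j' := by
        have hne' : E i j ≠ E i j' := fun h => hne ((E i).injective h)
        generalize E i j = a at *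
        generalize E i j' = b at *
        revert a b
        decide
      have h4 := he i e'
      rw [h2, h3] at h4
      exact h4.trans h1)
    (by
      intro i hi
      simp only [E, hTR i hi, if_false]
      exact hTo i hi)
    (by
      intro i hi
      rw [Finset.disjoint_left]
      intro x hx hx'
      rw [Finset.mem_inter] at hx'
      apply hno i (hTP hi) x
      intro j
      obtain ⟨j', rfl⟩ := (E i).surjective j
      fin_cases j'
      exacts [hx, hx'.1, hx'.2])
    f
    (by
      intro i hi
      simp only [f, E, hTR i hi, if_false]
      exact (hf₁ i hi).1)
    (by
      intro i hi
      simp only [f, E, hi, if_true]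
      exact he₂ i hi)
    (by
      intro i hi i' hi' hh
      simp only [Finset.coe_union, Set.mem_union, Finset.mem_coe] at hi hi'
      rcases hi with hi | hi <;> rcases hi' with hi' | hi'
      · simp only [f, hTR i hi, hTR i' hi', if_false] at hh
        exact hi₁ hi hi' hh
      · simp only [f, hTR i hi, hi', if_false, if_true] at hh
        exact absurd (hh ▸ Finset.mem_image_of_mem f₁ hi) (hf₂ i' hi').2
      · simp only [f, hTR i' hi', hi, if_false, if_true] at hh
        exact absurd (hh ▸ Finset.mem_image_of_mem f₁ hi') (hf₂ i hi).2
      · simp only [f, hi, hi', if_true] at hh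
        exact hi₂ hi hi' hh)
  rw [← hU] at key
  exact key

/-- Reduction to few colors (Kierstead's small pot lemma). -/
lemma pot_reduction {ι : Type*} [DecidableEq ι] (P : Finset ι) (s : ℕ)
    (hsmall : ∀ L : ι → Fin 3 → Finset ℕ, (∀ i ∈ P, ∀ j, s ≤ (L i j).card) →
      ∀ pot : Finset ℕ, (∀ i ∈ P, ∀ j, L i j ⊆ pot) → pot.card < 3 * P.card → Col P L)
    (L : ι → Fin 3 → Finset ℕ) (hL : ∀ i ∈ P, ∀ j, s ≤ (L i j).card) : Col P L := by
  classical
  set V : Finset (ι × Fin 3) := P ×ˢ univ with hV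
  have hVc : V.card = 3 * P.card := by simp [hV, Finset.card_product, mul_comm]
  have memV : ∀ i j, (i, j) ∈ V ↔ i ∈ P := by intro i j; simp [hV]
  set N : Finset (ι × Fin 3) → Finset ℕ := fun S => S.biUnion (fun p => L p.1 p.2) with hN
  -- a largest set that is not over-satisfied
  obtain ⟨S, hS, hmax⟩ := Finset.exists_max_image
    (V.powerset.filter (fun S => S = ∅ ∨ (N S).card < S.card)) Finset.card
    ⟨∅, by simp⟩
  simp only [Finset.mem_filter, Finset.mem_powerset] at hS hmax
  obtain ⟨hSV, hS⟩ := hS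
  -- the remaining vertices are matched outside the colors of `S`
  obtain ⟨g, hg, hgi⟩ := hall_on (V \ S) (fun p => L p.1 p.2 \ N S) (by
    intro Q hQ
    rcases Q.eq_empty_or_nonempty with rfl | hQne
    · simp
    by_contra hc
    push Not at hc
    have hdisj : Disjoint S Q := by
      rw [Finset.disjoint_left]
      intro x hx hx'
      exact (Finset.mem_sdiff.1 (hQ hx')).2 hx
    have hQpos := Finset.card_pos.2 hQne
    have hcu := Finset.card_union_of_disjoint hdisj
    have hNu : N (S ∪ Q) ⊆ N S ∪ Q.biUnion (fun p => L p.1 p.2 \ N S) := by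
      intro x hx
      simp only [hN, Finset.mem_biUnion, Finset.mem_union, Finset.mem_sdiff] at hx ⊢
      obtain ⟨p, hp, hxp⟩ := hx
      by_cases h : ∃ a ∈ S, x ∈ L a.1 a.2
      · exact Or.inl h
      · rcases hp with hp | hp
        · exact Or.inl ⟨p, hp, hxp⟩
        · exact Or.inr ⟨p, hp, hxp, h⟩
    have h1 := (Finset.card_le_card hNu).trans (Finset.card_union_le _ _)
    have hNS : (N S).card ≤ S.card := by
      rcases hS with rfl | h
      · simp [hN]
      · exact h.le
    have := hmax (S ∪ Q) ⟨Finset.union_subset hSV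
      (fun x hx => (Finset.mem_sdiff.1 (hQ hx)).1), Or.inr (by omega)⟩
    omega)
  have hgN : ∀ p ∈ V \ S, g p ∈ L p.1 p.2 ∧ g p ∉ N S := fun p hp =>
    Finset.mem_sdiff.1 (hg p hp)
  -- color `S`
  obtain ⟨c, hc1, hc2⟩ : ∃ c : ι → Fin 3 → ℕ, (∀ i j, (i, j) ∈ S → c i j ∈ L i j) ∧
      ∀ i i' j j', (i, j) ∈ S → (i', j') ∈ S → i ≠ i' → c i j ≠ c i' j' := by
    rcases hS with rfl | hS
    · exact ⟨fun _ _ => 0, by simp, by simp⟩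
    · have hne : S.Nonempty := by
        rw [← Finset.card_pos]; omega
      obtain ⟨p, hp⟩ := hne
      obtain ⟨c, h1, h2⟩ := hsmall
        (fun i j => if (i, j) ∈ S then L i j else L p.1 p.2)
        (by
          intro i hi j
          split_ifs
          · exact hL i hi j
          · exact hL p.1 ((memV p.1 p.2).1 (hSV hp)) p.2)
        (N S)
        (by
          intro i hi j
          split_ifs with h
          · exact Finset.subset_biUnion_of_mem (fun p : ι × Fin 3 => L p.1 p.2) h
          · exact Finset.subset_biUnion_of_mem (fun p : ι × Fin 3 => L p.1 p.2) hp)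
        (by
          have := Finset.card_le_card hSV
          omega)
      refine ⟨c, ?_, ?_⟩
      · intro i j h
        have := h1 i ((memV i j).1 (hSV h)) j
        simpa [h] using this
      · intro i i' j j' h h' hne
        exact h2 i ((memV i j).1 (hSV h)) i' ((memV i' j').1 (hSV h')) hne j j'
  have hcN : ∀ i j, (i, j) ∈ S → c i j ∈ N S := fun i j h =>
    Finset.mem_biUnion.2 ⟨(i, j), h, hc1 i j h⟩
  have hVS : ∀ i ∈ P, ∀ j, (i, j) ∉ S → (i, j) ∈ V \ S := fun i hi j h =>
    Finset.mem_sdiff.2 ⟨(memV i j).2 hi, h⟩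
  refine ⟨fun i j => if (i, j) ∈ S then c i j else g (i, j), ?_, ?_⟩
  · intro i hi j
    dsimp only
    split_ifs with h
    · exact hc1 i j h
    · exact (hgN _ (hVS i hi j h)).1
  · intro i hi i' hi' hne j j'
    dsimp only
    split_ifs with h h' h'
    · exact hc2 i i' j j' h h' hne
    · intro he
      exact (hgN _ (hVS i' hi' j' h')).2 (he ▸ hcN i j h)
    · intro he
      exact (hgN _ (hVS i hi j h)).2 (he ▸ hcN i' j' h')
    · intro he
      exact hne (congrArg Prod.fst (hgi (hVS i hi j h) (hVS i' hi' j' h') he))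

/-- Upper bound. -/
lemma upper {ι : Type*} [DecidableEq ι] (n : ℕ) : ∀ (P : Finset ι), P.card = n →
    ∀ (L : ι → Fin 3 → Finset ℕ), (∀ i ∈ P, ∀ j, (4 * P.card + 1) / 3 ≤ (L i j).card) →
    Col P L := by
  induction n with
  | zero =>
    intro P hP L _
    rw [Finset.card_eq_zero] at hP
    subst hP
    exact ⟨fun _ _ => 0, by simp, by simp⟩
  | succ n ih =>
    intro P hP
    apply pot_reduction
    intro L hL pot hpot hpc
    by_cases hno : ∀ i ∈ P, ∀ x, ¬ ∀ j, x ∈ L i j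
    · exact small P L hL pot hpot hpc hno
    push Not at hno
    obtain ⟨i₀, hi₀, x, hx⟩ := hno
    have hcard := Finset.card_erase_of_mem hi₀
    obtain ⟨c, h1, h2⟩ := ih (P.erase i₀) (by omega) (fun i j => L i j \ {x}) (by
      intro i hi j
      have h3 := hL i (Finset.mem_of_mem_erase hi) j
      have h4 := Finset.le_card_sdiff {x} (L i j)
      rw [Finset.card_singleton] at h4
      omega)
    have h1' : ∀ i ∈ P, i ≠ i₀ → ∀ j, c i j ∈ L i j ∧ c i j ≠ x := by
      intro i hi hne j
      simpa using h1 i (Finset.mem_erase.2 ⟨hne, hi⟩) j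
    refine ⟨fun i j => if i = i₀ then x else c i j, ?_, ?_⟩
    · intro i hi j
      dsimp only
      split_ifs with h
      · subst h; exact hx j
      · exact (h1' i hi h j).1
    · intro i hi i' hi' hne j j'
      dsimp only
      split_ifs with h h' h'
      · exact absurd (h.trans h'.symm) hne
      · exact (h1' i' hi' h' j').2.symm
      · exact (h1' i hi h j).2
      · exact h2 i (Finset.mem_erase.2 ⟨h, hi⟩) i' (Finset.mem_erase.2 ⟨h', hi'⟩) hne j j'

lemma card_mod (j : ℕ) (hj : j < 3) (N : ℕ) :
    2 * N / 3 ≤ ((Finset.range N).filter (fun x => x % 3 ≠ j)).card := by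
  induction N using Nat.strong_induction_on with
  | _ N ih =>
    match N with
    | 0 => simp
    | 1 => simp
    | 2 => interval_cases j <;> decide
    | N + 3 =>
      have h := ih N (by omega)
      rw [Finset.range_add_one, Finset.range_add_one, Finset.range_add_one]
      simp only [Finset.filter_insert]
      have hm : N % 3 = 0 ∨ N % 3 = 1 ∨ N % 3 = 2 := by omega
      split_ifs <;> first
        | omega
        | (repeat rw [Finset.card_insert_of_notMem (by simp)]
           omega)

/-- Lower bound. -/
lemma lower (k : ℕ) (n : ℕ) (hn : 3 * n + 2 ≤ 4 * k) :
    ¬ Choosable (SimpleGraph.completeMultipartiteGraph (fun _ : Fin k => Fin 3)) n := by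
  intro h
  obtain ⟨c, h1, h2⟩ := h
    (fun v => (Finset.range (2 * k - 1)).filter (fun x => x % 3 ≠ (v.2 : ℕ))) (by
      intro v
      have := card_mod (v.2 : ℕ) v.2.2 (2 * k - 1)
      exact le_trans (by omega) this)
  simp only [Finset.mem_filter, Finset.mem_range] at h1
  have h3 : ∀ i : Fin k, ∃ j : Fin 3, c ⟨i, 0⟩ ≠ c ⟨i, j⟩ := by
    intro i
    by_contra hc
    push Not at hc
    have hlt : c ⟨i, 0⟩ % 3 < 3 := Nat.mod_lt _ (by norm_num)
    have := (h1 ⟨i, ⟨c ⟨i, 0⟩ % 3, hlt⟩⟩).2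
    rw [← hc] at this
    exact this rfl
  choose j hj using h3
  have hcard := Finset.card_le_card_of_injOn (s := (univ : Finset (Fin k × Bool)))
    (t := Finset.range (2 * k - 1))
    (fun p => c ⟨p.1, if p.2 then 0 else j p.1⟩)
    (by intro p _; exact Finset.mem_coe.2 (Finset.mem_range.2 (h1 _).1))
    (by
      rintro ⟨a, b⟩ - ⟨a', b'⟩ - he
      simp only at he
      by_cases haa : a = a'
      · subst haa
        have := hj a
        cases b <;> cases b'
        · rfl
        · exact absurd he.symm this
        · exact absurd he this
        · rfl
      · exact absurd he (h2 (by simpa using haa)))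
  simp at hcard
  omega

end KThree

/-- Kierstead: `Ch(K_{3*k}) = ⌈(4k-1)/3⌉`. -/
theorem choiceNumber_K3xk (k : ℕ) (hk : 1 ≤ k) :
    IsLeast {n | Choosable (SimpleGraph.completeMultipartiteGraph
      (fun _ : Fin k => Fin 3)) n} ((4 * k - 1 + 2) / 3) := by
  constructor
  · intro L hL
    obtain ⟨c, h1, h2⟩ := KThree.upper k (Finset.univ : Finset (Fin k)) (by simp)
      (fun i j => L ⟨i, j⟩) (by
        intro i _ j
        have := hL ⟨i, j⟩
        simp only [Finset.card_univ, Fintype.card_fin]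
        exact le_trans (by omega) this)
    refine ⟨fun v => c v.1 v.2, fun v => h1 v.1 (by simp) v.2, ?_⟩
    intro u w huw
    exact h2 u.1 (by simp) w.1 (by simp) (by simpa using huw) _ _
  · intro n hn
    by_contra hlt
    push Not at hlt
    exact KThree.lower k n (by omega) hn
end
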